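/- If G is a finite simple graph that is 5/2-critical and G is not isomorphic to the 3-cycle C3, then 5·n(G) − 4·e(G) ≤ 2, where n(G) and e(G) denote the number of vertices and edges of G. -/

import Mathlib

open SimpleGraph

/-- The degree of a vertex, as the cardinality of its neighbor set. -/
noncomputable def deg {V : Type} (G : SimpleGraph V) (v : V) : ℕ :=
  (G.neighborSet v).ncard

/-- The potential of a finite graph: `5 n(G) - 4 e(G)`. -/
noncomputable def pot {V : Type} [Fintype V] (G : SimpleGraph V) : ℤ :=
  5 * (Fintype.card V : ℤ) - 4 * (G.edgeSet.ncard : ℤ)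

/-- A graph is 5/2-critical if it has no homomorphism to the 5-cycle
but every proper subgraph has one. -/
def Critical52 {V : Type} (G : SimpleGraph V) : Prop :=
  IsEmpty (G →g cycleGraph 5) ∧
  ∀ H : G.Subgraph, H ≠ ⊤ → Nonempty (H.coe →g cycleGraph 5)

/-- The exceptional graph `E₁`: a 9-cycle `0 1 2 3 4 5 6 7 8` together
with a vertex `9` adjacent to `0`, `3` and `6`. -/
def E1 : SimpleGraph (Fin 10) := SimpleGraph.fromEdgeSet
  {s(0,1), s(1,2), s(2,3), s(3,4), s(4,5), s(5,6), s(6,7), s(7,8), s(8,0),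
   s(9,0), s(9,3), s(9,6)}

/-- The exceptional graph `E₂`: two 5-cycles `0 1 2 3 4` and `0 1 5 6 7`
sharing exactly the edge `01`, together with a path `3 8 9 6`. -/
def E2 : SimpleGraph (Fin 10) := SimpleGraph.fromEdgeSet
  {s(0,1), s(1,2), s(2,3), s(3,4), s(4,0),
   s(1,5), s(5,6), s(6,7), s(7,0),
   s(3,8), s(8,9), s(9,6)}

/-- A smallest counterexample: a 5/2-critical graph, not isomorphic to `C₃`, `E₁`, `E₂`,
with potential at least 2, such that every smaller 5/2-critical graph not isomorphic
to `C₃`, `E₁`, `E₂` has potential at most 1. -/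
def SmallestCex {V : Type} [Fintype V] (G : SimpleGraph V) : Prop :=
  Critical52 G ∧ IsEmpty (G ≃g cycleGraph 3) ∧ IsEmpty (G ≃g E1) ∧ IsEmpty (G ≃g E2) ∧
  2 ≤ pot G ∧
  ∀ (m : ℕ) (H : SimpleGraph (Fin m)), Critical52 H →
    IsEmpty (H ≃g cycleGraph 3) → IsEmpty (H ≃g E1) → IsEmpty (H ≃g E2) →
    m < Fintype.card V → pot H ≤ 1

/-- A string: a path of positive length whose endvertices have degree at least 3
and whose internal vertices have degree 2. A `k`-string is a string of length `k+1`. -/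
def IsString {V : Type} (G : SimpleGraph V) {u v : V} (p : G.Walk u v) : Prop :=
  p.IsPath ∧ 0 < p.length ∧ 3 ≤ deg G u ∧ 3 ≤ deg G v ∧
  ∀ w ∈ p.support, w ≠ u → w ≠ v → deg G w = 2

/-- `v` lies on a 5-cycle of `G`. -/
def InFiveCycle {V : Type} (G : SimpleGraph V) (v : V) : Prop :=
  ∃ (w : V) (c : G.Walk w w), c.IsCycle ∧ c.length = 5 ∧ v ∈ c.support

/-- `v` is a `(k₁,k₂,k₃)`-vertex: it has degree 3 and is the end of a `k₁`-string,
a `k₂`-string and a `k₃`-string leaving `v` through its three distinct edges. -/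
def IsVertex3 {V : Type} (G : SimpleGraph V) (v : V) (k1 k2 k3 : ℕ) : Prop :=
  deg G v = 3 ∧ ∃ (u1 u2 u3 : V) (p1 : G.Walk v u1) (p2 : G.Walk v u2) (p3 : G.Walk v u3),
    IsString G p1 ∧ IsString G p2 ∧ IsString G p3 ∧
    p1.getVert 1 ≠ p2.getVert 1 ∧ p1.getVert 1 ≠ p3.getVert 1 ∧ p2.getVert 1 ≠ p3.getVert 1 ∧
    p1.length = k1 + 1 ∧ p2.length = k2 + 1 ∧ p3.length = k3 + 1

/-- `v` is a `(k₁,k₂,k₃,k₄)`-vertex: it has degree 4 and is the end of strings of the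
corresponding lengths leaving `v` through its four distinct edges. -/
def IsVertex4 {V : Type} (G : SimpleGraph V) (v : V) (k1 k2 k3 k4 : ℕ) : Prop :=
  deg G v = 4 ∧ ∃ (u1 u2 u3 u4 : V) (p1 : G.Walk v u1) (p2 : G.Walk v u2)
    (p3 : G.Walk v u3) (p4 : G.Walk v u4),
    IsString G p1 ∧ IsString G p2 ∧ IsString G p3 ∧ IsString G p4 ∧
    p1.getVert 1 ≠ p2.getVert 1 ∧ p1.getVert 1 ≠ p3.getVert 1 ∧ p1.getVert 1 ≠ p4.getVert 1 ∧
    p2.getVert 1 ≠ p3.getVert 1 ∧ p2.getVert 1 ≠ p4.getVert 1 ∧ p3.getVert 1 ≠ p4.getVert 1 ∧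
    p1.length = k1 + 1 ∧ p2.length = k2 + 1 ∧ p3.length = k3 + 1 ∧ p4.length = k4 + 1

/-- `H` contains at least two distinct cycles, where cycles are counted as subgraphs,
i.e. two cycles are distinct if their edge sets differ. -/
def TwoDistinctCycles {V : Type} (H : SimpleGraph V) : Prop :=
  ∃ (v1 v2 : V) (c1 : H.Walk v1 v1) (c2 : H.Walk v2 v2),
    c1.IsCycle ∧ c2.IsCycle ∧ {e | e ∈ c1.edges} ≠ {e | e ∈ c2.edges}

/-- The degree of a 5-cycle (cell) `c` in `G`: the number of strings not contained in `c`
that intersect `c`, strings being counted by their edge sets. -/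
noncomputable def cellDegree {V : Type} (G : SimpleGraph V) {w : V} (c : G.Walk w w) : ℕ :=
  {S : Set (Sym2 V) | ∃ (u v : V) (p : G.Walk u v), IsString G p ∧ S = {e | e ∈ p.edges} ∧
    ¬ S ⊆ {e | e ∈ c.edges} ∧ ∃ x ∈ p.support, x ∈ c.support}.ncard

set_option linter.all false
set_option linter.unusedSectionVars false
set_option linter.unusedVariables false

namespace CG

/-- States of a node: the ten automorphisms of the pentagon. -/
abbrev St := Fin 5 × Bool
def val (g : St) (i : Fin 5) : Fin 5 := if g.2 then g.1 + i else g.1 - i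
def rel (k : Fin 3) (x y : Fin 5) : Bool :=
  if k = 0 then (x - y == 2 || x - y == 3)
  else if k = 1 then (x - y == 0 || x - y == 1 || x - y == 4)
  else x != y

structure Dart (N : Type) where
  s : N × Fin 5
  t : N × Fin 5
  k : Fin 3
deriving DecidableEq

def Dart.rev {N : Type} (d : Dart N) : Dart N := ⟨d.t, d.s, d.k⟩

def cost (k : Fin 3) : ℤ := 4 - (k.val : ℤ)

theorem rel_val : ∀ (k : Fin 3) (g : St) (x y : Fin 5),
    rel k (val g x) (val g y) = rel k x y := by decide +kernel
theorem rel_symm : ∀ (k : Fin 3) (x y : Fin 5), rel k x y = rel k y x := by decide +kernel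
theorem val_undo : ∀ (g x : St), ∃ y : St, ∀ i, val g (val y i) = val x i := by decide +kernel
theorem cost0 : cost 0 = 4 := rfl
theorem cost1 : cost 1 = 3 := rfl
theorem cost2 : cost 2 = 2 := rfl
theorem cost_ge : ∀ k, 2 ≤ cost k := by decide
theorem cost_le : ∀ k, cost k ≤ 4 := by decide
theorem cost_nonneg (k) : 0 ≤ cost k := by have := cost_ge k; omega

variable {N : Type} [DecidableEq N]

@[simp] theorem rev_rev (d : Dart N) : d.rev.rev = d := rfl
@[simp] theorem rev_s (d : Dart N) : d.rev.s = d.t := rfl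
@[simp] theorem rev_t (d : Dart N) : d.rev.t = d.s := rfl
@[simp] theorem rev_k (d : Dart N) : d.rev.k = d.k := rfl
theorem rev_inj : Function.Injective (Dart.rev : Dart N → Dart N) := fun a b h => by
  rw [← rev_rev a, h, rev_rev]

def Sym (D : Finset (Dart N)) : Prop := ∀ d ∈ D, d.rev ∈ D
def Loopless (D : Finset (Dart N)) : Prop := ∀ d ∈ D, d.s.1 ≠ d.t.1

def col (σ : N → St) (P : N × Fin 5) : Fin 5 := val (σ P.1) P.2

def Good (D : Finset (Dart N)) (A : Finset N) (σ : N → St) : Prop :=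
  ∀ d ∈ D, d.s.1 ∈ A → d.t.1 ∈ A → rel d.k (col σ d.s) (col σ d.t) = true

def Col (D : Finset (Dart N)) (A : Finset N) : Prop := ∃ σ, Good D A σ

def inn (D : Finset (Dart N)) (A : Finset N) : Finset (Dart N) :=
  D.filter (fun d => d.s.1 ∈ A ∧ d.t.1 ∈ A)

def pot (D : Finset (Dart N)) (A : Finset N) : ℤ :=
  10 * (A.card : ℤ) - ∑ d ∈ inn D A, cost d.k

theorem mem_inn {D : Finset (Dart N)} {A : Finset N} {d} :
    d ∈ inn D A ↔ d ∈ D ∧ d.s.1 ∈ A ∧ d.t.1 ∈ A := by simp [inn]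

/-- A monochromatic obstruction. -/
def HasTri (D : Finset (Dart N)) (A : Finset N) : Prop :=
  (∃ P Q : N × Fin 5, P.1 ∈ A ∧ Q.1 ∈ A ∧ (⟨P, Q, 0⟩ : Dart N) ∈ D ∧ (⟨P, Q, 1⟩ : Dart N) ∈ D) ∨
  (∃ P Q S : N × Fin 5, P.1 ∈ A ∧ Q.1 ∈ A ∧ S.1 ∈ A ∧ (⟨P, Q, 0⟩ : Dart N) ∈ D ∧
    (⟨Q, S, 0⟩ : Dart N) ∈ D ∧ (⟨S, P, 0⟩ : Dart N) ∈ D)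

theorem Good.mono {D D' : Finset (Dart N)} {A A' : Finset N} {σ} (h : Good D A σ)
    (hD : D' ⊆ D) (hA : A' ⊆ A) : Good D' A' σ :=
  fun d hd h1 h2 => h d (hD hd) (hA h1) (hA h2)

theorem Good.congr {D D' : Finset (Dart N)} {A : Finset N} {σ} (h : Good D A σ)
    (hD : inn D' A ⊆ inn D A) : Good D' A σ := by
  intro d hd h1 h2
  have := hD (mem_inn.2 ⟨hd, h1, h2⟩)
  exact h d (mem_inn.1 this).1 h1 h2

theorem no01 : ∀ x y : Fin 5, rel 0 x y = true → rel 1 x y = true → False := by decide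
theorem no000 : ∀ x y z : Fin 5, rel 0 x y = true → rel 0 y z = true → rel 0 z x = true → False := by
  decide

theorem HasTri.not_col {D : Finset (Dart N)} {A : Finset N} (h : HasTri D A) : ¬ Col D A := by
  rintro ⟨σ, hσ⟩
  rcases h with ⟨P, Q, hP, hQ, h0, h1⟩ | ⟨P, Q, S, hP, hQ, hS, h1, h2, h3⟩
  · exact no01 _ _ (hσ _ h0 hP hQ) (hσ _ h1 hP hQ)
  · exact no000 _ _ _ (hσ _ h1 hP hQ) (hσ _ h2 hQ hS) (hσ _ h3 hS hP)

theorem sum_cost_mono {F F' : Finset (Dart N)} (h : F ⊆ F') :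
    ∑ d ∈ F, cost d.k ≤ ∑ d ∈ F', cost d.k :=
  Finset.sum_le_sum_of_subset_of_nonneg h (fun d _ _ => cost_nonneg _)

theorem sum_rev (F : Finset (Dart N)) : ∑ d ∈ F.image Dart.rev, cost d.k = ∑ d ∈ F, cost d.k := by
  rw [Finset.sum_image (fun a _ b _ h => rev_inj h)]; rfl

theorem pot_single {D : Finset (Dart N)} (hl : Loopless D) (v : N) : pot D {v} = 10 := by
  have : inn D {v} = ∅ := by
    ext d; simp only [mem_inn, Finset.mem_singleton]
    constructor
    · rintro ⟨h, h1, h2⟩; exact absurd (h1.trans h2.symm) (hl d h)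
    · simp
  simp [pot, this]

/-- Adding a node. -/
theorem pot_insert_le {D : Finset (Dart N)} (hs : Sym D) {A : Finset N} {v : N} (hv : v ∉ A)
    {F : Finset (Dart N)} (hF : ∀ d ∈ F, d ∈ D ∧ d.s.1 = v ∧ d.t.1 ∈ A) :
    pot D (insert v A) ≤ pot D A + 10 - 2 * ∑ d ∈ F, cost d.k := by
  have hsub : inn D A ∪ (F ∪ F.image Dart.rev) ⊆ inn D (insert v A) := by
    intro d hd
    simp only [Finset.mem_union, Finset.mem_image] at hd
    rw [mem_inn]
    rcases hd with hd | hd | ⟨e, he, rfl⟩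
    · rw [mem_inn] at hd; simp [hd]
    · have := hF d hd; simp [this]
    · have := hF e he; simp [hs e this.1, this]
  have h1 : Disjoint F (F.image Dart.rev) := by
    rw [Finset.disjoint_left]
    intro d hd hd'
    obtain ⟨e, he, rfl⟩ := Finset.mem_image.1 hd'
    have a := hF _ hd; have b := hF _ he
    simp only [rev_s, rev_t] at a
    exact hv (b.2.1 ▸ a.2.2)
  have h2 : Disjoint (inn D A) (F ∪ F.image Dart.rev) := by
    rw [Finset.disjoint_left]
    intro d hd hd'
    rw [mem_inn] at hd
    rcases Finset.mem_union.1 hd' with h | h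
    · exact hv ((hF d h).2.1 ▸ hd.2.1)
    · obtain ⟨e, he, rfl⟩ := Finset.mem_image.1 h
      exact hv ((hF e he).2.1 ▸ hd.2.2)
  have h3 := sum_cost_mono hsub
  rw [Finset.sum_union h2, Finset.sum_union h1, sum_rev] at h3
  unfold pot
  rw [Finset.card_insert_of_notMem hv]
  push_cast
  linarith

/-- Add both darts of an edge. -/
def addE (D : Finset (Dart N)) (P Q : N × Fin 5) (k : Fin 3) : Finset (Dart N) :=
  insert ⟨P, Q, k⟩ (insert ⟨Q, P, k⟩ D)

theorem mem_addE {D : Finset (Dart N)} {P Q k d} :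
    d ∈ addE D P Q k ↔ d = ⟨P, Q, k⟩ ∨ d = ⟨Q, P, k⟩ ∨ d ∈ D := by simp [addE]

theorem addE_sym {D : Finset (Dart N)} (h : Sym D) (P Q k) : Sym (addE D P Q k) := by
  intro d hd
  rw [mem_addE] at *
  rcases hd with rfl | rfl | hd
  · right; left; rfl
  · left; rfl
  · right; right; exact h d hd

theorem addE_loop {D : Finset (Dart N)} (h : Loopless D) {P Q : N × Fin 5} (hPQ : P.1 ≠ Q.1) (k) :
    Loopless (addE D P Q k) := by
  intro d hd
  rw [mem_addE] at hd
  rcases hd with rfl | rfl | hd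
  · exact hPQ
  · exact hPQ.symm
  · exact h d hd

theorem pot_addE (D : Finset (Dart N)) (P Q k) (B : Finset N) :
    pot D B ≤ pot (addE D P Q k) B + 2 * cost k := by
  have : inn (addE D P Q k) B ⊆ inn D B ∪ {⟨P, Q, k⟩, ⟨Q, P, k⟩} := by
    intro d; simp only [mem_inn, mem_addE, Finset.mem_union, Finset.mem_insert,
      Finset.mem_singleton]; tauto
  have h := sum_cost_mono this
  have h2 : ∑ d ∈ inn D B ∪ {⟨P, Q, k⟩, ⟨Q, P, k⟩}, cost d.k ≤
      ∑ d ∈ inn D B, cost d.k + 2 * cost k := by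
    have h4 := Finset.sum_union_inter (s₁ := inn D B) (s₂ := {⟨P, Q, k⟩, ⟨Q, P, k⟩})
        (f := fun d => cost d.k)
    have h3 : 0 ≤ ∑ d ∈ inn D B ∩ {⟨P, Q, k⟩, ⟨Q, P, k⟩}, cost d.k :=
        Finset.sum_nonneg (fun d _ => cost_nonneg _)
    have : ∑ d ∈ ({⟨P, Q, k⟩, ⟨Q, P, k⟩} : Finset (Dart N)), cost d.k ≤ 2 * cost k := by
        by_cases h : (⟨P, Q, k⟩ : Dart N) = ⟨Q, P, k⟩
        · rw [h]; simp; linarith [cost_nonneg k]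
        · rw [Finset.sum_pair h]; simp; linarith
    linarith
  unfold pot
  linarith

theorem inn_addE_of_not {D : Finset (Dart N)} {P Q k} {B : Finset N}
    (h : ¬ (P.1 ∈ B ∧ Q.1 ∈ B)) : inn (addE D P Q k) B = inn D B := by
  ext d; simp only [mem_inn, mem_addE]
  constructor
  · rintro ⟨rfl | rfl | h1, h2⟩
    · exact absurd h2 h
    · exact absurd h2.symm h
    · exact ⟨h1, h2⟩
  · rintro ⟨h1, h2⟩; exact ⟨Or.inr (Or.inr h1), h2⟩

theorem Good_addE {D : Finset (Dart N)} {P Q k} {A : Finset N} {σ} (h : Good (addE D P Q k) A σ) :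
    Good D A σ := h.mono (fun d hd => mem_addE.2 (Or.inr (Or.inr hd))) (subset_refl _)

end CG

namespace CG
variable {N : Type} [DecidableEq N]

def IH (N : Type) [DecidableEq N] (n : ℕ) : Prop :=
  ∀ (D : Finset (Dart N)) (V : Finset N), Sym D → Loopless D → V.card < n → ¬ Col D V →
    (∃ B ⊆ V, ¬ Col D B ∧ pot D B ≤ 4) ∨ HasTri D V

section K
variable (R : Finset N) (r : N) (φ : N → St)

def ctr (P : N × Fin 5) : N × Fin 5 := if P.1 ∈ R then (r, val (φ P.1) P.2) else P

def ctrD (d : Dart N) : Dart N := ⟨ctr R r φ d.s, ctr R r φ d.t, d.k⟩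

def Dc (D : Finset (Dart N)) : Finset (Dart N) :=
  (D.filter (fun d => ¬ (d.s.1 ∈ R ∧ d.t.1 ∈ R))).image (ctrD R r φ)

variable {R r φ}

theorem ctr_in {P : N × Fin 5} (h : P.1 ∈ R) : ctr R r φ P = (r, val (φ P.1) P.2) := by
  simp [ctr, h]
theorem ctr_out {P : N × Fin 5} (h : P.1 ∉ R) : ctr R r φ P = P := by
  simp [ctr, h]

theorem mem_Dc {D : Finset (Dart N)} {e} : e ∈ Dc R r φ D ↔
    ∃ d ∈ D, ¬ (d.s.1 ∈ R ∧ d.t.1 ∈ R) ∧ ctrD R r φ d = e := by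
  simp [Dc, and_assoc]

theorem Dc_sym {D : Finset (Dart N)} (h : Sym D) : Sym (Dc R r φ D) := by
  intro e he
  obtain ⟨d, hd, hn, rfl⟩ := mem_Dc.1 he
  exact mem_Dc.2 ⟨d.rev, h d hd, fun hh => hn ⟨hh.2, hh.1⟩, rfl⟩

theorem ctr_fst_ne {D : Finset (Dart N)} (hr : r ∈ R) (hl : Loopless D) {d} (hd : d ∈ D)
    (hn : ¬ (d.s.1 ∈ R ∧ d.t.1 ∈ R)) : (ctr R r φ d.s).1 ≠ (ctr R r φ d.t).1 := by
  by_cases h1 : d.s.1 ∈ R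
  · have h2 : d.t.1 ∉ R := fun h => hn ⟨h1, h⟩
    rw [ctr_in h1, ctr_out h2]; intro h; exact h2 (h ▸ hr)
  · by_cases h2 : d.t.1 ∈ R
    · rw [ctr_in h2, ctr_out h1]; intro h; exact h1 (h ▸ hr)
    · rw [ctr_out h1, ctr_out h2]; exact hl d hd

theorem Dc_loop {D : Finset (Dart N)} (hr : r ∈ R) (h : Loopless D) : Loopless (Dc R r φ D) := by
  intro e he
  obtain ⟨d, hd, hn, rfl⟩ := mem_Dc.1 he
  exact ctr_fst_ne hr h hd hn

/-- a dart of the contraction at two outside points comes from `D` -/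
theorem Dc_out {D : Finset (Dart N)} (hr : r ∈ R) {P Q : N × Fin 5} {k}
    (h : (⟨P, Q, k⟩ : Dart N) ∈ Dc R r φ D) (hP : P.1 ≠ r) (hQ : Q.1 ≠ r) :
    (⟨P, Q, k⟩ : Dart N) ∈ D := by
  obtain ⟨⟨s, t, k'⟩, hd, hn, he⟩ := mem_Dc.1 h
  simp only [ctrD, Dart.mk.injEq] at he
  obtain ⟨h1, h2, rfl⟩ := he
  have hs : s.1 ∉ R := fun hh => by rw [ctr_in hh] at h1; exact hP (h1 ▸ rfl)
  have ht : t.1 ∉ R := fun hh => by rw [ctr_in hh] at h2; exact hQ (h2 ▸ rfl)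
  rw [ctr_out hs] at h1; rw [ctr_out ht] at h2
  rwa [← h1, ← h2]

theorem Dc_in {D : Finset (Dart N)} (hr : r ∈ R) {P Q : N × Fin 5} {k}
    (h : (⟨P, Q, k⟩ : Dart N) ∈ Dc R r φ D) (hP : P.1 = r) (hQ : Q.1 ≠ r) :
    ∃ P' : N × Fin 5, P'.1 ∈ R ∧ (⟨P', Q, k⟩ : Dart N) ∈ D := by
  obtain ⟨⟨s, t, k'⟩, hd, hn, he⟩ := mem_Dc.1 h
  simp only [ctrD, Dart.mk.injEq] at he
  obtain ⟨h1, h2, rfl⟩ := he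
  have ht : t.1 ∉ R := fun hh => by rw [ctr_in hh] at h2; exact hQ (h2 ▸ rfl)
  rw [ctr_out ht] at h2
  refine ⟨s, ?_, h2 ▸ hd⟩
  by_contra hh
  rw [ctr_out hh] at h1
  exact hh (h1 ▸ hP ▸ hr)

theorem Dc_lift {D : Finset (Dart N)} (hr : r ∈ R) {V : Finset N} {σ' : N → St}
    (hφ : Good D R φ) (h : Good (Dc R r φ D) (insert r (V \ R)) σ') :
    ∃ σ, Good D V σ ∧ ∀ x ∈ R, σ x = φ x := by
  choose y hy using fun x => val_undo (σ' r) (σ' x)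
  let σ : N → St := fun x => if x ∈ R then φ x else y x
  have hσ : ∀ x ∈ R, σ x = φ x := fun x hx => by simp [σ, hx]
  have key : ∀ P : N × Fin 5, val (σ' r) (col σ P) = col σ' (ctr R r φ P) := by
    intro P
    by_cases hP : P.1 ∈ R
    · rw [ctr_in hP]; simp [col, σ, hP]
    · rw [ctr_out hP]; simp [col, σ, hP, hy]
  refine ⟨σ, ?_, hσ⟩
  intro d hd h1 h2
  by_cases hn : d.s.1 ∈ R ∧ d.t.1 ∈ R
  · have := hφ d hd hn.1 hn.2
    simpa [col, hσ _ hn.1, hσ _ hn.2] using this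
  · rw [← rel_val d.k (σ' r), key, key]
    have mem : ∀ P : N × Fin 5, P.1 ∈ V → (ctr R r φ P).1 ∈ insert r (V \ R) := by
      intro P hP
      by_cases hh : P.1 ∈ R
      · rw [ctr_in hh]; simp
      · rw [ctr_out hh]; simp [hP, hh]
    exact h _ (mem_Dc.2 ⟨d, hd, hn, rfl⟩) (mem _ h1) (mem _ h2)

theorem Dc_pot {D : Finset (Dart N)} (hr : r ∈ R) {W : Finset N} (hW : ∀ x ∈ W, x ∉ R) :
    pot D (R ∪ W) ≤ pot D R + pot (Dc R r φ D) (insert r W) - 10 := by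
  have hd : Disjoint R W := Finset.disjoint_right.2 hW
  have hrW : r ∉ W := fun h => hW r h hr
  let F := (inn D (R ∪ W)).filter (fun d => ¬ (d.s.1 ∈ R ∧ d.t.1 ∈ R))
  have h1 : inn (Dc R r φ D) (insert r W) ⊆ F.image (ctrD R r φ) := by
    intro e he
    rw [mem_inn] at he
    obtain ⟨d, hd, hn, rfl⟩ := mem_Dc.1 he.1
    refine Finset.mem_image.2 ⟨d, ?_, rfl⟩
    have mem : ∀ P : N × Fin 5, (ctr R r φ P).1 ∈ insert r W → P.1 ∈ R ∪ W := by
      intro P hP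
      by_cases hh : P.1 ∈ R
      · simp [hh]
      · rw [ctr_out hh] at hP
        rcases Finset.mem_insert.1 hP with h | h
        · exact absurd (h ▸ hr) hh
        · simp [h]
    simp only [F, Finset.mem_filter, mem_inn]
    exact ⟨⟨hd, mem _ he.2.1, mem _ he.2.2⟩, hn⟩
  have h2 := sum_cost_mono h1
  have h3 : ∑ e ∈ F.image (ctrD R r φ), cost e.k ≤ ∑ d ∈ F, cost d.k := by
    have := Finset.sum_fiberwise_of_maps_to (s := F) (t := F.image (ctrD R r φ))
      (g := ctrD R r φ) (fun d hd => Finset.mem_image_of_mem _ hd) (fun d => cost d.k)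
    rw [← this]
    refine Finset.sum_le_sum (fun e he => ?_)
    obtain ⟨d, hd, rfl⟩ := Finset.mem_image.1 he
    refine Finset.single_le_sum (f := fun d : Dart N => cost d.k) (fun _ _ => cost_nonneg _)
      (a := d) ?_
    simp [hd]
  have h4 : inn D R = (inn D (R ∪ W)).filter (fun d => (d.s.1 ∈ R ∧ d.t.1 ∈ R)) := by
    ext d; simp only [mem_inn, Finset.mem_filter, Finset.mem_union]; tauto
  have h5 := Finset.sum_filter_add_sum_filter_not (inn D (R ∪ W))
    (fun d => (d.s.1 ∈ R ∧ d.t.1 ∈ R)) (fun d => cost d.k)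
  rw [← h4] at h5
  unfold pot
  rw [Finset.card_union_of_disjoint hd, Finset.card_insert_of_notMem hrW]
  push_cast
  linarith

theorem lemK {D : Finset (Dart N)} {V R : Finset N} {φ : N → St} (ih : IH N V.card) (hs : Sym D)
    (hl : Loopless D) (hRV : R ⊆ V) (hR : 2 ≤ R.card) (hφ : Good D R φ)
    (hno : ∀ σ, Good D V σ → (∀ x ∈ R, σ x = φ x) → False) :
    (∃ B ⊆ V, (∀ x ∈ B, x ∉ R) ∧ ¬ Col D B) ∨
    (∃ W ⊆ V, (∀ x ∈ W, x ∉ R) ∧ pot D (R ∪ W) ≤ pot D R - 6) ∨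
    (∃ P P' Q : N × Fin 5, P.1 ∈ R ∧ P'.1 ∈ R ∧ Q.1 ∈ V ∧ Q.1 ∉ R ∧
      (⟨P, Q, 0⟩ : Dart N) ∈ D ∧ (⟨P', Q, 1⟩ : Dart N) ∈ D) ∨
    (∃ P P' Q S : N × Fin 5, P.1 ∈ R ∧ P'.1 ∈ R ∧ Q.1 ∈ V ∧ Q.1 ∉ R ∧ S.1 ∈ V ∧ S.1 ∉ R ∧
      (⟨P, Q, 0⟩ : Dart N) ∈ D ∧ (⟨Q, S, 0⟩ : Dart N) ∈ D ∧ (⟨S, P', 0⟩ : Dart N) ∈ D) := by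
  obtain ⟨r, hr⟩ : R.Nonempty := Finset.card_pos.1 (by omega)
  have hrn : r ∉ V \ R := by simp [hr]
  have hcard : (insert r (V \ R)).card < V.card := by
    rw [Finset.card_insert_of_notMem hrn, Finset.card_sdiff_of_subset hRV]
    have := Finset.card_le_card hRV; omega
  have hnc : ¬ Col (Dc R r φ D) (insert r (V \ R)) := by
    rintro ⟨σ', h'⟩
    obtain ⟨σ, h1, h2⟩ := Dc_lift hr hφ h'
    exact hno σ h1 h2
  have hls := Dc_loop (φ := φ) hr hl
  have hsy := Dc_sym (R := R) (r := r) (φ := φ) hs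
  have memV : ∀ x, x ∈ insert r (V \ R) → x ≠ r → x ∈ V ∧ x ∉ R := by
    intro x hx hxr
    rcases Finset.mem_insert.1 hx with h | h
    · exact absurd h hxr
    · simpa using h
  rcases ih _ _ hsy hls hcard hnc with ⟨B, hB, hBc, hBp⟩ | htri
  · by_cases hrB : r ∈ B
    · right; left
      refine ⟨B.erase r, ?_, ?_, ?_⟩
      · intro x hx; rw [Finset.mem_erase] at hx; exact (memV x (hB hx.2) hx.1).1
      · intro x hx; rw [Finset.mem_erase] at hx; exact (memV x (hB hx.2) hx.1).2
      · have := Dc_pot (D := D) (φ := φ) hr (W := B.erase r) (by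
          intro x hx; rw [Finset.mem_erase] at hx; exact (memV x (hB hx.2) hx.1).2)
        rw [Finset.insert_erase hrB] at this
        linarith
    · left
      have hh : ∀ x ∈ B, x ∈ V ∧ x ∉ R := fun x hx => memV x (hB hx) (fun h => hrB (h ▸ hx))
      refine ⟨B, fun x hx => (hh x hx).1, fun x hx => (hh x hx).2, ?_⟩
      rintro ⟨σ, hσ⟩
      refine hBc ⟨σ, fun d hd h1 h2 => ?_⟩
      exact hσ d (Dc_out hr hd (fun h => hrB (h ▸ h1)) (fun h => hrB (h ▸ h2))) h1 h2
  · -- triangles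
    rcases htri with ⟨P, Q, hP, hQ, h0, h1⟩ | ⟨P, Q, S, hP, hQ, hS, h1, h2, h3⟩
    · have hne := hls _ h0
      simp only at hne
      by_cases hPr : P.1 = r
      · have hQr : Q.1 ≠ r := fun h => hne (hPr.trans h.symm)
        obtain ⟨P1, a1, a2⟩ := Dc_in hr h0 hPr hQr
        obtain ⟨P2, b1, b2⟩ := Dc_in hr h1 hPr hQr
        right; right; left
        exact ⟨P1, P2, Q, a1, b1, (memV _ hQ hQr).1, (memV _ hQ hQr).2, a2, b2⟩
      · by_cases hQr : Q.1 = r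
        · obtain ⟨P1, a1, a2⟩ := Dc_in hr (hsy _ h0) hQr hPr
          obtain ⟨P2, b1, b2⟩ := Dc_in hr (hsy _ h1) hQr hPr
          right; right; left
          exact ⟨P1, P2, P, a1, b1, (memV _ hP hPr).1, (memV _ hP hPr).2, a2, b2⟩
        · left
          refine ⟨V \ R, Finset.sdiff_subset, fun x hx => (Finset.mem_sdiff.1 hx).2,
            HasTri.not_col (Or.inl ⟨P, Q, ?_, ?_, Dc_out hr h0 hPr hQr, Dc_out hr h1 hPr hQr⟩)⟩
          · exact Finset.mem_sdiff.2 (memV _ hP hPr)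
          · exact Finset.mem_sdiff.2 (memV _ hQ hQr)
    · have rot : ∀ P Q S : N × Fin 5, P.1 ∈ insert r (V \ R) → Q.1 ∈ insert r (V \ R) →
          S.1 ∈ insert r (V \ R) → (⟨P, Q, 0⟩ : Dart N) ∈ Dc R r φ D →
          (⟨Q, S, 0⟩ : Dart N) ∈ Dc R r φ D → (⟨S, P, 0⟩ : Dart N) ∈ Dc R r φ D → P.1 = r →
          (∃ P P' Q S : N × Fin 5, P.1 ∈ R ∧ P'.1 ∈ R ∧ Q.1 ∈ V ∧ Q.1 ∉ R ∧ S.1 ∈ V ∧ S.1 ∉ R ∧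
          (⟨P, Q, 0⟩ : Dart N) ∈ D ∧ (⟨Q, S, 0⟩ : Dart N) ∈ D ∧ (⟨S, P', 0⟩ : Dart N) ∈ D) := by
        intro P Q S hP hQ hS h1 h2 h3 hPr
        have hQr : Q.1 ≠ r := fun h => hls _ h1 (hPr.trans h.symm)
        have hSr : S.1 ≠ r := fun h => hls _ h3 (h.trans hPr.symm)
        obtain ⟨P1, a1, a2⟩ := Dc_in hr h1 hPr hQr
        obtain ⟨P2, b1, b2⟩ := Dc_in hr (hsy _ h3) hPr hSr
        exact ⟨P1, P2, Q, S, a1, b1, (memV _ hQ hQr).1, (memV _ hQ hQr).2, (memV _ hS hSr).1,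
          (memV _ hS hSr).2, a2, Dc_out hr h2 hQr hSr, hs _ b2⟩
      by_cases hPr : P.1 = r
      · right; right; right; exact rot P Q S hP hQ hS h1 h2 h3 hPr
      by_cases hQr : Q.1 = r
      · right; right; right; exact rot Q S P hQ hS hP h2 h3 h1 hQr
      by_cases hSr : S.1 = r
      · right; right; right; exact rot S P Q hS hP hQ h3 h1 h2 hSr
      left
      refine ⟨V \ R, Finset.sdiff_subset, fun x hx => (Finset.mem_sdiff.1 hx).2,
        HasTri.not_col (Or.inr ⟨P, Q, S, Finset.mem_sdiff.2 (memV _ hP hPr),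
          Finset.mem_sdiff.2 (memV _ hQ hQr), Finset.mem_sdiff.2 (memV _ hS hSr),
          Dc_out hr h1 hPr hQr, Dc_out hr h2 hQr hSr, Dc_out hr h3 hSr hPr⟩)⟩
end K

end CG

namespace CG
variable {N : Type} [DecidableEq N]

structure MC (D : Finset (Dart N)) (V : Finset N) : Prop where
  sym : Sym D
  loop : Loopless D
  ins : ∀ d ∈ D, d.s.1 ∈ V
  nc : ¬ Col D V
  potV : 5 ≤ pot D V
  sub : ∀ B, B ⊂ V → Col D B
  notri : ¬ HasTri D V
  ih : IH N V.card

theorem MC.inst {D : Finset (Dart N)} {V} (hm : MC D V) {d} (h : d ∈ D) : d.t.1 ∈ V :=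
  hm.ins _ (hm.sym d h)

def out (D : Finset (Dart N)) (v : N) : Finset (Dart N) := D.filter (fun d => d.s.1 = v)

theorem mem_out {D : Finset (Dart N)} {v d} : d ∈ out D v ↔ d ∈ D ∧ d.s.1 = v := by simp [out]

/-! ### adding a node with explicit darts -/
section
variable {D : Finset (Dart N)} (hs : Sym D) {A : Finset N} {v : N} (hv : v ∉ A)
  {d1 d2 d3 d4 : Dart N}
  (h1 : d1 ∈ D) (h1s : d1.s.1 = v) (h1t : d1.t.1 ∈ A)
  (h2 : d2 ∈ D) (h2s : d2.s.1 = v) (h2t : d2.t.1 ∈ A)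
  (h3 : d3 ∈ D) (h3s : d3.s.1 = v) (h3t : d3.t.1 ∈ A)
  (h4 : d4 ∈ D) (h4s : d4.s.1 = v) (h4t : d4.t.1 ∈ A)
  (h12 : d1 ≠ d2) (h13 : d1 ≠ d3) (h23 : d2 ≠ d3) (h14 : d1 ≠ d4) (h24 : d2 ≠ d4) (h34 : d3 ≠ d4)
include hs hv

theorem pot_add0 : pot D (insert v A) ≤ pot D A + 10 := by
  have := pot_insert_le hs hv (F := ∅) (by simp)
  simpa using this

include h1 h1s h1t
theorem pot_add1 : pot D (insert v A) ≤ pot D A + 10 - 2 * cost d1.k := by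
  have := pot_insert_le hs hv (F := {d1}) (by simp [*])
  simpa using this

include h2 h2s h2t h12
theorem pot_add2 : pot D (insert v A) ≤ pot D A + 10 - 2 * (cost d1.k + cost d2.k) := by
  have := pot_insert_le hs hv (F := {d1, d2}) (by simp [*])
  rwa [Finset.sum_pair h12] at this

include h3 h3s h3t h13 h23
theorem pot_add3 : pot D (insert v A) ≤ pot D A + 10 - 2 * (cost d1.k + cost d2.k + cost d3.k) := by
  have := pot_insert_le hs hv (F := {d1, d2, d3}) (by simp [*])
  rw [Finset.sum_insert (by simp [*]), Finset.sum_pair h23] at this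
  linarith

include h4 h4s h4t h14 h24 h34
theorem pot_add4 : pot D (insert v A) ≤
    pot D A + 10 - 2 * (cost d1.k + cost d2.k + cost d3.k + cost d4.k) := by
  have := pot_insert_le hs hv (F := {d1, d2, d3, d4}) (by simp [*])
  rw [Finset.sum_insert (by simp [*]), Finset.sum_insert (by simp [*]), Finset.sum_pair h34] at this
  linarith
end

/-! ### gadgets -/

def addG (D G : Finset (Dart N)) : Finset (Dart N) := D ∪ (G ∪ G.image Dart.rev)

theorem mem_addG {D G : Finset (Dart N)} {d} :
    d ∈ addG D G ↔ d ∈ D ∨ ∃ g ∈ G, (d = g ∨ d = g.rev) := by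
  simp only [addG, Finset.mem_union, Finset.mem_image]
  constructor
  · rintro (h | h | ⟨g, h, rfl⟩)
    · exact Or.inl h
    · exact Or.inr ⟨d, h, Or.inl rfl⟩
    · exact Or.inr ⟨g, h, Or.inr rfl⟩
  · rintro (h | ⟨g, h, rfl | rfl⟩)
    · exact Or.inl h
    · exact Or.inr (Or.inl h)
    · exact Or.inr (Or.inr ⟨g, h, rfl⟩)

theorem addG_sym {D : Finset (Dart N)} (h : Sym D) (G) : Sym (addG D G) := by
  intro d hd
  rw [mem_addG] at *
  rcases hd with hd | ⟨g, hg, rfl | rfl⟩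
  · exact Or.inl (h d hd)
  · exact Or.inr ⟨d, hg, Or.inr rfl⟩
  · exact Or.inr ⟨g, hg, Or.inl rfl⟩

theorem addG_loop {D G : Finset (Dart N)} (h : Loopless D) (hG : Loopless G) :
    Loopless (addG D G) := by
  intro d hd
  rw [mem_addG] at *
  rcases hd with hd | ⟨g, hg, rfl | rfl⟩
  · exact h d hd
  · exact hG d hg
  · exact (hG g hg).symm

theorem pot_addG (D G : Finset (Dart N)) (B : Finset N) :
    pot D B ≤ pot (addG D G) B + 2 * ∑ d ∈ inn G B, cost d.k := by
  have : inn (addG D G) B ⊆ inn D B ∪ (inn G B ∪ (inn G B).image Dart.rev) := by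
    intro d hd
    rw [mem_inn, mem_addG] at hd
    simp only [Finset.mem_union, Finset.mem_image]
    rcases hd with ⟨hd | ⟨g, hg, rfl | rfl⟩, h2⟩
    · exact Or.inl (mem_inn.2 ⟨hd, h2⟩)
    · exact Or.inr (Or.inl (mem_inn.2 ⟨hg, h2⟩))
    · exact Or.inr (Or.inr ⟨g, mem_inn.2 ⟨hg, h2.2, h2.1⟩, rfl⟩)
  have h := sum_cost_mono this
  have un : ∀ X Y : Finset (Dart N), ∑ d ∈ X ∪ Y, cost d.k ≤ ∑ d ∈ X, cost d.k + ∑ d ∈ Y, cost d.k := by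
    intro X Y
    have h1 := Finset.sum_union_inter (s₁ := X) (s₂ := Y) (f := fun d => cost d.k)
    have h3 : 0 ≤ ∑ d ∈ X ∩ Y, cost d.k := Finset.sum_nonneg (fun d _ => cost_nonneg _)
    linarith
  have a := un (inn D B) (inn G B ∪ (inn G B).image Dart.rev)
  have b := un (inn G B) ((inn G B).image Dart.rev)
  rw [sum_rev] at b
  unfold pot
  linarith

theorem inn_addG_of_not {D G : Finset (Dart N)} {B : Finset N}
    (h : inn G B = ∅) : inn (addG D G) B = inn D B := by
  ext d; simp only [mem_inn, mem_addG]
  constructor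
  · rintro ⟨h1 | ⟨g, hg, rfl | rfl⟩, h2⟩
    · exact ⟨h1, h2⟩
    · have : d ∈ inn G B := mem_inn.2 ⟨hg, h2⟩
      simp [h] at this
    · have : g ∈ inn G B := mem_inn.2 ⟨hg, h2.2, h2.1⟩
      simp [h] at this
  · rintro ⟨h1, h2⟩; exact ⟨Or.inl h1, h2⟩

theorem gadG {D : Finset (Dart N)} {V} (hm : MC D V) {A} (hA : A ⊂ V) (G : Finset (Dart N))
    (hG : Loopless G) :
    (∃ σ, Good D A σ ∧ Good G A σ) ∨
    (∃ B ⊆ A, (inn G B).Nonempty ∧ pot D B ≤ 4 + 2 * ∑ g ∈ inn G B, cost g.k) ∨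
    HasTri (addG D G) A := by
  by_cases hc : Col (addG D G) A
  · obtain ⟨σ, hσ⟩ := hc
    left
    refine ⟨σ, ?_, ?_⟩
    · exact hσ.mono (fun d hd => mem_addG.2 (Or.inl hd)) (subset_refl _)
    · exact hσ.mono (fun d hd => mem_addG.2 (Or.inr ⟨d, hd, Or.inl rfl⟩)) (subset_refl _)
  · right
    rcases hm.ih _ _ (addG_sym hm.sym G) (addG_loop hm.loop hG) (Finset.card_lt_card hA) hc with
      ⟨B, hB, hBc, hBp⟩ | h
    · left
      refine ⟨B, hB, ?_, ?_⟩
      · rw [Finset.nonempty_iff_ne_empty]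
        intro he
        apply hBc
        obtain ⟨σ, hσ⟩ := hm.sub B (lt_of_le_of_lt hB hA)
        exact ⟨σ, hσ.congr (inn_addG_of_not he).le⟩
      · have := pot_addG D G B
        linarith
    · exact Or.inr h

/-- the obstruction to a single gadget -/
def Tri1 (D : Finset (Dart N)) (A : Finset N) (g : Dart N) : Prop :=
  (g.k = 1 ∧ (⟨g.s, g.t, 0⟩ : Dart N) ∈ D) ∨
  (g.k = 0 ∧ ((⟨g.s, g.t, 1⟩ : Dart N) ∈ D ∨
    ∃ S : N × Fin 5, S.1 ∈ A ∧ (⟨g.s, S, 0⟩ : Dart N) ∈ D ∧ (⟨S, g.t, 0⟩ : Dart N) ∈ D))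

theorem tri01 {D G : Finset (Dart N)} {A} (hs : Sym D) {P Q : N × Fin 5}
    (hP : P.1 ∈ A) (hQ : Q.1 ∈ A) (hn : ¬ HasTri D A)
    (h0 : (⟨P, Q, 0⟩ : Dart N) ∈ addG D G) (h1 : (⟨P, Q, 1⟩ : Dart N) ∈ addG D G) :
    (∃ g ∈ G, Tri1 D A g) ∨ ∃ g ∈ G, ∃ g' ∈ G, g.k = 0 ∧ g'.k = 1 ∧
      (g = ⟨P, Q, 0⟩ ∨ g = ⟨Q, P, 0⟩) ∧ (g' = ⟨P, Q, 1⟩ ∨ g' = ⟨Q, P, 1⟩) := by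
  have conv : ∀ {k} {g : Dart N}, (⟨P, Q, k⟩ : Dart N) = g ∨ (⟨P, Q, k⟩ : Dart N) = g.rev →
      g = ⟨P, Q, k⟩ ∨ g = ⟨Q, P, k⟩ := by
    rintro k g (h | h)
    · exact Or.inl h.symm
    · right; rw [← rev_rev g, ← h]; rfl
  rcases mem_addG.1 h0 with h0 | ⟨g, hg, h0⟩ <;> rcases mem_addG.1 h1 with h1 | ⟨g', hg', h1⟩
  · exact absurd (Or.inl ⟨P, Q, hP, hQ, h0, h1⟩) hn
  · left; refine ⟨g', hg', Or.inl ?_⟩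
    rcases conv h1 with rfl | rfl
    · exact ⟨rfl, h0⟩
    · exact ⟨rfl, hs _ h0⟩
  · left; refine ⟨g, hg, Or.inr ?_⟩
    rcases conv h0 with rfl | rfl
    · exact ⟨rfl, Or.inl h1⟩
    · exact ⟨rfl, Or.inl (hs _ h1)⟩
  · right
    have a := conv h0; have b := conv h1
    refine ⟨g, hg, g', hg', ?_, ?_, a, b⟩
    · rcases a with rfl | rfl <;> rfl
    · rcases b with rfl | rfl <;> rfl

/-- gadgets without 0-edges -/
theorem triG12 {D G : Finset (Dart N)} {A} (hs : Sym D) (hn : ¬ HasTri D A)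
    (hk : ∀ g ∈ G, g.k ≠ 0) (h : HasTri (addG D G) A) :
    ∃ g ∈ G, g.k = 1 ∧ (⟨g.s, g.t, 0⟩ : Dart N) ∈ D := by
  rcases h with ⟨P, Q, hP, hQ, h0, h1⟩ | ⟨P, Q, S, hP, hQ, hS, h1, h2, h3⟩
  · rcases tri01 hs hP hQ hn h0 h1 with ⟨g, hg, h | h⟩ | ⟨g, hg, _, _, h, _⟩
    · exact ⟨g, hg, h⟩
    · exact absurd h.1 (hk g hg)
    · exact absurd h (hk g hg)
  · have : ∀ P Q : N × Fin 5, (⟨P, Q, 0⟩ : Dart N) ∈ addG D G → (⟨P, Q, 0⟩ : Dart N) ∈ D := by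
      intro P Q h
      rcases mem_addG.1 h with h | ⟨g, hg, h | h⟩
      · exact h
      · exact absurd (congrArg Dart.k h).symm (hk g hg)
      · exact absurd (congrArg Dart.k h).symm (hk g hg)
    exact absurd (Or.inr ⟨P, Q, S, hP, hQ, hS, this _ _ h1, this _ _ h2, this _ _ h3⟩) hn

theorem MC.notri_sub {D : Finset (Dart N)} {V} (hm : MC D V) {A} (hA : A ⊆ V) : ¬ HasTri D A := by
  intro h
  apply hm.notri
  rcases h with ⟨P, Q, hP, hQ, h⟩ | ⟨P, Q, S, hP, hQ, hS, h⟩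
  · exact Or.inl ⟨P, Q, hA hP, hA hQ, h⟩
  · exact Or.inr ⟨P, Q, S, hA hP, hA hQ, hA hS, h⟩

/-- one gadget -/
theorem gad1 {D : Finset (Dart N)} {V} (hm : MC D V) {A} (hA : A ⊂ V) {P Q : N × Fin 5}
    (hP : P.1 ∈ A) (hQ : Q.1 ∈ A) (hPQ : P.1 ≠ Q.1) (k : Fin 3) :
    (∃ σ, Good D A σ ∧ rel k (col σ P) (col σ Q) = true) ∨
    (∃ B ⊆ A, P.1 ∈ B ∧ Q.1 ∈ B ∧ pot D B ≤ 4 + 2 * cost k) ∨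
    (k = 1 ∧ (⟨P, Q, 0⟩ : Dart N) ∈ D) ∨
    (k = 0 ∧ ((⟨P, Q, 1⟩ : Dart N) ∈ D ∨ ∃ S : N × Fin 5, S.1 ∈ A ∧
      (⟨P, S, 0⟩ : Dart N) ∈ D ∧ (⟨S, Q, 0⟩ : Dart N) ∈ D)) := by
  have hG : Loopless ({⟨P, Q, k⟩} : Finset (Dart N)) := by
    intro d hd; rw [Finset.mem_singleton] at hd; subst hd; exact hPQ
  rcases gadG hm hA {⟨P, Q, k⟩} hG with ⟨σ, h1, h2⟩ | ⟨B, hB, ⟨g, hg⟩, hp⟩ | ht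
  · left; exact ⟨σ, h1, h2 ⟨P, Q, k⟩ (by simp) hP hQ⟩
  · right; left
    rw [mem_inn, Finset.mem_singleton] at hg
    obtain ⟨rfl, hg1, hg2⟩ := hg
    refine ⟨B, hB, hg1, hg2, hp.trans ?_⟩
    have := sum_cost_mono (F := inn {(⟨P, Q, k⟩ : Dart N)} B) (F' := {⟨P, Q, k⟩})
      (Finset.filter_subset _ _)
    simp only [Finset.sum_singleton] at this
    linarith
  · right; right
    have hn := hm.notri_sub hA.1
    rcases ht with ⟨P', Q', hP', hQ', h0, h1⟩ | ⟨P', Q', S', hP', hQ', hS', h1, h2, h3⟩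
    · rcases tri01 hm.sym hP' hQ' hn h0 h1 with ⟨g, hg, h⟩ | ⟨g, hg, g', hg', h, h', _⟩
      · rw [Finset.mem_singleton] at hg; subst hg; exact h
      · rw [Finset.mem_singleton] at hg hg'; subst hg; subst hg'
        rw [h] at h'; exact absurd h' (by decide)
    · right
      have conv : ∀ X Y : N × Fin 5, (⟨X, Y, 0⟩ : Dart N) ∈ addG D {⟨P, Q, k⟩} →
          (⟨X, Y, 0⟩ : Dart N) ∈ D ∨ (k = 0 ∧ ((X = P ∧ Y = Q) ∨ (X = Q ∧ Y = P))) := by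
        intro X Y h
        rcases mem_addG.1 h with h | ⟨g, hg, h⟩
        · exact Or.inl h
        · rw [Finset.mem_singleton] at hg; subst hg
          simp only [Dart.rev, Dart.mk.injEq] at h
          rcases h with ⟨a, b, c⟩ | ⟨a, b, c⟩
          · exact Or.inr ⟨c.symm, Or.inl ⟨a, b⟩⟩
          · exact Or.inr ⟨c.symm, Or.inr ⟨a, b⟩⟩
      have hll := addG_loop hm.loop hG
      have main : ∀ X Y Z : N × Fin 5, Z.1 ∈ A → (⟨Y, Z, 0⟩ : Dart N) ∈ addG D {⟨P, Q, k⟩} →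
          (⟨Z, X, 0⟩ : Dart N) ∈ addG D {⟨P, Q, k⟩} → k = 0 →
          ((X = P ∧ Y = Q) ∨ (X = Q ∧ Y = P)) → ∃ S : N × Fin 5, S.1 ∈ A ∧
      (⟨P, S, 0⟩ : Dart N) ∈ D ∧ (⟨S, Q, 0⟩ : Dart N) ∈ D := by
        intro X Y Z hZ a b hk h
        have aYZ := hll _ a; have bZX := hll _ b
        simp only at aYZ bZX
        have a' : (⟨Y, Z, 0⟩ : Dart N) ∈ D := by
          rcases conv _ _ a with a | ⟨_, ⟨a1, a2⟩ | ⟨a1, a2⟩⟩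
          · exact a
          all_goals
            exfalso
            rcases h with ⟨e1, e2⟩ | ⟨e1, e2⟩ <;> grind
        have b' : (⟨Z, X, 0⟩ : Dart N) ∈ D := by
          rcases conv _ _ b with b | ⟨_, ⟨a1, a2⟩ | ⟨a1, a2⟩⟩
          · exact b
          all_goals
            exfalso
            rcases h with ⟨e1, e2⟩ | ⟨e1, e2⟩ <;> grind
        rcases h with ⟨rfl, rfl⟩ | ⟨rfl, rfl⟩
        · exact ⟨Z, hZ, hm.sym _ b', hm.sym _ a'⟩
        · exact ⟨Z, hZ, a', b'⟩
      rcases conv _ _ h1 with c1 | ⟨hk, c1⟩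
      · rcases conv _ _ h2 with c2 | ⟨hk, c2⟩
        · rcases conv _ _ h3 with c3 | ⟨hk, c3⟩
          · exact absurd (Or.inr ⟨P', Q', S', hP', hQ', hS', c1, c2, c3⟩) hn
          · exact ⟨hk, Or.inr (main _ _ _ hQ' h1 h2 hk c3)⟩
        · exact ⟨hk, Or.inr (main _ _ _ hP' h3 h1 hk c2)⟩
      · exact ⟨hk, Or.inr (main _ _ _ hS' h2 h3 hk c1)⟩

theorem MC.ext {D : Finset (Dart N)} {V} (hm : MC D V) {v : N} {σ : N → St}
    (hσ : Good D (V.erase v) σ) (st : St)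
    (h : ∀ d ∈ D, d.s.1 = v → rel d.k (val st d.s.2) (col σ d.t) = true) : False := by
  apply hm.nc
  refine ⟨Function.update σ v st, ?_⟩
  have c1 : ∀ P : N × Fin 5, P.1 ≠ v → col (Function.update σ v st) P = col σ P := by
    intro P hP; simp [col, Function.update_of_ne hP]
  have c2 : ∀ P : N × Fin 5, P.1 = v → col (Function.update σ v st) P = val st P.2 := by
    intro P hP; simp [col, hP]
  intro d hd h1 h2
  have hne := hm.loop d hd
  by_cases hs : d.s.1 = v
  · rw [c2 _ hs, c1 _ (fun h => hne (hs.trans h.symm))]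
    exact h d hd hs
  · by_cases ht : d.t.1 = v
    · rw [c2 _ ht, c1 _ hs, rel_symm]
      exact h _ (hm.sym d hd) ht
    · rw [c1 _ hs, c1 _ ht]
      exact hσ d hd (Finset.mem_erase.2 ⟨hs, h1⟩) (Finset.mem_erase.2 ⟨ht, h2⟩)

end CG

namespace CG
variable {N : Type} [DecidableEq N]

theorem two_le_card {A : Finset N} {x y : N} (hx : x ∈ A) (hy : y ∈ A) (h : x ≠ y) :
    2 ≤ A.card := by
  have : ({x, y} : Finset N) ⊆ A := by
    intro z hz; simp at hz; rcases hz with rfl | rfl <;> assumption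
  have h2 := Finset.card_le_card this
  rwa [Finset.card_pair h] at h2

section
variable {D : Finset (Dart N)} {V : Finset N} (hm : MC D V)
include hm

theorem MC.erase_ss {v} (hv : v ∈ V) : V.erase v ⊂ V := Finset.erase_ssubset hv

theorem MC.nocol {B : Finset N} (hB : B ⊆ V) (h : ¬ Col D B) : B = V := by
  by_contra hne
  exact h (hm.sub B (lt_of_le_of_ne hB hne))

theorem MC.weak : ∀ n (R : Finset N), V.card - R.card = n → R ⊂ V → 2 ≤ R.card → 9 ≤ pot D R := by
  intro n
  induction n using Nat.strong_induction_on with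
  | _ n IHn =>
  intro R hn hR hc
  obtain ⟨φ, hφ⟩ := hm.sub R hR
  -- larger sets
  have big : ∀ R', R ⊆ R' → R' ⊆ V → R ≠ R' → 5 ≤ pot D R' := by
    intro R' h1 h2 h3
    by_cases h : R' = V
    · rw [h]; exact hm.potV
    · have hss : R' ⊂ V := lt_of_le_of_ne h2 h
      have hlt : R.card < R'.card := Finset.card_lt_card (lt_of_le_of_ne h1 h3)
      have hlt2 := Finset.card_lt_card hss
      have := IHn (V.card - R'.card) (by omega) R' rfl hss (by omega)
      linarith
  have hrn : R.Nonempty := Finset.card_pos.1 (by omega)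
  rcases lemK hm.ih hm.sym hm.loop hR.1 hc hφ (fun σ h _ => hm.nc ⟨σ, h⟩) with
    ⟨B, hB, hBR, h⟩ | ⟨W, hW, hWR, h⟩ | ⟨P, P', Q, hP, hP', hQ, hQR, h0, h1⟩ |
    ⟨P, P', Q, S, hP, hP', hQ, hQR, hS, hSR, h0, h1, h2⟩
  · have := hm.nocol hB h
    subst this
    obtain ⟨x, hx⟩ := hrn
    exact absurd hx (hBR x (hR.1 hx))
  · have := big (R ∪ W) Finset.subset_union_left (Finset.union_subset hR.1 hW) (by
      intro he; rw [← he] at h; linarith)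
    linarith
  · have := big (insert Q.1 R) (Finset.subset_insert _ _) (Finset.insert_subset hQ hR.1)
      (fun he => hQR (he ▸ Finset.mem_insert_self _ _))
    have h3 := pot_add2 hm.sym hQR (hm.sym _ h0) rfl hP (hm.sym _ h1) rfl hP'
      (by intro h; simpa using congrArg Dart.k h)
    simp only [rev_k, cost0, cost1] at h3
    linarith
  · have hQS : Q.1 ≠ S.1 := hm.loop _ h1
    have hSR' : S.1 ∉ insert Q.1 R := by simp [hSR, hQS.symm]
    have := big (insert S.1 (insert Q.1 R))
      ((Finset.subset_insert _ _).trans (Finset.subset_insert _ _))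
      (Finset.insert_subset hS (Finset.insert_subset hQ hR.1))
      (fun he => hSR (he ▸ Finset.mem_insert_self _ _))
    have h3 := pot_add1 hm.sym hQR (hm.sym _ h0) rfl hP
    have h4 := pot_add2 hm.sym hSR' (hm.sym _ h1) rfl (Finset.mem_insert_self _ _) h2 rfl
      (Finset.mem_insert_of_mem hP')
      (by intro h; have := congrArg (fun d => d.t.1) h; simp at this; exact hQR (this ▸ hP'))
    simp only [rev_k, cost0, cost1] at h3 h4
    linarith

theorem MC.potge {R : Finset N} (hR : R ⊆ V) (hc : 2 ≤ R.card) : 5 ≤ pot D R := by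
  by_cases h : R = V
  · rw [h]; exact hm.potV
  · have := hm.weak _ R rfl (lt_of_le_of_ne hR h) hc
    linarith

omit hm in
theorem fact1 : ∀ (k : Fin 3) (p y : Fin 5), ∃ st : St, rel k (val st p) y = true := by
  decide +kernel

omit hm in
theorem fact2 : ∀ (k1 k2 : Fin 3) (p1 p2 : Fin 5),
    (∀ y1 y2, ∃ st : St, rel k1 (val st p1) y1 = true ∧ rel k2 (val st p2) y2 = true) ∨
    (k1 = 0 ∧ k2 = 0 ∧ p1 = p2 ∧ ∀ y1 y2, rel 1 y1 y2 = true →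
      ∃ st : St, rel k1 (val st p1) y1 = true ∧ rel k2 (val st p2) y2 = true) ∨
    (k1 = 0 ∧ k2 = 0 ∧ ∀ y1 y2, rel 2 y1 y2 = true →
      ∃ st : St, rel k1 (val st p1) y1 = true ∧ rel k2 (val st p2) y2 = true) ∨
    (((k1 = 0 ∧ k2 = 1) ∨ (k1 = 1 ∧ k2 = 0)) ∧ p1 = p2 ∧ ∀ y1 y2, rel 2 y1 y2 = true →
      ∃ st : St, rel k1 (val st p1) y1 = true ∧ rel k2 (val st p2) y2 = true) := by
  decide +kernel

omit hm in
theorem val_inj : ∀ (g : St) (i j : Fin 5), i ≠ j → rel 2 (val g i) (val g j) = true := by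
  decide +kernel

theorem MC.out_pair {v : N} (hv : v ∈ V) {d1 d2 : Dart N} (h12 : d1 ≠ d2)
    (ho : out D v = {d1, d2}) : False := by
  have h1 : d1 ∈ D ∧ d1.s.1 = v := mem_out.1 (by rw [ho]; simp)
  have h2 : d2 ∈ D ∧ d2.s.1 = v := mem_out.1 (by rw [ho]; simp)
  have hA := hm.erase_ss hv
  have t1 : d1.t.1 ∈ V.erase v := Finset.mem_erase.2
    ⟨fun h => hm.loop _ h1.1 (h1.2.trans h.symm), hm.inst h1.1⟩
  have t2 : d2.t.1 ∈ V.erase v := Finset.mem_erase.2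
    ⟨fun h => hm.loop _ h2.1 (h2.2.trans h.symm), hm.inst h2.1⟩
  have fin : ∀ σ, Good D (V.erase v) σ → (∃ st : St, rel d1.k (val st d1.s.2) (col σ d1.t) = true ∧
      rel d2.k (val st d2.s.2) (col σ d2.t) = true) → False := by
    rintro σ hσ ⟨st, a, b⟩
    refine hm.ext hσ st (fun d hd hds => ?_)
    have : d ∈ out D v := mem_out.2 ⟨hd, hds⟩
    rw [ho] at this; simp at this
    rcases this with rfl | rfl <;> assumption
  -- potential of a set together with v
  have addv : ∀ B ⊆ V.erase v, d1.t.1 ∈ B → d2.t.1 ∈ B →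
      5 ≤ pot D B + 10 - 2 * (cost d1.k + cost d2.k) := by
    intro B hB b1 b2
    have hvB : v ∉ B := fun h => by simpa using hB h
    have a := pot_add2 hm.sym hvB h1.1 h1.2 b1 h2.1 h2.2 b2 h12
    have b := hm.potge (R := insert v B)
      (Finset.insert_subset hv (hB.trans (Finset.erase_subset _ _)))
      (two_le_card (Finset.mem_insert_self _ _) (Finset.mem_insert_of_mem b1)
        (fun h => hvB (h ▸ b1)))
    linarith
  have same : d1.t.1 = d2.t.1 → cost d1.k + cost d2.k ≤ 7 := by
    intro h
    have := addv {d1.t.1} (by simpa using t1) (by simp) (by simp [h])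
    rw [pot_single hm.loop] at this
    linarith
  rcases fact2 d1.k d2.k d1.s.2 d2.s.2 with h | ⟨k1, k2, hp, h⟩ | ⟨k1, k2, h⟩ | ⟨hk, hp, h⟩
  · obtain ⟨σ, hσ⟩ := hm.sub _ hA
    exact fin σ hσ (h _ _)
  · have hs : d1.s = d2.s := Prod.ext (h1.2.trans h2.2.symm) hp
    have hne : d1.t.1 ≠ d2.t.1 := by
      intro h; have := same h; rw [k1, k2, cost0] at this; linarith
    rcases gad1 hm hA t1 t2 hne 1 with ⟨σ, hσ, hr⟩ | ⟨B, hB, b1, b2, hp⟩ | ⟨_, h0⟩ | ⟨h0, _⟩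
    · exact fin σ hσ (h _ _ hr)
    · have := addv B hB b1 b2
      rw [k1, k2, cost0] at this; rw [cost1] at hp; linarith
    · apply hm.notri
      right
      refine ⟨d1.s, d1.t, d2.t, h1.2 ▸ hv, hm.inst h1.1, hm.inst h2.1, ?_, h0, ?_⟩
      · rw [← k1]; exact h1.1
      · rw [← k2, hs]; exact hm.sym _ h2.1
    · exact absurd h0 (by decide)
  · have hne : d1.t.1 ≠ d2.t.1 := by
      intro h; have := same h; rw [k1, k2, cost0] at this; linarith
    rcases gad1 hm hA t1 t2 hne 2 with ⟨σ, hσ, hr⟩ | ⟨B, hB, b1, b2, hp⟩ | ⟨h0, _⟩ | ⟨h0, _⟩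
    · exact fin σ hσ (h _ _ hr)
    · have := addv B hB b1 b2
      rw [k1, k2, cost0] at this; rw [cost2] at hp; linarith
    · exact absurd h0 (by decide)
    · exact absurd h0 (by decide)
  · have hs : d1.s = d2.s := Prod.ext (h1.2.trans h2.2.symm) hp
    have hc : cost d1.k + cost d2.k = 7 := by
      rcases hk with ⟨a, b⟩ | ⟨a, b⟩ <;> rw [a, b] <;> rfl
    by_cases hne : d1.t.1 = d2.t.1
    · by_cases hpos : d1.t.2 = d2.t.2
      · have ht : d1.t = d2.t := Prod.ext hne hpos
        apply hm.notri; left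
        rcases hk with ⟨a, b⟩ | ⟨a, b⟩
        · refine ⟨d1.s, d1.t, h1.2 ▸ hv, hm.inst h1.1, ?_, ?_⟩
          · rw [← a]; exact h1.1
          · rw [← b, hs, ht]; exact h2.1
        · refine ⟨d1.s, d1.t, h1.2 ▸ hv, hm.inst h1.1, ?_, ?_⟩
          · rw [← b, hs, ht]; exact h2.1
          · rw [← a]; exact h1.1
      · obtain ⟨σ, hσ⟩ := hm.sub _ hA
        refine fin σ hσ (h _ _ ?_)
        unfold col; rw [hne]; exact val_inj _ _ _ hpos
    · rcases gad1 hm hA t1 t2 hne 2 with ⟨σ, hσ, hr⟩ | ⟨B, hB, b1, b2, hp⟩ | ⟨h0, _⟩ | ⟨h0, _⟩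
      · exact fin σ hσ (h _ _ hr)
      · have := addv B hB b1 b2
        rw [cost2] at hp; linarith
      · exact absurd h0 (by decide)
      · exact absurd h0 (by decide)

theorem MC.deg3 {v : N} (hv : v ∈ V) : 3 ≤ (out D v).card := by
  by_contra hlt
  have hA := hm.erase_ss hv
  have h012 : (out D v).card = 0 ∨ (out D v).card = 1 ∨ (out D v).card = 2 := by omega
  rcases h012 with h | h | h
  · obtain ⟨σ, hσ⟩ := hm.sub _ hA
    rw [Finset.card_eq_zero] at h
    refine hm.ext hσ (0, true) (fun d hd hds => ?_)
    have : d ∈ out D v := mem_out.2 ⟨hd, hds⟩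
    simp [h] at this
  · obtain ⟨σ, hσ⟩ := hm.sub _ hA
    obtain ⟨e, he⟩ := Finset.card_eq_one.1 h
    obtain ⟨st, hst⟩ := fact1 e.k e.s.2 (col σ e.t)
    refine hm.ext hσ st (fun d hd hds => ?_)
    have : d ∈ out D v := mem_out.2 ⟨hd, hds⟩
    rw [he, Finset.mem_singleton] at this
    rw [this]; exact hst
  · obtain ⟨d1, d2, h12, he⟩ := Finset.card_eq_two.1 h
    exact hm.out_pair hv h12 he

theorem MC.third {v : N} (hv : v ∈ V) (d1 d2 : Dart N) :
    ∃ e ∈ D, e.s.1 = v ∧ e ≠ d1 ∧ e ≠ d2 := by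
  by_contra hcon
  push Not at hcon
  have hsub : out D v ⊆ {d1, d2} := by
    intro e he
    rw [mem_out] at he
    by_cases h : e = d1
    · simp [h]
    · simp [hcon e he.1 he.2 h]
  have := (Finset.card_le_card hsub).trans Finset.card_le_two
  have := hm.deg3 hv
  omega

theorem MC.p2 : ∀ n (R : Finset N), V.card - R.card = n → R ⊂ V → 2 ≤ R.card → 11 ≤ pot D R := by
  intro n
  induction n using Nat.strong_induction_on with
  | _ n IHn =>
  intro R hn hR hc
  obtain ⟨φ, hφ⟩ := hm.sub R hR
  have big : ∀ R', R ⊆ R' → R' ⊆ V → R ≠ R' → R' = V ∨ 11 ≤ pot D R' := by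
    intro R' h1 h2 h3
    by_cases h : R' = V
    · left; exact h
    · right
      have hss : R' ⊂ V := lt_of_le_of_ne h2 h
      have hlt : R.card < R'.card := Finset.card_lt_card (lt_of_le_of_ne h1 h3)
      have hlt2 := Finset.card_lt_card hss
      exact IHn (V.card - R'.card) (by omega) R' rfl hss (by omega)
  have hpV := hm.potV
  have hrn : R.Nonempty := Finset.card_pos.1 (by omega)
  rcases lemK hm.ih hm.sym hm.loop hR.1 hc hφ (fun σ h _ => hm.nc ⟨σ, h⟩) with
    ⟨B, hB, hBR, h⟩ | ⟨W, hW, hWR, h⟩ | ⟨P, P', Q, hP, hP', hQ, hQR, h0, h1⟩ |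
    ⟨P, P', Q, S, hP, hP', hQ, hQR, hS, hSR, h0, h1, h2⟩
  · have := hm.nocol hB h
    subst this
    obtain ⟨x, hx⟩ := hrn
    exact absurd hx (hBR x (hR.1 hx))
  · rcases big (R ∪ W) Finset.subset_union_left (Finset.union_subset hR.1 hW) (by
      intro he; rw [← he] at h; linarith) with h' | h'
    · rw [h'] at h; linarith
    · linarith
  · have hne : (⟨Q, P, 0⟩ : Dart N) ≠ ⟨Q, P', 1⟩ := by
      intro h; simpa using congrArg Dart.k h
    rcases big (insert Q.1 R) (Finset.subset_insert _ _) (Finset.insert_subset hQ hR.1)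
      (fun he => hQR (he ▸ Finset.mem_insert_self _ _)) with h' | h'
    · obtain ⟨e, he, hes, e1, e2⟩ := hm.third hQ ⟨Q, P, 0⟩ ⟨Q, P', 1⟩
      have het : e.t.1 ∈ R := by
        have := hm.inst he
        rw [← h', Finset.mem_insert] at this
        rcases this with h | h
        · exact absurd (hes.trans h.symm) (hm.loop _ he)
        · exact h
      have h3 := pot_add3 hm.sym hQR (hm.sym _ h0) rfl hP (hm.sym _ h1) rfl hP' he hes het
        hne e1.symm e2.symm
      simp only [rev_k, cost0, cost1] at h3
      rw [h'] at h3
      have := cost_ge e.k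
      linarith
    · have h3 := pot_add2 hm.sym hQR (hm.sym _ h0) rfl hP (hm.sym _ h1) rfl hP' hne
      simp only [rev_k, cost0, cost1] at h3
      linarith
  · have hQS : Q.1 ≠ S.1 := hm.loop _ h1
    have hSR' : S.1 ∉ insert Q.1 R := by simp [hSR, hQS.symm]
    have hne : (⟨S, Q, 0⟩ : Dart N) ≠ ⟨S, P', 0⟩ := by
      intro h; have := congrArg (fun d => d.t.1) h; simp at this; exact hQR (this ▸ hP')
    rcases big (insert S.1 (insert Q.1 R))
      ((Finset.subset_insert _ _).trans (Finset.subset_insert _ _))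
      (Finset.insert_subset hS (Finset.insert_subset hQ hR.1))
      (fun he => hSR (he ▸ Finset.mem_insert_self _ _)) with h' | h'
    · obtain ⟨e, he, hes, e1, e2⟩ := hm.third hQ ⟨Q, P, 0⟩ ⟨Q, S, 0⟩
      have het : e.t.1 = S.1 ∨ e.t.1 ∈ R := by
        have := hm.inst he
        rw [← h', Finset.mem_insert, Finset.mem_insert] at this
        rcases this with h | h | h
        · exact Or.inl h
        · exact absurd (hes.trans h.symm) (hm.loop _ he)
        · exact Or.inr h
      have hek := cost_ge e.k
      rcases het with het | het
      · have h3 := pot_add1 hm.sym hQR (hm.sym _ h0) rfl hP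
        have h4 := pot_add3 hm.sym hSR' (hm.sym _ h1) rfl (Finset.mem_insert_self _ _) h2 rfl
          (Finset.mem_insert_of_mem hP') (hm.sym _ he) het
          (by rw [rev_t, hes]; exact Finset.mem_insert_self _ _) hne
          (by intro h; exact e2 (by rw [← rev_rev e, ← h]; rfl))
          (by intro h; have := congrArg (fun d => d.t.1) h
              simp [hes] at this; exact hQR (this ▸ hP'))
        simp only [rev_k, cost0, cost1] at h3 h4
        rw [h'] at h4
        linarith
      · have h3 := pot_add2 hm.sym hQR (hm.sym _ h0) rfl hP he hes het e1.symm
        have h4 := pot_add2 hm.sym hSR' (hm.sym _ h1) rfl (Finset.mem_insert_self _ _) h2 rfl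
          (Finset.mem_insert_of_mem hP') hne
        simp only [rev_k, cost0, cost1] at h3 h4
        rw [h'] at h4
        linarith
    · have h3 := pot_add1 hm.sym hQR (hm.sym _ h0) rfl hP
      have h4 := pot_add2 hm.sym hSR' (hm.sym _ h1) rfl (Finset.mem_insert_self _ _) h2 rfl
        (Finset.mem_insert_of_mem hP') hne
      simp only [rev_k, cost0, cost1] at h3 h4
      linarith

/-- proper sets with two nodes have potential at least 11 -/
theorem MC.P2 {R : Finset N} (hR : R ⊂ V) {x y : N} (hx : x ∈ R) (hy : y ∈ R) (hxy : x ≠ y) :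
    11 ≤ pot D R := hm.p2 _ R rfl hR (two_le_card hx hy hxy)
end

end CG

namespace CG
variable {N : Type} [DecidableEq N]

def rm (D F : Finset (Dart N)) : Finset (Dart N) := D \ (F ∪ F.image Dart.rev)

theorem mem_rm {D F : Finset (Dart N)} {d} : d ∈ rm D F ↔ d ∈ D ∧ d ∉ F ∧ d.rev ∉ F := by
  simp only [rm, Finset.mem_sdiff, Finset.mem_union, Finset.mem_image, not_or]
  refine and_congr_right (fun _ => and_congr_right (fun _ => not_congr ?_))
  constructor
  · rintro ⟨a, ha, rfl⟩; exact ha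
  · intro h; exact ⟨_, h, rfl⟩

theorem rm_sym {D : Finset (Dart N)} (h : Sym D) (F) : Sym (rm D F) := by
  intro d hd; rw [mem_rm] at *; exact ⟨h d hd.1, hd.2.2, hd.2.1⟩

theorem pot_rm {D F : Finset (Dart N)} (hs : Sym D) (hFD : F ⊆ D) (hF : ∀ d ∈ F, d.rev ∉ F) (B : Finset N) :
    pot D B ≤ pot (rm D F) B - 2 * ∑ d ∈ inn F B, cost d.k := by
  have h1 : inn (rm D F) B ∪ (inn F B ∪ (inn F B).image Dart.rev) ⊆ inn D B := by
    intro d hd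
    simp only [Finset.mem_union, Finset.mem_image] at hd
    rcases hd with hd | hd | ⟨e, he, rfl⟩
    · rw [mem_inn, mem_rm] at hd; exact mem_inn.2 ⟨hd.1.1, hd.2⟩
    · rw [mem_inn] at hd; exact mem_inn.2 ⟨hFD hd.1, hd.2⟩
    · rw [mem_inn] at he; exact mem_inn.2 ⟨hs _ (hFD he.1), he.2.2, he.2.1⟩
  have d1 : Disjoint (inn F B) ((inn F B).image Dart.rev) := by
    rw [Finset.disjoint_left]
    intro d hd hd'
    obtain ⟨e, he, rfl⟩ := Finset.mem_image.1 hd'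
    exact hF _ (mem_inn.1 he).1 (mem_inn.1 hd).1
  have d2 : Disjoint (inn (rm D F) B) (inn F B ∪ (inn F B).image Dart.rev) := by
    rw [Finset.disjoint_left]
    intro d hd hd'
    rw [mem_inn, mem_rm] at hd
    rcases Finset.mem_union.1 hd' with h | h
    · exact hd.1.2.1 (mem_inn.1 h).1
    · obtain ⟨e, he, rfl⟩ := Finset.mem_image.1 h
      exact hd.1.2.2 (mem_inn.1 he).1
  have h3 := sum_cost_mono h1
  rw [Finset.sum_union d2, Finset.sum_union d1, sum_rev] at h3
  unfold pot
  linarith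

section
variable {D : Finset (Dart N)} {V : Finset N} (hm : MC D V)
include hm

/-- contraction with modification of the crossing edges -/
theorem MC.lemKM' {R : Finset N} (hRV : R ⊆ V) (hR : 2 ≤ R.card) {φ : N → St} (hφ : Good D R φ)
    {F : Finset (Dart N)} (hFD : F ⊆ D) (hF : ∀ d ∈ F, d.s.1 ∉ R ∧ d.t.1 ∈ R)
    {g : Dart N} (hgs : g.s.1 ∉ R) (hgt : g.t.1 ∈ R) (hgV : g.s.1 ∈ V)
    (hno1 : ∀ σ, Good (addG (rm D F) {g}) V σ → (∀ x ∈ R, σ x = φ x) → False) :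
    (∃ W ⊆ V, (∀ x ∈ W, x ∉ R) ∧ g.s.1 ∈ W ∧
      pot D (R ∪ W) ≤ pot D R - 6 + 2 * cost g.k - 2 * ∑ d ∈ inn F (R ∪ W), cost d.k) ∨
    (∃ W ⊆ V, (∀ x ∈ W, x ∉ R) ∧ g.s.1 ∉ W ∧
      pot D (R ∪ W) ≤ pot D R - 6 - 2 * ∑ d ∈ inn F (R ∪ W), cost d.k) ∨
    (∃ P P' Q : N × Fin 5, P.1 ∈ R ∧ P'.1 ∈ R ∧ Q.1 ∈ V ∧ Q.1 ∉ R ∧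
      (⟨P, Q, 0⟩ : Dart N) ∈ addG (rm D F) {g} ∧ (⟨P', Q, 1⟩ : Dart N) ∈ addG (rm D F) {g}) ∨
    (∃ P P' Q S : N × Fin 5, P.1 ∈ R ∧ P'.1 ∈ R ∧ Q.1 ∈ V ∧ Q.1 ∉ R ∧ S.1 ∈ V ∧ S.1 ∉ R ∧
      (⟨P, Q, 0⟩ : Dart N) ∈ addG (rm D F) {g} ∧ (⟨Q, S, 0⟩ : Dart N) ∈ addG (rm D F) {g} ∧
      (⟨S, P', 0⟩ : Dart N) ∈ addG (rm D F) {g}) := by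
  have hFr : ∀ d ∈ F, d.rev ∉ F := fun d hd h => (hF _ h).1 (hF _ hd).2
  have hl1 : Loopless (addG (rm D F) {g}) := by
    apply addG_loop
    · intro d hd; exact hm.loop d (mem_rm.1 hd).1
    · intro d hd; rw [Finset.mem_singleton] at hd; subst hd
      intro h; exact hgs (h ▸ hgt)
  have hs1 : Sym (addG (rm D F) {g}) := addG_sym (rm_sym hm.sym F) _
  -- inside R nothing changes
  have innB : ∀ B : Finset N, inn {g} B = ∅ → inn (addG (rm D F) {g}) B ⊆ inn D B := by
    intro B hB; rw [inn_addG_of_not hB]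
    intro d hd; rw [mem_inn, mem_rm] at hd; exact mem_inn.2 ⟨hd.1.1, hd.2⟩
  have gR : inn {g} R = ∅ := by
    ext d; simp only [mem_inn, Finset.mem_singleton]
    constructor
    · rintro ⟨rfl, h, _⟩; exact absurd h hgs
    · simp
  have hφ1 : Good (addG (rm D F) {g}) R φ := hφ.congr (innB R gR)
  have potR : pot (addG (rm D F) {g}) R = pot D R := by
    have : inn (addG (rm D F) {g}) R = inn D R := by
      apply (innB R gR).antisymm
      intro d hd; rw [mem_inn] at *
      refine ⟨mem_addG.2 (Or.inl (mem_rm.2 ⟨hd.1, ?_, ?_⟩)), hd.2⟩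
      · intro h; exact (hF _ h).1 hd.2.1
      · intro h; exact (hF _ h).1 hd.2.2
    unfold pot; rw [this]
  rcases lemK hm.ih hs1 hl1 hRV hR hφ1 hno1 with ⟨B, hB, hBR, h⟩ | ⟨W, hW, hWR, h⟩ | h | h
  · exfalso
    have gB : inn {g} B = ∅ := by
      ext d; simp only [mem_inn, Finset.mem_singleton]
      constructor
      · rintro ⟨rfl, _, h⟩; exact absurd hgt (hBR _ h)
      · simp
    have hBV : B ⊂ V := by
      refine lt_of_le_of_ne hB ?_
      rintro rfl
      obtain ⟨x, hx⟩ : R.Nonempty := Finset.card_pos.1 (by omega)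
      exact hBR x (hRV hx) hx
    obtain ⟨σ, hσ⟩ := hm.sub B hBV
    exact h ⟨σ, hσ.congr (innB B gB)⟩
  · rw [potR] at h
    have a := pot_rm hm.sym hFD hFr (R ∪ W)
    have b := pot_addG (rm D F) {g} (R ∪ W)
    by_cases hgW : g.s.1 ∈ W
    · left
      refine ⟨W, hW, hWR, hgW, ?_⟩
      have c := sum_cost_mono (F := inn {g} (R ∪ W)) (F' := {g}) (Finset.filter_subset _ _)
      simp only [Finset.sum_singleton] at c
      linarith
    · right; left
      refine ⟨W, hW, hWR, hgW, ?_⟩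
      have : inn {g} (R ∪ W) = ∅ := by
        ext d; simp only [mem_inn, Finset.mem_singleton, Finset.mem_union]
        constructor
        · rintro ⟨rfl, h, _⟩; exact absurd h (by tauto)
        · simp
      rw [this] at b
      simp only [Finset.sum_empty] at b
      linarith
  · right; right; left; exact h
  · right; right; right; exact h

theorem MC.lemKM {R : Finset N} (hRV : R ⊆ V) (hR : 2 ≤ R.card) {φ : N → St} (hφ : Good D R φ)
    {F : Finset (Dart N)} (hFD : F ⊆ D) (hF : ∀ d ∈ F, d.s.1 ∉ R ∧ d.t.1 ∈ R)
    {g : Dart N} (hgs : g.s.1 ∉ R) (hgt : g.t.1 ∈ R) (hgV : g.s.1 ∈ V)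
    (hno : ∀ σ, (∀ x ∈ R, σ x = φ x) → rel g.k (col σ g.s) (col σ g.t) = true →
      ∀ d ∈ F, rel d.k (col σ d.s) (col σ d.t) = true) :
    (∃ W ⊆ V, (∀ x ∈ W, x ∉ R) ∧ g.s.1 ∈ W ∧
      pot D (R ∪ W) ≤ pot D R - 6 + 2 * cost g.k - 2 * ∑ d ∈ inn F (R ∪ W), cost d.k) ∨
    (∃ W ⊆ V, (∀ x ∈ W, x ∉ R) ∧ g.s.1 ∉ W ∧
      pot D (R ∪ W) ≤ pot D R - 6 - 2 * ∑ d ∈ inn F (R ∪ W), cost d.k) ∨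
    (∃ P P' Q : N × Fin 5, P.1 ∈ R ∧ P'.1 ∈ R ∧ Q.1 ∈ V ∧ Q.1 ∉ R ∧
      (⟨P, Q, 0⟩ : Dart N) ∈ addG (rm D F) {g} ∧ (⟨P', Q, 1⟩ : Dart N) ∈ addG (rm D F) {g}) ∨
    (∃ P P' Q S : N × Fin 5, P.1 ∈ R ∧ P'.1 ∈ R ∧ Q.1 ∈ V ∧ Q.1 ∉ R ∧ S.1 ∈ V ∧ S.1 ∉ R ∧
      (⟨P, Q, 0⟩ : Dart N) ∈ addG (rm D F) {g} ∧ (⟨Q, S, 0⟩ : Dart N) ∈ addG (rm D F) {g} ∧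
      (⟨S, P', 0⟩ : Dart N) ∈ addG (rm D F) {g}) := by
  refine hm.lemKM' hRV hR hφ hFD hF hgs hgt hgV ?_
  intro σ hσ hx
  apply hm.nc
  have hg := hσ g (mem_addG.2 (Or.inr ⟨g, by simp, Or.inl rfl⟩)) hgV (hRV hgt)
  have hFs := hno σ hx hg
  refine ⟨σ, fun d hd h1 h2 => ?_⟩
  by_cases hdF : d ∈ F
  · exact hFs d hdF
  · by_cases hdF' : d.rev ∈ F
    · rw [rel_symm]; exact hFs _ hdF'
    · exact hσ d (mem_addG.2 (Or.inl (mem_rm.2 ⟨hd, hdF, hdF'⟩))) h1 h2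

omit hm in
theorem val_surj : ∀ (g : St) (c : Fin 5), ∃ i, val g i = c := by decide +kernel
omit hm in
theorem rel_t3 : ∀ x t : Fin 5, rel 0 x (t + 3) = true → x = t ∨ x = t + 1 := by decide +kernel

theorem MC.flex {u : N} (hu : u ∈ V) (h0 : ∀ d ∈ D, d.s.1 = u → d.k ≠ 0) {R : Finset N}
    (hR : R ⊆ V) (huR : u ∉ R) (hc : 2 ≤ R.card) {φ : N → St} (hφ : Good D R φ)
    (F : Finset (Dart N)) (hF : ∀ d, d ∈ F ↔ d ∈ D ∧ d.s.1 = u ∧ d.t.1 ∈ R) (l t : Fin 5)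
    (hst : ∀ st : St, (val st l = t ∨ val st l = t + 1) →
      ∀ d ∈ F, rel d.k (val st d.s.2) (col φ d.t) = true)
    (hF6 : ∑ d ∈ F, cost d.k ≤ 6) (hp : pot D R ≤ 2 + 2 * ∑ d ∈ F, cost d.k) : False := by
  obtain ⟨r, hr⟩ : R.Nonempty := Finset.card_pos.1 (by omega)
  obtain ⟨i, hi⟩ := val_surj (φ r) (t + 3)
  obtain ⟨x, hx, y, hy, hxy⟩ := Finset.one_lt_card.1 (show 1 < R.card by omega)
  have hRp : ∀ R', R ⊆ R' → R' ⊆ V → u ∉ R' → 11 ≤ pot D R' := by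
    intro R' h1 h2 h3
    exact hm.P2 (lt_of_le_of_ne h2 (fun h => h3 (h ▸ hu))) (h1 hx) (h1 hy) hxy
  let g : Dart N := ⟨(u, l), (r, i), 0⟩
  have key := hm.lemKM hR hc hφ (F := F) (fun d hd => ((hF d).1 hd).1)
    (fun d hd => by obtain ⟨_, b, c⟩ := (hF d).1 hd; exact ⟨b ▸ huR, c⟩)
    (g := g) huR hr hu (by
      intro σ hσ hg d hd
      obtain ⟨a, b, c⟩ := (hF d).1 hd
      have e1 : col σ d.t = col φ d.t := by unfold col; rw [hσ _ c]
      have e2 : col σ g.t = t + 3 := by simp only [col, g]; rw [hσ _ hr, hi]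
      rw [e2] at hg
      rw [e1]
      have := hst (σ u) (rel_t3 _ _ hg) d hd
      unfold col; unfold col at this; rw [b]; exact this)
  -- darts of the modified graph
  have dG : ∀ P Q : N × Fin 5, ∀ k, (⟨P, Q, k⟩ : Dart N) ∈ addG (rm D F) {g} →
      ((⟨P, Q, k⟩ : Dart N) ∈ D ∧ ¬ (P.1 = u ∧ Q.1 ∈ R) ∧ ¬ (Q.1 = u ∧ P.1 ∈ R)) ∨
      (k = 0 ∧ (Q.1 = u ∨ P.1 = u)) := by
    intro P Q k h
    rcases mem_addG.1 h with h | ⟨e, he, h⟩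
    · left
      rw [mem_rm, hF, hF] at h
      refine ⟨h.1, fun hh => h.2.1 ⟨h.1, hh⟩, fun hh => h.2.2 ⟨hm.sym _ h.1, hh⟩⟩
    · right
      rw [Finset.mem_singleton] at he; subst he
      rcases h with h | h
      · simp only [g, Dart.mk.injEq] at h; exact ⟨h.2.2, Or.inr (by rw [h.1])⟩
      · simp only [g, Dart.rev, Dart.mk.injEq] at h; exact ⟨h.2.2, Or.inl (by rw [h.2.1])⟩
  rcases key with ⟨W, hW, hWR, hgW, h⟩ | ⟨W, hW, hWR, hgW, h⟩ |
    ⟨P, P', Q, hP, hP', hQ, hQR, d0, d1⟩ | ⟨P, P', Q, S, hP, hP', hQ, hQR, hS, hSR, d0, d1, d2⟩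
  · have e : inn F (R ∪ W) = F := by
      ext d; rw [mem_inn]
      constructor
      · exact fun h => h.1
      · intro h; obtain ⟨a, b, c⟩ := (hF d).1 h
        refine ⟨h, ?_, ?_⟩
        · rw [b]; exact Finset.mem_union_right _ hgW
        · exact Finset.mem_union_left _ c
    rw [e] at h
    have h5 := hm.potge (R := R ∪ W) (Finset.union_subset hR hW)
      (hc.trans (Finset.card_le_card Finset.subset_union_left))
    have : cost g.k = 4 := rfl
    linarith
  · have h11 := hRp (R ∪ W) Finset.subset_union_left (Finset.union_subset hR hW)
      (by simp only [Finset.mem_union, not_or]; exact ⟨huR, hgW⟩)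
    have : 0 ≤ ∑ d ∈ inn F (R ∪ W), cost d.k := Finset.sum_nonneg (fun d _ => cost_nonneg _)
    linarith
  · have hPu : P.1 ≠ u := fun h => huR (h ▸ hP)
    have hPu' : P'.1 ≠ u := fun h => huR (h ▸ hP')
    rcases dG _ _ _ d1 with ⟨d1, _, n1⟩ | ⟨h, _⟩
    · have hQu : Q.1 ≠ u := fun h => n1 ⟨h, hP'⟩
      rcases dG _ _ _ d0 with ⟨d0, _, n0⟩ | ⟨_, h⟩
      · have h3 := pot_add2 hm.sym hQR (hm.sym _ d0) rfl hP (hm.sym _ d1) rfl hP'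
          (by intro h; simpa using congrArg Dart.k h)
        have h11 := hRp (insert Q.1 R) (Finset.subset_insert _ _) (Finset.insert_subset hQ hR)
          (by simp only [Finset.mem_insert, not_or]; exact ⟨hQu.symm, huR⟩)
        simp only [rev_k, cost0, cost1] at h3
        linarith
      · rcases h with h | h <;> contradiction
    · exact absurd h (by decide)
  · have hPu : P.1 ≠ u := fun h => huR (h ▸ hP)
    have hPu' : P'.1 ≠ u := fun h => huR (h ▸ hP')
    have d1' : (⟨Q, S, 0⟩ : Dart N) ∈ D := by
      rcases mem_addG.1 d1 with h | ⟨e, he, h⟩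
      · exact (mem_rm.1 h).1
      · exfalso
        rw [Finset.mem_singleton] at he; subst he
        rcases h with h | h
        · simp only [g, Dart.mk.injEq] at h; exact hSR (by rw [h.2.1]; exact hr)
        · simp only [g, Dart.rev, Dart.mk.injEq] at h; exact hQR (by rw [h.1]; exact hr)
    have hQu : Q.1 ≠ u := fun h => h0 _ d1' h rfl
    have hSu : S.1 ≠ u := fun h => h0 _ (hm.sym _ d1') h rfl
    have hQS : Q.1 ≠ S.1 := hm.loop _ d1'
    rcases dG _ _ _ d0 with ⟨d0, _, n0⟩ | ⟨_, h⟩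
    · rcases dG _ _ _ d2 with ⟨d2, _, n2⟩ | ⟨_, h⟩
      · have hSR' : S.1 ∉ insert Q.1 R := by simp [hSR, hQS.symm]
        have h11 := hRp (insert S.1 (insert Q.1 R))
          ((Finset.subset_insert _ _).trans (Finset.subset_insert _ _))
          (Finset.insert_subset hS (Finset.insert_subset hQ hR))
          (by simp only [Finset.mem_insert, not_or]; exact ⟨hSu.symm, hQu.symm, huR⟩)
        have h3 := pot_add1 hm.sym hQR (hm.sym _ d0) rfl hP
        have h4 := pot_add2 hm.sym hSR' (hm.sym _ d1') rfl (Finset.mem_insert_self _ _) d2 rfl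
          (Finset.mem_insert_of_mem hP')
          (by intro h; have := congrArg (fun d => d.t.1) h; simp at this; exact hQR (this ▸ hP'))
        simp only [rev_k, cost0, cost1] at h3 h4
        linarith
      · rcases h with h | h <;> contradiction
    · rcases h with h | h <;> contradiction

/-- 2-gadgets always work -/
theorem MC.gk2 {A} (hA : A ⊂ V) {P Q : N × Fin 5} (hP : P.1 ∈ A) (hQ : Q.1 ∈ A)
    (hPQ : P ≠ Q) : ∃ σ, Good D A σ ∧ rel 2 (col σ P) (col σ Q) = true := by
  by_cases h : P.1 = Q.1
  · obtain ⟨σ, hσ⟩ := hm.sub _ hA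
    refine ⟨σ, hσ, ?_⟩
    unfold col; rw [h]; exact val_inj _ _ _ (fun h2 => hPQ (Prod.ext h h2))
  · rcases gad1 hm hA hP hQ h 2 with h | ⟨B, hB, b1, b2, hp⟩ | ⟨h0, _⟩ | ⟨h0, _⟩
    · exact h
    · have := hm.P2 (lt_of_le_of_lt hB hA) b1 b2 h
      rw [cost2] at hp; linarith
    · exact absurd h0 (by decide)
    · exact absurd h0 (by decide)

/-- 1-gadgets work unless there is a 0-dart -/
theorem MC.gk1 {A} (hA : A ⊂ V) {P Q : N × Fin 5} (hP : P.1 ∈ A) (hQ : Q.1 ∈ A)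
    (hPQ : P.1 ≠ Q.1) : (∃ σ, Good D A σ ∧ rel 1 (col σ P) (col σ Q) = true) ∨
      (⟨P, Q, 0⟩ : Dart N) ∈ D := by
  rcases gad1 hm hA hP hQ hPQ 1 with h | ⟨B, hB, b1, b2, hp⟩ | ⟨_, h0⟩ | ⟨h0, _⟩
  · exact Or.inl h
  · have := hm.P2 (lt_of_le_of_lt hB hA) b1 b2 hPQ
    rw [cost1] at hp; linarith
  · exact Or.inr h0
  · exact absurd h0 (by decide)

end

end CG

namespace CG
variable {N : Type} [DecidableEq N]

section
variable {D : Finset (Dart N)} {V : Finset N} (hm : MC D V)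
include hm

def endsIn (g : Dart N) (B : Finset N) : Prop := g.s.1 ∈ B ∧ g.t.1 ∈ B

set_option maxHeartbeats 1000000 in
theorem MC.gad2 {A} (hA : A ⊂ V) {g1 g2 : Dart N} (e1 : endsIn g1 A) (e2 : endsIn g2 A)
    (l1 : g1.s.1 ≠ g1.t.1) (l2 : g2.s.1 ≠ g2.t.1) :
    (∃ σ, Good D A σ ∧ rel g1.k (col σ g1.s) (col σ g1.t) = true ∧
      rel g2.k (col σ g2.s) (col σ g2.t) = true) ∨
    (∃ B ⊆ A, endsIn g1 B ∧ pot D B ≤ 4 + 2 * cost g1.k) ∨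
    (∃ B ⊆ A, endsIn g2 B ∧ pot D B ≤ 4 + 2 * cost g2.k) ∨
    (∃ B ⊆ A, endsIn g1 B ∧ endsIn g2 B ∧ pot D B ≤ 4 + 2 * cost g1.k + 2 * cost g2.k) ∨
    Tri1 D A g1 ∨ Tri1 D A g2 ∨
    ((g1.k = 0 ∨ g2.k = 0) ∧ ∃ B ⊆ A, endsIn g1 B ∧ endsIn g2 B ∧
      (∀ x ∈ B, x = g1.s.1 ∨ x = g1.t.1 ∨ x = g2.s.1 ∨ x = g2.t.1) ∧
      pot D B ≤ 6 + 2 * cost g1.k + 2 * cost g2.k) := by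
  have hG : Loopless ({g1, g2} : Finset (Dart N)) := by
    intro d hd; simp at hd; rcases hd with rfl | rfl <;> assumption
  have hs12 : ∀ X : Finset (Dart N), X ⊆ {g1, g2} → ∑ d ∈ X, cost d.k ≤ cost g1.k + cost g2.k := by
    intro X hX
    refine (sum_cost_mono hX).trans ?_
    by_cases h : g1 = g2
    · subst h; simp; exact cost_nonneg _
    · rw [Finset.sum_pair h]
  rcases gadG hm hA {g1, g2} hG with ⟨σ, h1, h2⟩ | ⟨B, hB, hne, hp⟩ | ht
  · left; exact ⟨σ, h1, h2 _ (by simp) e1.1 e1.2, h2 _ (by simp) e2.1 e2.2⟩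
  · by_cases i1 : endsIn g1 B
    · by_cases i2 : endsIn g2 B
      · right; right; right; left
        refine ⟨B, hB, i1, i2, ?_⟩
        have := hs12 (inn {g1, g2} B) (Finset.filter_subset _ _)
        linarith
      · right; left
        refine ⟨B, hB, i1, ?_⟩
        have : inn {g1, g2} B ⊆ {g1} := by
          intro d hd; rw [mem_inn] at hd; simp at hd
          rcases hd with ⟨rfl | rfl, h⟩
          · simp
          · exact absurd h i2
        have := sum_cost_mono this
        simp only [Finset.sum_singleton] at this
        linarith
    · right; right; left
      have hsub : inn {g1, g2} B ⊆ {g2} := by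
        intro d hd; rw [mem_inn] at hd; simp at hd
        rcases hd with ⟨rfl | rfl, h⟩
        · exact absurd h i1
        · simp
      obtain ⟨d, hd⟩ := hne
      have hd2 := hsub hd
      rw [Finset.mem_singleton] at hd2; subst hd2
      refine ⟨B, hB, (mem_inn.1 hd).2, ?_⟩
      have := sum_cost_mono hsub
      simp only [Finset.sum_singleton] at this
      linarith
  · right; right; right; right
    have hn := hm.notri_sub hA.1
    -- the case where both gadgets are used
    have both : ∀ g ∈ ({g1, g2} : Finset (Dart N)), ∀ g' ∈ ({g1, g2} : Finset (Dart N)), g ≠ g' →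
        ∀ B ⊆ A, endsIn g B → endsIn g' B →
        (∀ x ∈ B, x = g.s.1 ∨ x = g.t.1 ∨ x = g'.s.1 ∨ x = g'.t.1) → g.k = 0 →
        pot D B ≤ 6 + 2 * cost g.k + 2 * cost g'.k →
        ((g1.k = 0 ∨ g2.k = 0) ∧ ∃ B ⊆ A, endsIn g1 B ∧ endsIn g2 B ∧
          (∀ x ∈ B, x = g1.s.1 ∨ x = g1.t.1 ∨ x = g2.s.1 ∨ x = g2.t.1) ∧
          pot D B ≤ 6 + 2 * cost g1.k + 2 * cost g2.k) := by
      intro g hg g' hg' hne B hB i i' hx hk hp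
      simp at hg hg'
      rcases hg with rfl | rfl <;> rcases hg' with rfl | rfl
      · exact absurd rfl hne
      · exact ⟨Or.inl hk, B, hB, i, i', hx, hp⟩
      · refine ⟨Or.inr hk, B, hB, i', i, fun x h => ?_, by linarith⟩
        have := hx x h; tauto
      · exact absurd rfl hne
    have fin1 : (∃ g ∈ ({g1, g2} : Finset (Dart N)), Tri1 D A g) → Tri1 D A g1 ∨ Tri1 D A g2 ∨ 
        ((g1.k = 0 ∨ g2.k = 0) ∧ ∃ B ⊆ A, endsIn g1 B ∧ endsIn g2 B ∧
          (∀ x ∈ B, x = g1.s.1 ∨ x = g1.t.1 ∨ x = g2.s.1 ∨ x = g2.t.1) ∧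
          pot D B ≤ 6 + 2 * cost g1.k + 2 * cost g2.k) := by
      rintro ⟨g, hg, h⟩
      simp at hg
      rcases hg with rfl | rfl
      · exact Or.inl h
      · exact Or.inr (Or.inl h)
    rcases ht with ⟨P, Q, hP, hQ, h0, h1⟩ | ⟨P, Q, S, hP, hQ, hS, h1, h2, h3⟩
    · rcases tri01 hm.sym hP hQ hn h0 h1 with h | ⟨g, hg, g', hg', hk, hk', h, h'⟩
      · exact fin1 h
      · right; right
        refine both g hg g' hg' (fun h => by rw [h, hk'] at hk; exact absurd hk (by decide))
          {P.1, Q.1} ?_ ?_ ?_ ?_ hk ?_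
        · intro x hx; simp at hx; rcases hx with rfl | rfl <;> assumption
        · rcases h with rfl | rfl <;> simp [endsIn]
        · rcases h' with rfl | rfl <;> simp [endsIn]
        · intro x hx; simp at hx
          rcases h with rfl | rfl <;> rcases hx with rfl | rfl <;> simp
        · rw [hk, hk', cost0, cost1]
          unfold pot
          have : ({P.1, Q.1} : Finset N).card ≤ 2 := Finset.card_le_two
          have h0 : 0 ≤ ∑ d ∈ inn D {P.1, Q.1}, cost d.k :=
            Finset.sum_nonneg (fun d _ => cost_nonneg _)
          have : (({P.1, Q.1} : Finset N).card : ℤ) ≤ 2 := by exact_mod_cast this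
          linarith
    · have hll := addG_loop hm.loop hG
      have conv : ∀ X Y : N × Fin 5, (⟨X, Y, 0⟩ : Dart N) ∈ addG D {g1, g2} →
          (⟨X, Y, 0⟩ : Dart N) ∈ D ∨ ∃ g ∈ ({g1, g2} : Finset (Dart N)), g.k = 0 ∧
            ((g.s = X ∧ g.t = Y) ∨ (g.s = Y ∧ g.t = X)) := by
        intro X Y h
        rcases mem_addG.1 h with h | ⟨g, hg, h⟩
        · exact Or.inl h
        · refine Or.inr ⟨g, hg, ?_⟩
          rcases h with h | h
          · rw [← h]; simp
          · rw [← rev_rev g, ← h]; simp [Dart.rev]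
      have main : ∀ X Y Z : N × Fin 5, X.1 ∈ A → Y.1 ∈ A → Z.1 ∈ A →
          (⟨X, Y, 0⟩ : Dart N) ∈ addG D {g1, g2} →
          (⟨Y, Z, 0⟩ : Dart N) ∈ addG D {g1, g2} →
          (⟨Z, X, 0⟩ : Dart N) ∈ addG D {g1, g2} →
          (∃ g ∈ ({g1, g2} : Finset (Dart N)), g.k = 0 ∧
            ((g.s = X ∧ g.t = Y) ∨ (g.s = Y ∧ g.t = X))) →
          Tri1 D A g1 ∨ Tri1 D A g2 ∨ 
          ((g1.k = 0 ∨ g2.k = 0) ∧ ∃ B ⊆ A, endsIn g1 B ∧ endsIn g2 B ∧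
          (∀ x ∈ B, x = g1.s.1 ∨ x = g1.t.1 ∨ x = g2.s.1 ∨ x = g2.t.1) ∧
          pot D B ≤ 6 + 2 * cost g1.k + 2 * cost g2.k) := by
        intro X Y Z hX hY hZ a b c ⟨g, hg, hk, hgXY⟩
        have nXY := hll _ a; have nYZ := hll _ b; have nZX := hll _ c
        simp only at nXY nYZ nZX
        have sub3 : ({X.1, Y.1, Z.1} : Finset N) ⊆ A := by
          intro x hx; simp at hx; rcases hx with rfl | rfl | rfl <;> assumption
        have potb : ∀ P Q : N × Fin 5, (⟨P, Q, 0⟩ : Dart N) ∈ D → P.1 ∈ ({X.1, Y.1, Z.1} : Finset N) →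
            Q.1 ∈ ({X.1, Y.1, Z.1} : Finset N) → pot D {X.1, Y.1, Z.1} ≤ 22 := by
          intro P Q hd hP hQ
          have hsub : ({⟨P, Q, 0⟩, ⟨Q, P, 0⟩} : Finset (Dart N)) ⊆ inn D {X.1, Y.1, Z.1} := by
            intro d hd'; simp only [Finset.mem_insert, Finset.mem_singleton] at hd'
            rcases hd' with rfl | rfl
            · exact mem_inn.2 ⟨hd, hP, hQ⟩
            · exact mem_inn.2 ⟨hm.sym _ hd, hQ, hP⟩
          have h1 := sum_cost_mono hsub
          rw [Finset.sum_pair (by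
            intro h; simp only [Dart.mk.injEq] at h
            exact hm.loop _ hd (by rw [h.1]))] at h1
          simp only [cost0] at h1
          have h3 : ({X.1, Y.1, Z.1} : Finset N).card ≤ 3 := Finset.card_le_three
          have h3 : (({X.1, Y.1, Z.1} : Finset N).card : ℤ) ≤ 3 := by exact_mod_cast h3
          unfold pot
          linarith
        have iG : endsIn g {X.1, Y.1, Z.1} := by
          rcases hgXY with ⟨h, h'⟩ | ⟨h, h'⟩ <;> rw [endsIn, h, h'] <;> simp
        rcases conv _ _ b with b' | ⟨g', hg', hk', hYZ⟩
        · rcases conv _ _ c with c' | ⟨g', hg', hk', hZX⟩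
          · apply fin1
            refine ⟨g, hg, Or.inr ⟨hk, Or.inr ⟨Z, hZ, ?_⟩⟩⟩
            rcases hgXY with ⟨h, h'⟩ | ⟨h, h'⟩ <;> rw [h, h']
            · exact ⟨hm.sym _ c', hm.sym _ b'⟩
            · exact ⟨b', c'⟩
          · right; right
            refine both g hg g' hg' ?_ {X.1, Y.1, Z.1} sub3 iG ?_ ?_ hk ?_
            · rintro rfl; grind
            · rcases hZX with ⟨h, h'⟩ | ⟨h, h'⟩ <;> rw [endsIn, h, h'] <;> simp
            · intro x hx; simp at hx; grind
            · rw [hk, hk', cost0]; have := potb _ _ b' (by simp) (by simp); linarith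
        · by_cases hgg : g = g'
          · subst hgg; exfalso; grind
          · rcases conv _ _ c with c' | ⟨g'', hg'', hk'', hZX⟩
            · right; right
              refine both g hg g' hg' hgg {X.1, Y.1, Z.1} sub3 iG ?_ ?_ hk ?_
              · rcases hYZ with ⟨h, h'⟩ | ⟨h, h'⟩ <;> rw [endsIn, h, h'] <;> simp
              · intro x hx; simp at hx; grind
              · rw [hk, hk', cost0]; have := potb _ _ c' (by simp) (by simp); linarith
            · exfalso
              have : g'' = g ∨ g'' = g' := by simp at hg hg' hg''; grind
              clear both fin1 conv potb iG sub3 hs12 hll hn hG hg hg' hg'' e1 e2 l1 l2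
              rcases this with rfl | rfl <;> grind
      rcases conv _ _ h1 with c1 | c1
      · rcases conv _ _ h2 with c2 | c2
        · rcases conv _ _ h3 with c3 | c3
          · exact absurd (Or.inr ⟨P, Q, S, hP, hQ, hS, c1, c2, c3⟩) hn
          · exact main _ _ _ hS hP hQ h3 h1 h2 c3
        · exact main _ _ _ hQ hS hP h2 h3 h1 c2
      · exact main _ _ _ hP hQ hS h1 h2 h3 c1

end

end CG

namespace CG
variable {N : Type} [DecidableEq N]

/-! ### fast finite checks: sets of states as bit masks -/
def rot (S a : ℕ) : ℕ := (S * 2 ^ a) % 32 + (S * 2 ^ a) / 32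
def rset (k : Fin 3) : ℕ := if k.val = 0 then 12 else if k.val = 1 then 19 else 30
def msk (k : Fin 3) (p y : Fin 5) : ℕ :=
  rot (rset k) ((y.val + 5 - p.val) % 5) + 32 * rot (rset k) ((y.val + p.val) % 5)
def bit (st : St) : ℕ := st.1.val + if st.2 then 0 else 5

theorem msk_spec : ∀ k p y st, (msk k p y).testBit (bit st) = rel k (val st p) y := by
  decide +kernel
theorem msk_lt : ∀ k p y, msk k p y < 1024 := by decide +kernel
theorem bit_ex (n : ℕ) (h : n < 1024) (h0 : n ≠ 0) : ∃ st, n.testBit (bit st) = true := by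
  obtain ⟨i, hi⟩ := Nat.exists_testBit_of_ne_zero h0
  have : i < 10 := by
    by_contra hc
    have : n < 2 ^ i := lt_of_lt_of_le h (by
      calc 1024 = 2 ^ 10 := by norm_num
        _ ≤ 2 ^ i := Nat.pow_le_pow_right (by norm_num) (by omega))
    rw [Nat.testBit_lt_two_pow this] at hi
    exact absurd hi (by simp)
  by_cases h5 : i < 5
  · exact ⟨(⟨i, h5⟩, true), by simpa [bit] using hi⟩
  · refine ⟨(⟨i - 5, by omega⟩, false), ?_⟩
    have : bit (⟨i - 5, by omega⟩, false) = i := by simp [bit]; omega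
    rw [this]; exact hi

def ok3 (k1 k2 k3 : Fin 3) (p1 p2 p3 y1 y2 y3 : Fin 5) : Bool :=
  msk k1 p1 y1 &&& msk k2 p2 y2 &&& msk k3 p3 y3 != 0
def ok4 (k1 k2 k3 k4 : Fin 3) (p1 p2 p3 p4 y1 y2 y3 y4 : Fin 5) : Bool :=
  msk k1 p1 y1 &&& msk k2 p2 y2 &&& msk k3 p3 y3 &&& msk k4 p4 y4 != 0

theorem ok3_ex {k1 k2 k3 p1 p2 p3 y1 y2 y3} (h : ok3 k1 k2 k3 p1 p2 p3 y1 y2 y3 = true) :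
    ∃ st, rel k1 (val st p1) y1 = true ∧ rel k2 (val st p2) y2 = true ∧
      rel k3 (val st p3) y3 = true := by
  simp only [ok3, bne_iff_ne] at h
  obtain ⟨st, hst⟩ := bit_ex _ (lt_of_le_of_lt Nat.and_le_right (msk_lt k3 p3 y3)) h
  simp only [Nat.testBit_land, Bool.and_eq_true, msk_spec] at hst
  exact ⟨st, hst.1.1, hst.1.2, hst.2⟩
theorem ok4_ex {k1 k2 k3 k4 p1 p2 p3 p4 y1 y2 y3 y4}
    (h : ok4 k1 k2 k3 k4 p1 p2 p3 p4 y1 y2 y3 y4 = true) :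
    ∃ st, rel k1 (val st p1) y1 = true ∧ rel k2 (val st p2) y2 = true ∧
      rel k3 (val st p3) y3 = true ∧ rel k4 (val st p4) y4 = true := by
  simp only [ok4, bne_iff_ne] at h
  obtain ⟨st, hst⟩ := bit_ex _ (lt_of_le_of_lt Nat.and_le_right (msk_lt k4 p4 y4)) h
  simp only [Nat.testBit_land, Bool.and_eq_true, msk_spec] at hst
  exact ⟨st, hst.1.1.1, hst.1.1.2, hst.1.2, hst.2⟩

theorem fin5a : ∀ x y y0 : Fin 5, x - (y - y0) = (x + y0) - y := by decide +kernel
theorem fin5b : ∀ x y y0 : Fin 5, (x - y0) - (y - y0) = x - y := by decide +kernel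
theorem fin5c : ∀ a p p0 y0 : Fin 5, (a - p0 + y0) + p = a + (p - p0) + y0 := by decide +kernel
theorem fin5d : ∀ a p p0 y0 : Fin 5, (a + p0 + y0) - p = a - (p - p0) + y0 := by decide +kernel

theorem rel_shift (k x y y0) : rel k (x - y0) (y - y0) = rel k x y := by
  have h : ((x - y0) != (y - y0)) = (x != y) := by revert x y y0; decide +kernel
  simp only [rel, fin5b, h]
theorem rel_sub (k x y y0) : rel k x (y - y0) = rel k (x + y0) y := by
  have h : (x != (y - y0)) = ((x + y0) != y) := by revert x y y0; decide +kernel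
  simp only [rel, fin5a, h]
theorem st_norm (st : St) (p0 y0 : Fin 5) : ∃ st' : St, ∀ k p y,
    rel k (val st (p - p0)) (y - y0) = rel k (val st' p) y := by
  obtain ⟨a, b⟩ := st
  cases b
  · refine ⟨(a + p0 + y0, false), fun k p y => ?_⟩
    rw [rel_sub]; simp only [val]; simp [fin5d]
  · refine ⟨(a - p0 + y0, true), fun k p y => ?_⟩
    rw [rel_sub]; simp only [val]; simp [fin5c]

/-! ### counting -/
def wt (k : Fin 3) : ℕ := 6 - 2 * k.val

theorem wt_card : ∀ (k : Fin 3) (p y : Fin 5),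
    (Finset.univ.filter (fun st : St => rel k (val st p) y = false)).card = wt k := by
  decide +kernel

theorem exists_st (F : Finset (Dart N)) (σ : N → St) (h : ∑ d ∈ F, wt d.k < 10) :
    ∃ st, ∀ d ∈ F, rel d.k (val st d.s.2) (col σ d.t) = true := by
  by_contra hc
  push Not at hc
  have hsub : (Finset.univ : Finset St) ⊆ F.biUnion
      (fun d => Finset.univ.filter (fun st : St => rel d.k (val st d.s.2) (col σ d.t) = false)) := by
    intro st _
    obtain ⟨d, hd, h1⟩ := hc st
    rw [Finset.mem_biUnion]
    exact ⟨d, hd, by simpa using h1⟩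
  have h1 := Finset.card_le_card hsub
  have h2 := Finset.card_biUnion_le (s := F) (t := (fun d => Finset.univ.filter
      (fun st : St => rel d.k (val st d.s.2) (col σ d.t) = false)))
  simp only [wt_card] at h2
  have h3 : (Finset.univ : Finset St).card = 10 := by decide
  omega

theorem wt_cost : ∀ k, (wt k : ℤ) = 2 * cost k - 2 := by decide

section
variable {D : Finset (Dart N)} {V : Finset N} (hm : MC D V)
include hm

theorem MC.cnt {v} (hv : v ∈ V) : 10 ≤ ∑ d ∈ out D v, wt d.k := by
  by_contra hc
  obtain ⟨σ, hσ⟩ := hm.sub _ (hm.erase_ss hv)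
  obtain ⟨st, hst⟩ := exists_st (out D v) σ (by omega)
  exact hm.ext hσ st (fun d hd hs => hst d (mem_out.2 ⟨hd, hs⟩))

theorem MC.sumcost {v} (hv : v ∈ V) : 5 + ((out D v).card : ℤ) ≤ ∑ d ∈ out D v, cost d.k := by
  have h : (10 : ℤ) ≤ ∑ d ∈ out D v, (wt d.k : ℤ) := by exact_mod_cast hm.cnt hv
  simp only [wt_cost] at h
  rw [Finset.sum_sub_distrib, ← Finset.mul_sum] at h
  simp at h
  omega

theorem MC.sumcost8 {v} (hv : v ∈ V) : 8 ≤ ∑ d ∈ out D v, cost d.k := by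
  have := hm.sumcost hv; have := hm.deg3 hv; omega

/-- a pair of nodes is a proper subset -/
theorem MC.pair_ss {v b} (hv : v ∈ V) (hb : b ∈ V) (hvb : v ≠ b) : ({v, b} : Finset N) ⊂ V := by
  rw [Finset.ssubset_iff_subset_ne]
  refine ⟨by simp [Finset.insert_subset_iff, hv, hb], fun h => ?_⟩
  have h1 := pot_insert_le hm.sym (A := {b}) (v := v) (by simpa using hvb) (F := out D v) (by
    intro d hd
    rw [mem_out] at hd
    refine ⟨hd.1, hd.2, ?_⟩
    have h2 := hm.inst hd.1
    have h3 := hm.loop d hd.1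
    rw [← h] at h2
    simp only [Finset.mem_insert, Finset.mem_singleton] at h2 ⊢
    rcases h2 with h2 | h2
    · exact absurd (hd.2.trans h2.symm) h3
    · exact h2)
  rw [h, pot_single hm.loop] at h1
  have := hm.sumcost8 hv
  have := hm.potV
  omega

theorem MC.par {d1 d2 : Dart N} (h1 : d1 ∈ D) (h2 : d2 ∈ D) (hs : d1.s.1 = d2.s.1)
    (ht : d1.t.1 = d2.t.1) (hne : d1 ≠ d2) : d1.k = 2 ∧ d2.k = 2 := by
  have hl := hm.loop _ h1
  have hp := pot_add2 hm.sym (A := {d1.t.1}) (v := d1.s.1) (by simpa using hl) h1 rfl (by simp)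
    h2 hs.symm (by simp [ht]) hne
  rw [pot_single hm.loop] at hp
  have := hm.P2 (hm.pair_ss (hm.ins _ h1) (hm.inst h1) hl) (x := d1.s.1) (y := d1.t.1)
    (by simp) (by simp) hl
  have a1 := cost_ge d1.k
  have a2 := cost_ge d2.k
  have key : ∀ k : Fin 3, cost k = 2 → k = 2 := by decide
  constructor <;> apply key <;> omega

theorem MC.two_to {b v c : N} (hb : b ∈ V) (hV : V = {v, b, c}) {e0 e1 : Dart N} (h0 : e0 ∈ D)
    (hs0 : e0.s.1 = b) (ht0 : e0.t.1 = c) (hk0 : e0.k ≠ 2) (h1 : e1 ∈ D) (hs1 : e1.s.1 = b)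
    (ht1 : e1.t.1 = v) (hcv : c ≠ v) : e1.k = 2 := by
  obtain ⟨e, he, hes, hne0, hne1⟩ := hm.third hb e0 e1
  have h2 := hm.inst he
  have h3 := hm.loop e he
  rw [hV] at h2
  simp only [Finset.mem_insert, Finset.mem_singleton] at h2
  rcases h2 with h2 | h2 | h2
  · exact (hm.par h1 he (hs1.trans hes.symm) (ht1.trans h2.symm) hne1.symm).1
  · exact absurd (hes.trans h2.symm) h3
  · exact absurd (hm.par h0 he (hs0.trans hes.symm) (ht0.trans h2.symm) hne0.symm).1 hk0

theorem MC.zex {d0 d1 d2 : Dart N} (h0 : d0 ∈ D) (hk0 : d0.k = 0) (h1 : d1 ∈ D) (h2 : d2 ∈ D)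
    (hs : d1.s.1 = d2.s.1) (ht1 : d1.t.1 = d0.s.1) (ht2 : d2.t.1 = d0.t.1) :
    cost d1.k + cost d2.k ≤ 5 := by
  have hl0 := hm.loop _ h0
  have hl1 := hm.loop _ h1
  have hl2 := hm.loop _ h2
  have hne : d1 ≠ d2 := by rintro rfl; exact hl0 (ht1.symm.trans ht2)
  have hp0 := pot_add1 hm.sym (A := {d0.t.1}) (v := d0.s.1) (by simpa using hl0) h0 rfl (by simp)
  rw [pot_single hm.loop, hk0, cost0] at hp0
  have hn : d1.s.1 ∉ ({d0.s.1, d0.t.1} : Finset N) := by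
    simp only [Finset.mem_insert, Finset.mem_singleton, not_or]
    exact ⟨fun h => hl1 (h.trans ht1.symm), fun h => hl2 (hs ▸ h.trans ht2.symm)⟩
  have hp := pot_add2 hm.sym hn h1 rfl (by simp [ht1]) h2 hs.symm (by simp [ht2]) hne
  by_cases hV : insert d1.s.1 {d0.s.1, d0.t.1} = V
  · have e1 := hm.two_to (b := d0.s.1) (v := d1.s.1) (c := d0.t.1) (hm.ins _ h0) hV.symm h0 rfl rfl
      (by rw [hk0]; decide) (e1 := d1.rev) (hm.sym _ h1) ht1 rfl (by
        intro h; apply hn; simp [h])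
    have e2 := hm.two_to (b := d0.t.1) (v := d1.s.1) (c := d0.s.1) (hm.inst h0)
      (by rw [← hV]; congr 1; exact Finset.pair_comm _ _) (hm.sym _ h0) rfl rfl
      (by rw [rev_k, hk0]; decide) (e1 := d2.rev) (hm.sym _ h2) ht2 hs.symm (by
        intro h; apply hn; simp [h])
    rw [rev_k] at e1 e2
    rw [e1, e2]; decide
  · have hss : insert d1.s.1 {d0.s.1, d0.t.1} ⊂ V := by
      rw [Finset.ssubset_iff_subset_ne]
      refine ⟨?_, hV⟩
      simp [Finset.insert_subset_iff, hm.ins _ h1, hm.ins _ h0, hm.inst h0]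
    have := hm.P2 hss (x := d0.s.1) (y := d0.t.1) (by simp) (by simp) hl0
    omega

/-- a pair of darts at `v` of total cost at least 6 can be forced to be close -/
theorem MC.gk {v} (hv : v ∈ V) {d1 d2 : Dart N} (h1 : d1 ∈ D) (h2 : d2 ∈ D) (hs1 : d1.s.1 = v)
    (hs2 : d2.s.1 = v) (hne : d1 ≠ d2) (hc : 6 ≤ cost d1.k + cost d2.k) (k : Fin 3) (hk : k ≠ 0) :
    ∃ σ, Good D (V.erase v) σ ∧ rel k (col σ d1.t) (col σ d2.t) = true := by
  have a1 : d1.t.1 ∈ V.erase v :=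
    Finset.mem_erase.2 ⟨fun h => hm.loop _ h1 (hs1.trans h.symm), hm.inst h1⟩
  have a2 : d2.t.1 ∈ V.erase v :=
    Finset.mem_erase.2 ⟨fun h => hm.loop _ h2 (hs2.trans h.symm), hm.inst h2⟩
  have a3 : d1.t.1 ≠ d2.t.1 := by
    intro h
    have := hm.par h1 h2 (hs1.trans hs2.symm) h hne
    rw [this.1, this.2] at hc
    exact absurd hc (by decide)
  have hk' : k = 1 ∨ k = 2 := by revert k; decide
  rcases hk' with rfl | rfl
  · rcases hm.gk1 (hm.erase_ss hv) a1 a2 a3 with h | h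
    · exact h
    · have := hm.zex h rfl h1 h2 (hs1.trans hs2.symm) rfl rfl
      omega
  · exact hm.gk2 (hm.erase_ss hv) a1 a2 (fun h => a3 (congrArg Prod.fst h))
end

end CG

namespace CG
variable {N : Type} [DecidableEq N]

structure S3 (D : Finset (Dart N)) (v : N) (d1 d2 d3 : Dart N) : Prop where
  h1 : d1 ∈ D
  h2 : d2 ∈ D
  h3 : d3 ∈ D
  s1 : d1.s.1 = v
  s2 : d2.s.1 = v
  s3 : d3.s.1 = v
  n12 : d1 ≠ d2
  n13 : d1 ≠ d3
  n23 : d2 ≠ d3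
  all : ∀ d ∈ D, d.s.1 = v → d = d1 ∨ d = d2 ∨ d = d3

structure S4 (D : Finset (Dart N)) (v : N) (d1 d2 d3 d4 : Dart N) : Prop where
  h1 : d1 ∈ D
  h2 : d2 ∈ D
  h3 : d3 ∈ D
  h4 : d4 ∈ D
  s1 : d1.s.1 = v
  s2 : d2.s.1 = v
  s3 : d3.s.1 = v
  s4 : d4.s.1 = v
  n12 : d1 ≠ d2
  n13 : d1 ≠ d3
  n23 : d2 ≠ d3
  n14 : d1 ≠ d4
  n24 : d2 ≠ d4
  n34 : d3 ≠ d4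
  all : ∀ d ∈ D, d.s.1 = v → d = d1 ∨ d = d2 ∨ d = d3 ∨ d = d4

section
variable {D : Finset (Dart N)} {v : N} {d1 d2 d3 d4 : Dart N}

theorem S3.sw12 (S : S3 D v d1 d2 d3) : S3 D v d2 d1 d3 :=
  ⟨S.h2, S.h1, S.h3, S.s2, S.s1, S.s3, S.n12.symm, S.n23, S.n13,
    fun d hd hs => by have := S.all d hd hs; tauto⟩
theorem S3.sw23 (S : S3 D v d1 d2 d3) : S3 D v d1 d3 d2 :=
  ⟨S.h1, S.h3, S.h2, S.s1, S.s3, S.s2, S.n13, S.n12, S.n23.symm,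
    fun d hd hs => by have := S.all d hd hs; tauto⟩
theorem S3.sw13 (S : S3 D v d1 d2 d3) : S3 D v d3 d2 d1 := S.sw12.sw23.sw12
theorem S4.sw12 (S : S4 D v d1 d2 d3 d4) : S4 D v d2 d1 d3 d4 :=
  ⟨S.h2, S.h1, S.h3, S.h4, S.s2, S.s1, S.s3, S.s4, S.n12.symm, S.n23, S.n13, S.n24, S.n14, S.n34,
    fun d hd hs => by have := S.all d hd hs; tauto⟩
theorem S4.sw23 (S : S4 D v d1 d2 d3 d4) : S4 D v d1 d3 d2 d4 :=
  ⟨S.h1, S.h3, S.h2, S.h4, S.s1, S.s3, S.s2, S.s4, S.n13, S.n12, S.n23.symm, S.n14, S.n34, S.n24,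
    fun d hd hs => by have := S.all d hd hs; tauto⟩
theorem S4.sw13 (S : S4 D v d1 d2 d3 d4) : S4 D v d3 d2 d1 d4 := S.sw12.sw23.sw12
theorem S4.sw34 (S : S4 D v d1 d2 d3 d4) : S4 D v d1 d2 d4 d3 :=
  ⟨S.h1, S.h2, S.h4, S.h3, S.s1, S.s2, S.s4, S.s3, S.n12, S.n14, S.n24, S.n13, S.n23, S.n34.symm,
    fun d hd hs => by have := S.all d hd hs; tauto⟩

theorem S3.out (S : S3 D v d1 d2 d3) : out D v = {d1, d2, d3} := by
  ext d; rw [mem_out]; simp only [Finset.mem_insert, Finset.mem_singleton]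
  constructor
  · rintro ⟨h, hs⟩; exact S.all d h hs
  · rintro (rfl | rfl | rfl)
    exacts [⟨S.h1, S.s1⟩, ⟨S.h2, S.s2⟩, ⟨S.h3, S.s3⟩]
theorem S4.out (S : S4 D v d1 d2 d3 d4) : out D v = {d1, d2, d3, d4} := by
  ext d; rw [mem_out]; simp only [Finset.mem_insert, Finset.mem_singleton]
  constructor
  · rintro ⟨h, hs⟩; exact S.all d h hs
  · rintro (rfl | rfl | rfl | rfl)
    exacts [⟨S.h1, S.s1⟩, ⟨S.h2, S.s2⟩, ⟨S.h3, S.s3⟩, ⟨S.h4, S.s4⟩]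
theorem S3.sum {M : Type} [AddCommMonoid M] (S : S3 D v d1 d2 d3) (f : Dart N → M) :
    ∑ d ∈ CG.out D v, f d = f d1 + (f d2 + f d3) := by
  rw [S.out, Finset.sum_insert (by simp [S.n12, S.n13]), Finset.sum_pair S.n23]
theorem S4.sum {M : Type} [AddCommMonoid M] (S : S4 D v d1 d2 d3 d4) (f : Dart N → M) :
    ∑ d ∈ CG.out D v, f d = f d1 + (f d2 + (f d3 + f d4)) := by
  rw [S.out, Finset.sum_insert (by simp [S.n12, S.n13, S.n14]),
    Finset.sum_insert (by simp [S.n23, S.n24]), Finset.sum_pair S.n34]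
end

theorem norm3 {k1 k2 k3 p1 p2 p3 y1 y2 y3}
    (h : ok3 k1 k2 k3 (p1 - p3) (p2 - p3) 0 (y1 - y3) (y2 - y3) 0 = true) :
    ∃ st, rel k1 (val st p1) y1 = true ∧ rel k2 (val st p2) y2 = true ∧
      rel k3 (val st p3) y3 = true := by
  obtain ⟨st, h1, h2, h3⟩ := ok3_ex h
  obtain ⟨st', h'⟩ := st_norm st p3 y3
  have h3' : rel k3 (val st (p3 - p3)) (y3 - y3) = true := by rw [sub_self, sub_self]; exact h3
  rw [h'] at h3'
  rw [h'] at h1 h2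
  exact ⟨st', h1, h2, h3'⟩
theorem norm4 {k1 k2 k3 k4 p1 p2 p3 p4 y1 y2 y3 y4}
    (h : ok4 k1 k2 k3 k4 (p1 - p4) (p2 - p4) (p3 - p4) 0 (y1 - y4) (y2 - y4) (y3 - y4) 0 = true) :
    ∃ st, rel k1 (val st p1) y1 = true ∧ rel k2 (val st p2) y2 = true ∧
      rel k3 (val st p3) y3 = true ∧ rel k4 (val st p4) y4 = true := by
  obtain ⟨st, h1, h2, h3, h4⟩ := ok4_ex h
  obtain ⟨st', h'⟩ := st_norm st p4 y4
  have h4' : rel k4 (val st (p4 - p4)) (y4 - y4) = true := by rw [sub_self, sub_self]; exact h4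
  rw [h'] at h4'
  rw [h'] at h1 h2 h3
  exact ⟨st', h1, h2, h3, h4'⟩

theorem relz (k : Fin 3) (x y : Fin 5) : rel k (x - y) 0 = rel k x y := by
  have e : ∀ x : Fin 5, (0 : Fin 5) = x - x := by decide
  rw [e y, rel_shift]

theorem F220 : ∀ p1 p2, ∃ k : Fin 3, k ≠ 0 ∧ ∀ y1 y2, rel k y2 0 = true →
    ok3 2 2 0 p1 p2 0 y1 y2 0 = true := by decide +kernel
theorem F211 : ∀ p1 p2, ∃ k : Fin 3, k ≠ 0 ∧ ∀ y1 y2, rel k y2 0 = true →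
    ok3 2 1 1 p1 p2 0 y1 y2 0 = true := by decide +kernel
theorem F210 : ∀ p1 p2, ∃ k : Fin 3, ∀ y1 y2, rel k y2 0 = true →
    ok3 2 1 0 p1 p2 0 y1 y2 0 = true := by decide +kernel
theorem F111nv : ∀ p1 p2, (p1 = 0 ∧ p2 = 0) ∨
    (∃ k : Fin 3, k ≠ 0 ∧ ∀ y1 y2, rel k y2 0 = true → ok3 1 1 1 p1 p2 0 y1 y2 0 = true) ∨
    (∃ k : Fin 3, k ≠ 0 ∧ ∀ y1 y2, rel k y1 0 = true → ok3 1 1 1 p1 p2 0 y1 y2 0 = true) ∨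
    (∃ k : Fin 3, k ≠ 0 ∧ ∀ y1 y2, rel k y1 y2 = true → ok3 1 1 1 p1 p2 0 y1 y2 0 = true) := by
  decide +kernel
theorem F2221a : ∀ p1 p2 p3, (p1 = 1 ∨ p1 = 4) → ∀ y1 y2 y3, rel 2 y1 0 = true →
    ok4 2 2 2 1 p1 p2 p3 0 y1 y2 y3 0 = true := by decide +kernel
theorem F2221b : ∀ p1 p2 p3, (p1 = 2 ∨ p1 = 3) → ¬ (p2 = 1 ∨ p2 = 4) → ¬ (p3 = 1 ∨ p3 = 4) →
    (∀ y1 y2 y3, rel 2 y1 y2 = true → ok4 2 2 2 1 p1 p2 p3 0 y1 y2 y3 0 = true) ∨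
    (∀ y1 y2 y3, rel 2 y1 y3 = true → ok4 2 2 2 1 p1 p2 p3 0 y1 y2 y3 0 = true) := by
  decide +kernel
theorem F2221c : ∀ p1 p2 p3, (p1 = 2 ∨ p1 = 3) → ∀ y1 y2 y3, rel 1 y1 0 = true →
    ok4 2 2 2 1 p1 p2 p3 0 y1 y2 y3 0 = true := by decide +kernel

section
variable {D : Finset (Dart N)} {V : Finset N} (hm : MC D V)
include hm

theorem MC.big {R : Finset N} (hR : R ⊆ V) {x y : N} (hx : x ∈ R) (hy : y ∈ R) (hxy : x ≠ y) :
    R = V ∧ 5 ≤ pot D R ∨ R ⊂ V ∧ 11 ≤ pot D R := by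
  by_cases h : R = V
  · left; exact ⟨h, h ▸ hm.potV⟩
  · right
    have := Finset.ssubset_iff_subset_ne.2 ⟨hR, h⟩
    exact ⟨this, hm.P2 this hx hy hxy⟩

theorem MC.ext3 {v : N} {d1 d2 d3 : Dart N} (S : S3 D v d1 d2 d3) {σ : N → St}
    (hσ : Good D (V.erase v) σ)
    (h : ∃ st, rel d1.k (val st d1.s.2) (col σ d1.t) = true ∧
      rel d2.k (val st d2.s.2) (col σ d2.t) = true ∧
      rel d3.k (val st d3.s.2) (col σ d3.t) = true) : False := by
  obtain ⟨st, a1, a2, a3⟩ := h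
  refine hm.ext hσ st (fun d hd hs => ?_)
  rcases S.all d hd hs with rfl | rfl | rfl <;> assumption

theorem MC.ext4 {v : N} {d1 d2 d3 d4 : Dart N} (S : S4 D v d1 d2 d3 d4) {σ : N → St}
    (hσ : Good D (V.erase v) σ)
    (h : ∃ st, rel d1.k (val st d1.s.2) (col σ d1.t) = true ∧
      rel d2.k (val st d2.s.2) (col σ d2.t) = true ∧
      rel d3.k (val st d3.s.2) (col σ d3.t) = true ∧
      rel d4.k (val st d4.s.2) (col σ d4.t) = true) : False := by
  obtain ⟨st, a1, a2, a3, a4⟩ := h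
  refine hm.ext hσ st (fun d hd hs => ?_)
  rcases S.all d hd hs with rfl | rfl | rfl | rfl <;> assumption

theorem MC.tne {d1 d2 : Dart N} (h1 : d1 ∈ D) (h2 : d2 ∈ D) (hs : d1.s.1 = d2.s.1)
    (hne : d1 ≠ d2) (hk : d1.k ≠ 2 ∨ d2.k ≠ 2) : d1.t.1 ≠ d2.t.1 := by
  intro h
  have := hm.par h1 h2 hs h hne
  tauto

theorem MC.mem_er {d : Dart N} {v} (h : d ∈ D) (hs : d.s.1 = v) : d.t.1 ∈ V.erase v :=
  Finset.mem_erase.2 ⟨fun e => hm.loop _ h (hs.trans e.symm), hm.inst h⟩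

theorem MC.no220 {v} (hv : v ∈ V) {d1 d2 d3 : Dart N} (S : S3 D v d1 d2 d3) (k1 : d1.k = 2)
    (k2 : d2.k = 2) (k3 : d3.k = 0) : False := by
  obtain ⟨k, hk, h⟩ := F220 (d1.s.2 - d3.s.2) (d2.s.2 - d3.s.2)
  obtain ⟨σ, hσ, hr⟩ := hm.gk hv S.h2 S.h3 S.s2 S.s3 S.n23 (by rw [k2, k3]; decide) k hk
  refine hm.ext3 S hσ ?_
  rw [k1, k2, k3]
  exact norm3 (h _ _ (by rw [relz]; exact hr))

theorem MC.no211 {v} (hv : v ∈ V) {d1 d2 d3 : Dart N} (S : S3 D v d1 d2 d3) (k1 : d1.k = 2)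
    (k2 : d2.k = 1) (k3 : d3.k = 1) : False := by
  obtain ⟨k, hk, h⟩ := F211 (d1.s.2 - d3.s.2) (d2.s.2 - d3.s.2)
  obtain ⟨σ, hσ, hr⟩ := hm.gk hv S.h2 S.h3 S.s2 S.s3 S.n23 (by rw [k2, k3]; decide) k hk
  refine hm.ext3 S hσ ?_
  rw [k1, k2, k3]
  exact norm3 (h _ _ (by rw [relz]; exact hr))

theorem MC.v111 {v} (hv : v ∈ V) {d1 d2 d3 : Dart N} (S : S3 D v d1 d2 d3) (k1 : d1.k = 1)
    (k2 : d2.k = 1) (k3 : d3.k = 1) : d1.s = d3.s ∧ d2.s = d3.s := by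
  have e : ∀ x y : Fin 5, x - y = 0 → x = y := by decide
  rcases F111nv (d1.s.2 - d3.s.2) (d2.s.2 - d3.s.2) with ⟨a, b⟩ | ⟨k, hk, h⟩ | ⟨k, hk, h⟩ | ⟨k, hk, h⟩
  · exact ⟨Prod.ext (S.s1.trans S.s3.symm) (e _ _ a), Prod.ext (S.s2.trans S.s3.symm) (e _ _ b)⟩
  · exfalso
    obtain ⟨σ, hσ, hr⟩ := hm.gk hv S.h2 S.h3 S.s2 S.s3 S.n23 (by rw [k2, k3]; decide) k hk
    refine hm.ext3 S hσ ?_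
    rw [k1, k2, k3]
    exact norm3 (h _ _ (by rw [relz]; exact hr))
  · exfalso
    obtain ⟨σ, hσ, hr⟩ := hm.gk hv S.h1 S.h3 S.s1 S.s3 S.n13 (by rw [k1, k3]; decide) k hk
    refine hm.ext3 S hσ ?_
    rw [k1, k2, k3]
    exact norm3 (h _ _ (by rw [relz]; exact hr))
  · exfalso
    obtain ⟨σ, hσ, hr⟩ := hm.gk hv S.h1 S.h2 S.s1 S.s2 S.n12 (by rw [k1, k2]; decide) k hk
    refine hm.ext3 S hσ ?_
    rw [k1, k2, k3]
    exact norm3 (h _ _ (by rw [rel_shift]; exact hr))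

theorem MC.no210 {v} (hv : v ∈ V) {d1 d2 d3 : Dart N} (S : S3 D v d1 d2 d3) (k1 : d1.k = 2)
    (k2 : d2.k = 1) (k3 : d3.k = 0) : False := by
  obtain ⟨k, h⟩ := F210 (d1.s.2 - d3.s.2) (d2.s.2 - d3.s.2)
  have fin : ∀ σ, Good D (V.erase v) σ → rel k (col σ d2.t) (col σ d3.t) = true → False := by
    intro σ hσ hr
    refine hm.ext3 S hσ ?_
    rw [k1, k2, k3]
    exact norm3 (h _ _ (by rw [relz]; exact hr))
  by_cases hk : k ≠ 0
  · obtain ⟨σ, hσ, hr⟩ := hm.gk hv S.h2 S.h3 S.s2 S.s3 S.n23 (by rw [k2, k3]; decide) k hk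
    exact fin σ hσ hr
  · push Not at hk
    subst hk
    have t23 := hm.tne S.h2 S.h3 (S.s2.trans S.s3.symm) S.n23 (by rw [k2]; left; decide)
    have t12 := hm.tne S.h1 S.h2 (S.s1.trans S.s2.symm) S.n12 (by rw [k2]; right; decide)
    have t13 := hm.tne S.h1 S.h3 (S.s1.trans S.s3.symm) S.n13 (by rw [k3]; right; decide)
    have m1 := hm.mem_er S.h1 S.s1
    have m2 := hm.mem_er S.h2 S.s2
    have m3 := hm.mem_er S.h3 S.s3
    have c1 : cost d1.k = 2 := by rw [k1]; rfl
    have c2 : cost d2.k = 3 := by rw [k2]; rfl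
    have c3 : cost d3.k = 4 := by rw [k3]; rfl
    have sub : ∀ B ⊆ V.erase v, insert v B ⊆ V ∧ v ∉ B := fun B hB =>
      ⟨Finset.insert_subset hv (hB.trans (Finset.erase_subset _ _)),
        fun hh => (Finset.mem_erase.1 (hB hh)).1 rfl⟩
    rcases gad1 hm (hm.erase_ss hv) m2 m3 t23 0 with ⟨σ, hσ, hr⟩ | ⟨B, hB, b2, b3, hp⟩ | h' | ⟨-, h' | h'⟩
    · exact fin σ hσ hr
    · obtain ⟨hs, hvB⟩ := sub B hB
      rw [cost0] at hp
      rcases hm.big hs (Finset.mem_insert_of_mem b2) (Finset.mem_insert_of_mem b3) t23 with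
        ⟨he, _⟩ | ⟨_, hb⟩
      · have b1 : d1.t.1 ∈ B := by
          have := hm.inst S.h1
          rw [← he] at this
          exact Finset.mem_of_mem_insert_of_ne this (Finset.mem_erase.1 m1).1
        have := pot_add3 hm.sym hvB S.h1 S.s1 b1 S.h2 S.s2 b2 S.h3 S.s3 b3 S.n12 S.n13 S.n23
        omega
      · have := pot_add2 hm.sym hvB S.h2 S.s2 b2 S.h3 S.s3 b3 S.n23
        omega
    · exact absurd h'.1 (by decide)
    · have hs := sub {d2.t.1, d3.t.1} (by simp only [Finset.insert_subset_iff, Finset.singleton_subset_iff]; exact ⟨m2, m3⟩)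
      have p1 := pot_add1 hm.sym (A := {d3.t.1}) (v := d2.t.1) (by simpa using t23) h' rfl (by simp)
      rw [pot_single hm.loop] at p1
      have p2 := pot_add2 hm.sym hs.2 S.h2 S.s2 (by simp) S.h3 S.s3 (by simp) S.n23
      have cc : cost (⟨d2.t, d3.t, 1⟩ : Dart N).k = 3 := rfl
      rcases hm.big hs.1 (x := d2.t.1) (y := d3.t.1) (by simp) (by simp) t23 with ⟨he, _⟩ | ⟨_, hb⟩
      · have := hm.two_to (Finset.mem_of_mem_erase m2) he.symm h' rfl rfl (by show (1 : Fin 3) ≠ 2; decide)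
          (hm.sym _ S.h2) rfl S.s2 (Finset.mem_erase.1 m3).1
        rw [rev_k, k2] at this; exact absurd this (by decide)
      · omega
    · obtain ⟨T, hT, f1, f2⟩ := h'
      have nT2 : d2.t.1 ≠ T.1 := hm.loop _ f1
      have nT3 : T.1 ≠ d3.t.1 := hm.loop _ f2
      have hs := sub {d2.t.1, T.1, d3.t.1} (by simp only [Finset.insert_subset_iff, Finset.singleton_subset_iff]; exact ⟨m2, hT, m3⟩)
      have p1 := pot_add1 hm.sym (A := {d3.t.1}) (v := T.1) (by simpa using nT3) f2 rfl (by simp)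
      rw [pot_single hm.loop] at p1
      have n2 : d2.t.1 ∉ ({T.1, d3.t.1} : Finset N) := by simp [nT2, t23]
      have p2 := pot_add1 hm.sym n2 f1 rfl (by simp)
      have p3 := pot_add2 hm.sym hs.2 S.h2 S.s2 (by simp) S.h3 S.s3 (by simp) S.n23
      have cc : cost (⟨d2.t, T, 0⟩ : Dart N).k = 4 := rfl
      have cc' : cost (⟨T, d3.t, 0⟩ : Dart N).k = 4 := rfl
      rcases hm.big hs.1 (x := d2.t.1) (y := d3.t.1) (by simp) (by simp) t23 with ⟨he, _⟩ | ⟨_, hb⟩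
      · have hT1 : d1.t.1 = T.1 := by
          have h1 := hm.inst S.h1
          have := Finset.mem_erase.1 m1
          rw [← he] at h1
          simp only [Finset.mem_insert, Finset.mem_singleton] at h1
          tauto
        obtain ⟨e, hE, hes, ne1, ne2⟩ := hm.third (Finset.mem_of_mem_erase m2) ⟨d2.t, T, 0⟩ d2.rev
        have het : e.t.1 = d3.t.1 := by
          have h1 := hm.inst hE
          rw [← he] at h1
          simp only [Finset.mem_insert, Finset.mem_singleton] at h1
          rcases h1 with h1 | h1 | h1 | h1
          · have := hm.tne hE (hm.sym _ S.h2) hes ne2 (by right; rw [rev_k, k2]; decide)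
            exact absurd (h1.trans S.s2.symm) this
          · exact absurd (hes.trans h1.symm) (hm.loop _ hE)
          · have := hm.tne hE f1 hes ne1 (by right; show (0 : Fin 3) ≠ 2; decide)
            exact absurd h1 this
          · exact h1
        have p2 := pot_add2 hm.sym n2 f1 rfl (by simp) hE hes (by simp [het]) ne1.symm
        have p3 := pot_add3 hm.sym hs.2 S.h1 S.s1 (by simp [hT1]) S.h2 S.s2 (by simp) S.h3 S.s3
          (by simp) S.n12 S.n13 S.n23
        have := cost_ge e.k
        omega
      · omega

theorem MC.v2221_a {v} (hv : v ∈ V) {d1 d2 d3 d4 : Dart N} (S : S4 D v d1 d2 d3 d4)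
      (k1 : d1.k = 2) (k2 : d2.k = 2) (k3 : d3.k = 2) (k4 : d4.k = 1) :
      ¬ (d1.s.2 - d4.s.2 = 1 ∨ d1.s.2 - d4.s.2 = 4) := by
  intro h
  have t14 := hm.tne S.h1 S.h4 (S.s1.trans S.s4.symm) S.n14 (by rw [k4]; right; decide)
  obtain ⟨σ, hσ, hr⟩ := hm.gk2 (hm.erase_ss hv) (hm.mem_er S.h1 S.s1) (hm.mem_er S.h4 S.s4)
      (fun h => t14 (congrArg Prod.fst h))
  refine hm.ext4 S hσ ?_
  rw [k1, k2, k3, k4]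
  exact norm4 (F2221a _ _ _ h _ _ _ (by rw [relz]; exact hr))

/-- exclusion of a nonvertex 2221 -/
theorem MC.v2221_aux {v} (hv : v ∈ V) {d1 d2 d3 d4 : Dart N} (S : S4 D v d1 d2 d3 d4)
    (k1 : d1.k = 2) (k2 : d2.k = 2) (k3 : d3.k = 2) (k4 : d4.k = 1) : d1.s = d4.s := by
  have e : ∀ x y : Fin 5, x = y ∨ (x - y = 1 ∨ x - y = 4) ∨ (x - y = 2 ∨ x - y = 3) := by decide
  rcases e d1.s.2 d4.s.2 with h | h | h
  · exact Prod.ext (S.s1.trans S.s4.symm) h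
  · exact (hm.v2221_a hv S k1 k2 k3 k4 h).elim
  · exfalso
    have main : ∀ {d2 d3 : Dart N}, S4 D v d1 d2 d3 d4 → d2.k = 2 → d3.k = 2 →
        (∀ y1 y2 y3, rel 2 y1 y2 = true → ok4 2 2 2 1 (d1.s.2 - d4.s.2) (d2.s.2 - d4.s.2)
          (d3.s.2 - d4.s.2) 0 y1 y2 y3 0 = true) → False := by
      intro d2 d3 S k2 k3 hh
      by_cases h12 : d1.t = d2.t
      · have t14 := hm.tne S.h1 S.h4 (S.s1.trans S.s4.symm) S.n14 (by rw [k4]; right; decide)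
        have m1 := hm.mem_er S.h1 S.s1
        have m4 := hm.mem_er S.h4 S.s4
        rcases hm.gk1 (hm.erase_ss hv) m1 m4 t14 with ⟨σ, hσ, hr⟩ | h0
        · refine hm.ext4 S hσ ?_
          rw [k1, k2, k3, k4]
          exact norm4 (F2221c _ _ _ h _ _ _ (by rw [relz]; exact hr))
        · have c1 : cost d1.k = 2 := by rw [k1]; rfl
          have c2 : cost d2.k = 2 := by rw [k2]; rfl
          have c3 : cost d3.k = 2 := by rw [k3]; rfl
          have c4 : cost d4.k = 3 := by rw [k4]; rfl
          have p1 := pot_add1 hm.sym (A := {d4.t.1}) (v := d1.t.1) (by simpa using t14) h0 rfl (by simp)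
          rw [pot_single hm.loop] at p1
          have cc : cost (⟨d1.t, d4.t, 0⟩ : Dart N).k = 4 := rfl
          have hvB : v ∉ ({d1.t.1, d4.t.1} : Finset N) := by
            have := (Finset.mem_erase.1 m1).1
            have := (Finset.mem_erase.1 m4).1
            simp only [Finset.mem_insert, Finset.mem_singleton]; tauto
          have hs : insert v ({d1.t.1, d4.t.1} : Finset N) ⊆ V := by
            simp only [Finset.insert_subset_iff, Finset.singleton_subset_iff]
            exact ⟨hv, hm.inst S.h1, hm.inst S.h4⟩
          rcases hm.big hs (x := d1.t.1) (y := d4.t.1) (by simp) (by simp) t14 with ⟨he, _⟩ | ⟨_, hb⟩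
          · have b3 : d3.t.1 ∈ ({d1.t.1, d4.t.1} : Finset N) := by
              have := hm.inst S.h3
              rw [← he] at this
              exact Finset.mem_of_mem_insert_of_ne this (Finset.mem_erase.1 (hm.mem_er S.h3 S.s3)).1
            have := pot_add4 hm.sym hvB S.h1 S.s1 (by simp) S.h2 S.s2 (by simp [← h12]) S.h3 S.s3 b3
              S.h4 S.s4 (by simp) S.n12 S.n13 S.n23 S.n14 S.n24 S.n34
            omega
          · have := pot_add3 hm.sym hvB S.h1 S.s1 (by simp) S.h2 S.s2 (by simp [← h12])
              S.h4 S.s4 (by simp) S.n12 S.n14 S.n24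
            omega
      · obtain ⟨σ, hσ, hr⟩ := hm.gk2 (hm.erase_ss hv) (hm.mem_er S.h1 S.s1) (hm.mem_er S.h2 S.s2) h12
        refine hm.ext4 S hσ ?_
        rw [k1, k2, k3, k4]
        exact norm4 (hh _ _ _ (by rw [rel_shift]; exact hr))
    rcases F2221b (d1.s.2 - d4.s.2) (d2.s.2 - d4.s.2) (d3.s.2 - d4.s.2) h
      (hm.v2221_a hv S.sw12 k2 k1 k3 k4) (hm.v2221_a hv S.sw13 k3 k2 k1 k4) with hh | hh
    · exact main S k2 k3 hh
    · refine main S.sw23 k3 k2 (fun y1 y2 y3 hr => ?_)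
      have := hh y1 y3 y2 hr
      simp only [ok4] at this ⊢
      rw [Nat.and_assoc (msk 2 _ y1)] at this ⊢
      rw [Nat.and_comm (msk 2 (d3.s.2 - d4.s.2) y2)]
      exact this
end

omit [DecidableEq N] in
theorem pick [DecidableEq N] (S : Finset (Dart N)) (n : ℕ) (h : S.card = n + 1) :
    ∃ d S', S = insert d S' ∧ d ∉ S' ∧ S'.card = n ∧ ∀ e ∈ S', e.k ≤ d.k := by
  obtain ⟨d, hd, hmax⟩ := Finset.exists_max_image S Dart.k (Finset.card_pos.1 (by omega))
  refine ⟨d, S.erase d, (Finset.insert_erase hd).symm, Finset.notMem_erase _ _, ?_, ?_⟩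
  · rw [Finset.card_erase_of_mem hd]; omega
  · intro e he; exact hmax e (Finset.mem_of_mem_erase he)

def sw (k : Fin 3) : ℤ := if k = 0 then 2 else 1

def Strict (D : Finset (Dart N)) (v : N) : Prop := 5 ≤ ∑ d ∈ out D v, sw d.k
def T111 (D : Finset (Dart N)) (v : N) (d1 d2 d3 : Dart N) : Prop :=
  S3 D v d1 d2 d3 ∧ d1.k = 1 ∧ d2.k = 1 ∧ d3.k = 1 ∧ d1.s = d3.s ∧ d2.s = d3.s
def TA (D : Finset (Dart N)) (v : N) (d1 d2 d3 : Dart N) : Prop :=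
  S3 D v d1 d2 d3 ∧ d1.k = 1 ∧ d2.k = 1 ∧ d3.k = 0
def T2221 (D : Finset (Dart N)) (v : N) (d1 d2 d3 d4 : Dart N) : Prop :=
  S4 D v d1 d2 d3 d4 ∧ d1.k = 2 ∧ d2.k = 2 ∧ d3.k = 2 ∧ d4.k = 1 ∧ d1.s = d4.s ∧ d2.s = d4.s ∧
    d3.s = d4.s
def TB (D : Finset (Dart N)) (v : N) (d1 d2 d3 d4 : Dart N) : Prop :=
  S4 D v d1 d2 d3 d4 ∧ d1.k = 2 ∧ d2.k = 2 ∧ d3.k = 1 ∧ d4.k = 1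
def TC (D : Finset (Dart N)) (v : N) (d1 d2 d3 d4 : Dart N) : Prop :=
  S4 D v d1 d2 d3 d4 ∧ d1.k = 2 ∧ d2.k = 1 ∧ d3.k = 1 ∧ d4.k = 1
def TD (D : Finset (Dart N)) (v : N) (d1 d2 d3 d4 : Dart N) : Prop :=
  S4 D v d1 d2 d3 d4 ∧ d1.k = 1 ∧ d2.k = 1 ∧ d3.k = 1 ∧ d4.k = 1

theorem lab3 : ∀ k1 k2 k3 : Fin 3, k2 ≤ k1 → k3 ≤ k1 → k3 ≤ k2 → 8 ≤ cost k1 + (cost k2 + cost k3) →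
    sw k1 + (sw k2 + sw k3) ≤ 4 → (k1 = 2 ∧ k2 = 2 ∧ k3 = 0) ∨ (k1 = 2 ∧ k2 = 1 ∧ k3 = 0) ∨
    (k1 = 2 ∧ k2 = 1 ∧ k3 = 1) ∨ (k1 = 1 ∧ k2 = 1 ∧ k3 = 1) ∨ (k1 = 1 ∧ k2 = 1 ∧ k3 = 0) := by
  decide
set_option synthInstance.maxHeartbeats 400000 in
set_option synthInstance.maxSize 1000 in
theorem lab4 : ∀ k1 k2 k3 k4 : Fin 3, k2 ≤ k1 → k3 ≤ k2 → k4 ≤ k3 →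
    9 ≤ cost k1 + (cost k2 + (cost k3 + cost k4)) →
    sw k1 + (sw k2 + (sw k3 + sw k4)) ≤ 4 → (k1 = 2 ∧ k2 = 2 ∧ k3 = 2 ∧ k4 = 1) ∨
    (k1 = 2 ∧ k2 = 2 ∧ k3 = 1 ∧ k4 = 1) ∨
    (k1 = 2 ∧ k2 = 1 ∧ k3 = 1 ∧ k4 = 1) ∨ (k1 = 1 ∧ k2 = 1 ∧ k3 = 1 ∧ k4 = 1) := by
  decide +kernel

theorem MC.classify {D : Finset (Dart N)} {V : Finset N} (hm : MC D V) {v} (hv : v ∈ V) :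
    Strict D v ∨ (∃ d1 d2 d3, T111 D v d1 d2 d3) ∨ (∃ d1 d2 d3, TA D v d1 d2 d3) ∨
    (∃ d1 d2 d3 d4, T2221 D v d1 d2 d3 d4) ∨ (∃ d1 d2 d3 d4, TB D v d1 d2 d3 d4) ∨
    (∃ d1 d2 d3 d4, TC D v d1 d2 d3 d4) ∨ (∃ d1 d2 d3 d4, TD D v d1 d2 d3 d4) := by
  by_cases hst : Strict D v
  · exact Or.inl hst
  right
  have h5 : ∑ d ∈ out D v, sw d.k ≤ 4 := by unfold Strict at hst; omega
  have hc := hm.sumcost hv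
  have hm3 := hm.deg3 hv
  have hsw : ((out D v).card : ℤ) ≤ ∑ d ∈ out D v, sw d.k := by
    rw [Finset.cast_card]
    exact Finset.sum_le_sum (fun d _ => by have : ∀ k, 1 ≤ sw k := by decide
                                           exact this d.k)
  have hcard : (out D v).card = 3 ∨ (out D v).card = 4 := by omega
  have mo : ∀ d, d ∈ out D v → d ∈ D ∧ d.s.1 = v := fun d => mem_out.1
  rcases hcard with hcard | hcard
  · obtain ⟨d1, S1, e1, n1, c1, l1⟩ := pick _ _ hcard
    obtain ⟨d2, S2, e2, n2, c2, l2⟩ := pick _ _ c1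
    obtain ⟨d3, S3', e3, n3, c3, l3⟩ := pick _ _ c2
    have : S3' = ∅ := Finset.card_eq_zero.1 c3
    subst this; subst e3; subst e2
    simp at n1 n2 l1 l2
    have S : S3 D v d1 d2 d3 := by
      have a1 := mo d1 (by rw [e1]; simp)
      have a2 := mo d2 (by rw [e1]; simp)
      have a3 := mo d3 (by rw [e1]; simp)
      refine ⟨a1.1, a2.1, a3.1, a1.2, a2.2, a3.2, n1.1, n1.2, n2, fun d hd hs => ?_⟩
      have := mem_out.2 ⟨hd, hs⟩
      rw [e1] at this; simpa using this
    have hs1 := S.sum (fun d => cost d.k)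
    have hs2 := S.sum (fun d => sw d.k)
    rcases lab3 d1.k d2.k d3.k l1.1 l1.2 l2 (by omega) (by omega) with
      ⟨k1, k2, k3⟩ | ⟨k1, k2, k3⟩ | ⟨k1, k2, k3⟩ | ⟨k1, k2, k3⟩ | ⟨k1, k2, k3⟩
    · exact (hm.no220 hv S k1 k2 k3).elim
    · exact (hm.no210 hv S k1 k2 k3).elim
    · exact (hm.no211 hv S k1 k2 k3).elim
    · left; exact ⟨d1, d2, d3, S, k1, k2, k3, hm.v111 hv S k1 k2 k3⟩
    · right; left; exact ⟨d1, d2, d3, S, k1, k2, k3⟩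
  · obtain ⟨d1, S1, e1, n1, c1, l1⟩ := pick _ _ hcard
    obtain ⟨d2, S2, e2, n2, c2, l2⟩ := pick _ _ c1
    obtain ⟨d3, S3', e3, n3, c3, l3⟩ := pick _ _ c2
    obtain ⟨d4, S4', e4, n4, c4, l4⟩ := pick _ _ c3
    have : S4' = ∅ := Finset.card_eq_zero.1 c4
    subst this; subst e4; subst e3; subst e2
    simp at n1 n2 n3 l1 l2 l3
    have S : S4 D v d1 d2 d3 d4 := by
      have a1 := mo d1 (by rw [e1]; simp)
      have a2 := mo d2 (by rw [e1]; simp)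
      have a3 := mo d3 (by rw [e1]; simp)
      have a4 := mo d4 (by rw [e1]; simp)
      refine ⟨a1.1, a2.1, a3.1, a4.1, a1.2, a2.2, a3.2, a4.2, n1.1, n1.2.1, n2.1, n1.2.2, n2.2, n3,
        fun d hd hs => ?_⟩
      have := mem_out.2 ⟨hd, hs⟩
      rw [e1] at this; simpa using this
    have hs1 := S.sum (fun d => cost d.k)
    have hs2 := S.sum (fun d => sw d.k)
    right; right
    rcases lab4 d1.k d2.k d3.k d4.k l1.1 l2.1 l3 (by omega) (by omega) with
      ⟨k1, k2, k3, k4⟩ | ⟨k1, k2, k3, k4⟩ | ⟨k1, k2, k3, k4⟩ | ⟨k1, k2, k3, k4⟩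
    · left
      exact ⟨d1, d2, d3, d4, S, k1, k2, k3, k4, hm.v2221_aux hv S k1 k2 k3 k4,
        hm.v2221_aux hv S.sw12 k2 k1 k3 k4, hm.v2221_aux hv S.sw13 k3 k2 k1 k4⟩
    · right; left; exact ⟨d1, d2, d3, d4, S, k1, k2, k3, k4⟩
    · right; right; left; exact ⟨d1, d2, d3, d4, S, k1, k2, k3, k4⟩
    · right; right; right; exact ⟨d1, d2, d3, d4, S, k1, k2, k3, k4⟩

end CG

namespace CG
variable {N : Type} [DecidableEq N]

theorem ext_node {D : Finset (Dart N)} (hs : Sym D) (hl : Loopless D) {A : Finset N} {s : N}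
    {σ : N → St} (hσ : Good D A σ) (hsA : s ∉ A) (st : St)
    (h : ∀ d ∈ D, d.s.1 = s → d.t.1 ∈ A → rel d.k (val st d.s.2) (col σ d.t) = true) :
    Good D (insert s A) (Function.update σ s st) := by
  have c1 : ∀ P : N × Fin 5, P.1 ≠ s → col (Function.update σ s st) P = col σ P := by
    intro P hP; simp [col, Function.update_of_ne hP]
  have c2 : ∀ P : N × Fin 5, P.1 = s → col (Function.update σ s st) P = val st P.2 := by
    intro P hP; simp [col, hP]
  intro d hd h1 h2
  have hne := hl d hd
  by_cases e1 : d.s.1 = s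
  · have e2 : d.t.1 ≠ s := fun e => hne (e1.trans e.symm)
    rw [c2 _ e1, c1 _ e2]
    exact h d hd e1 (Finset.mem_of_mem_insert_of_ne h2 e2)
  · rw [c1 _ e1]
    by_cases e2 : d.t.1 = s
    · rw [c2 _ e2, rel_symm]
      exact h d.rev (hs d hd) e2 (Finset.mem_of_mem_insert_of_ne h1 e1)
    · rw [c1 _ e2]
      exact hσ d hd (Finset.mem_of_mem_insert_of_ne h1 e1) (Finset.mem_of_mem_insert_of_ne h2 e2)

theorem col_upd {σ : N → St} {s : N} {st : St} {P : N × Fin 5} (h : P.1 ≠ s) :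
    col (Function.update σ s st) P = col σ P := by simp [col, Function.update_of_ne h]
theorem col_upd' {σ : N → St} {s : N} {st : St} {P : N × Fin 5} (h : P.1 = s) :
    col (Function.update σ s st) P = val st P.2 := by simp [col, h]

/-- a node which, once its other two ends are close, forbids at most one colour -/
structure Sp (D : Finset (Dart N)) (s : N) (e1 e2 e3 : Dart N) (k : Fin 3) : Prop where
  S : S3 D s e1 e2 e3
  k1 : e1.k = 1
  k2 : e2.k = 1
  k3 : e3.k = 1 ∨ e3.k = 0
  add : 6 + 2 * cost k ≤ 2 * (cost e2.k + cost e3.k)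
  ex : ∀ y2 y3, rel k y2 y3 = true → ∃ m, ∀ c, c ≠ m → ∃ st, rel 1 (val st e1.s.2) c = true ∧
    rel e2.k (val st e2.s.2) y2 = true ∧ rel e3.k (val st e3.s.2) y3 = true

theorem ok3_p {k1 k2 k3 p1 p2 p3 y1 y2 y3}
    (h : ok3 k1 k2 k3 0 (p2 - p1) (p3 - p1) y1 y2 y3 = true) :
    ∃ st, rel k1 (val st p1) y1 = true ∧ rel k2 (val st p2) y2 = true ∧
      rel k3 (val st p3) y3 = true := by
  obtain ⟨st, h1, h2, h3⟩ := ok3_ex h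
  obtain ⟨st', h'⟩ := st_norm st p1 0
  have h1' : rel k1 (val st (p1 - p1)) (y1 - 0) = true := by rw [sub_self, sub_zero]; exact h1
  have h2' : rel k2 (val st (p2 - p1)) (y2 - 0) = true := by rw [sub_zero]; exact h2
  have h3' : rel k3 (val st (p3 - p1)) (y3 - 0) = true := by rw [sub_zero]; exact h3
  rw [h'] at h1' h2' h3'
  exact ⟨st', h1', h2', h3'⟩

theorem FspV : ∀ y2 y3, rel 1 y2 y3 = true → ∃ m, ∀ c, c ≠ m → ok3 1 1 1 0 0 0 c y2 y3 = true := by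
  decide +kernel
theorem FspA : ∀ p2 p3, ∃ k, ∀ y2 y3, rel k y2 y3 = true → ∃ m, ∀ c, c ≠ m →
    ok3 1 1 0 0 p2 p3 c y2 y3 = true := by
  decide +kernel

theorem T111.sp {D : Finset (Dart N)} {v} {d1 d2 d3 : Dart N} (T : T111 D v d1 d2 d3) :
    Sp D v d1 d2 d3 1 := by
  obtain ⟨S, k1, k2, k3, e1, e2⟩ := T
  refine ⟨S, k1, k2, Or.inl k3, by rw [k2, k3]; decide, fun y2 y3 h => ?_⟩
  obtain ⟨m, hm⟩ := FspV y2 y3 h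
  refine ⟨m, fun c hc => ?_⟩
  rw [k2, k3]
  refine ok3_p ?_
  rw [e1, e2, sub_self]
  exact hm c hc
theorem TA.sp {D : Finset (Dart N)} {v} {d1 d2 d3 : Dart N} (T : TA D v d1 d2 d3) :
    ∃ k, Sp D v d1 d2 d3 k := by
  obtain ⟨S, k1, k2, k3⟩ := T
  obtain ⟨k, h⟩ := FspA (d2.s.2 - d1.s.2) (d3.s.2 - d1.s.2)
  refine ⟨k, S, k1, k2, Or.inr k3, ?_, fun y2 y3 hr => ?_⟩
  · rw [k2, k3, cost0, cost1]; have := cost_le k; omega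
  · obtain ⟨m, hm⟩ := h y2 y3 hr
    refine ⟨m, fun c hc => ?_⟩
    rw [k2, k3]
    exact ok3_p (hm c hc)

theorem T111.sw12 {D : Finset (Dart N)} {v} {d1 d2 d3 : Dart N} (T : T111 D v d1 d2 d3) :
    T111 D v d2 d1 d3 := by
  obtain ⟨S, k1, k2, k3, e1, e2⟩ := T; exact ⟨S.sw12, k2, k1, k3, e2, e1⟩
theorem T111.sw23 {D : Finset (Dart N)} {v} {d1 d2 d3 : Dart N} (T : T111 D v d1 d2 d3) :
    T111 D v d1 d3 d2 := by
  obtain ⟨S, k1, k2, k3, e1, e2⟩ := T; exact ⟨S.sw23, k1, k3, k2, e1.trans e2.symm, e2.symm⟩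
theorem T111.sw13 {D : Finset (Dart N)} {v} {d1 d2 d3 : Dart N} (T : T111 D v d1 d2 d3) :
    T111 D v d3 d2 d1 := T.sw12.sw23.sw12
theorem TA.sw12 {D : Finset (Dart N)} {v} {d1 d2 d3 : Dart N} (T : TA D v d1 d2 d3) :
    TA D v d2 d1 d3 := by
  obtain ⟨S, k1, k2, k3⟩ := T; exact ⟨S.sw12, k2, k1, k3⟩

theorem near_t : ∀ y1 y2 : Fin 5, rel 1 y1 y2 = true → ∃ t : Fin 5, rel 1 t y1 = true ∧
    rel 1 t y2 = true ∧ rel 1 (t + 1) y1 = true ∧ rel 1 (t + 1) y2 = true := by decide +kernel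

section
variable {D : Finset (Dart N)} {V : Finset N} (hm : MC D V)
include hm

theorem MC.F111 {v} (hv : v ∈ V) {d1 d2 d3 : Dart N} (T : T111 D v d1 d2 d3) {B : Finset N}
    (hB : B ⊆ V) (hvB : v ∉ B) (b1 : d1.t.1 ∈ B) (b2 : d2.t.1 ∈ B) (b3 : d3.t.1 ∉ B) :
    15 ≤ pot D B := by
  obtain ⟨S, k1, k2, k3, e1, e2⟩ := T
  by_contra hp
  have hss : B ⊂ V := Finset.ssubset_iff_subset_ne.2 ⟨hB, fun h => hvB (h ▸ hv)⟩
  have t12 := hm.tne S.h1 S.h2 (S.s1.trans S.s2.symm) S.n12 (by rw [k1]; left; decide)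
  rcases hm.gk1 hss b1 b2 t12 with ⟨φ, hφ, hr⟩ | h0
  · obtain ⟨t, a1, a2, a3, a4⟩ := near_t _ _ hr
    refine hm.flex hv ?_ hB hvB (two_le_card b1 b2 t12) hφ {d1, d2} ?_ d3.s.2 t ?_ ?_ ?_
    · intro d hd hs
      rcases S.all d hd hs with rfl | rfl | rfl
      · rw [k1]; decide
      · rw [k2]; decide
      · rw [k3]; decide
    · intro d
      simp only [Finset.mem_insert, Finset.mem_singleton]
      constructor
      · rintro (rfl | rfl)
        exacts [⟨S.h1, S.s1, b1⟩, ⟨S.h2, S.s2, b2⟩]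
      · rintro ⟨hd, hs, ht⟩
        rcases S.all d hd hs with rfl | rfl | rfl
        · exact Or.inl rfl
        · exact Or.inr rfl
        · exact absurd ht b3
    · intro st hst d hd
      simp only [Finset.mem_insert, Finset.mem_singleton] at hd
      rcases hd with rfl | rfl
      · rw [k1, e1]
        rcases hst with h | h <;> rw [h] <;> assumption
      · rw [k2, e2]
        rcases hst with h | h <;> rw [h] <;> assumption
    · rw [Finset.sum_pair S.n12, k1, k2]; decide
    · rw [Finset.sum_pair S.n12, k1, k2, cost1]; omega
  · have := hm.zex h0 rfl S.h1 S.h2 (S.s1.trans S.s2.symm) rfl rfl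
    rw [k1, k2] at this
    exact absurd this (by decide)

/-- no triangle of 1-edges at a 111-vertex -/
theorem MC.LT {v} (hv : v ∈ V) {d1 d2 d3 e : Dart N} (T : T111 D v d1 d2 d3) (he : e ∈ D)
    (hk : e.k ≠ 2) (hs : e.s.1 = d1.t.1) (ht : e.t.1 = d2.t.1) : False := by
  have T' := T
  obtain ⟨S, k1, k2, k3, e1, e2⟩ := T'
  have t12 := hm.tne S.h1 S.h2 (S.s1.trans S.s2.symm) S.n12 (by rw [k1]; left; decide)
  have t13 := hm.tne S.h1 S.h3 (S.s1.trans S.s3.symm) S.n13 (by rw [k1]; left; decide)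
  have t23 := hm.tne S.h2 S.h3 (S.s2.trans S.s3.symm) S.n23 (by rw [k2]; left; decide)
  have m1 := hm.mem_er S.h1 S.s1
  have m2 := hm.mem_er S.h2 S.s2
  have := hm.F111 hv T (B := {d1.t.1, d2.t.1})
    (by simp only [Finset.insert_subset_iff, Finset.singleton_subset_iff]
        exact ⟨hm.inst S.h1, hm.inst S.h2⟩)
    (by have := (Finset.mem_erase.1 m1).1
        have := (Finset.mem_erase.1 m2).1
        simp only [Finset.mem_insert, Finset.mem_singleton]; tauto)
    (by simp) (by simp) (by simp [t13.symm, t23.symm])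
  have p1 := pot_add1 hm.sym (A := {d2.t.1}) (v := d1.t.1) (by simpa using t12) he hs (by simp [ht])
  rw [pot_single hm.loop] at p1
  have : ∀ k : Fin 3, k ≠ 2 → 3 ≤ cost k := by decide
  have := this e.k hk
  omega

variable {s : N} {e1 e2 e3 : Dart N} {k : Fin 3}

omit hm in
theorem Sp.csum (S : Sp D s e1 e2 e3 k) : 6 ≤ cost e2.k + cost e3.k := by
  rw [S.k2]; rcases S.k3 with h | h <;> rw [h] <;> decide

theorem MC.sp_t23 (S : Sp D s e1 e2 e3 k) : e2.t.1 ≠ e3.t.1 :=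
  hm.tne S.S.h2 S.S.h3 (S.S.s2.trans S.S.s3.symm) S.S.n23 (by rw [S.k2]; left; decide)
theorem MC.sp_t12 (S : Sp D s e1 e2 e3 k) : e1.t.1 ≠ e2.t.1 :=
  hm.tne S.S.h1 S.S.h2 (S.S.s1.trans S.S.s2.symm) S.S.n12 (by rw [S.k2]; right; decide)
theorem MC.sp_t13 (S : Sp D s e1 e2 e3 k) : e1.t.1 ≠ e3.t.1 :=
  hm.tne S.S.h1 S.S.h3 (S.S.s1.trans S.S.s3.symm) S.S.n13 (by rw [S.k1]; left; decide)

omit hm in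
theorem Sp.pot_add (hs : Sym D) (S : Sp D s e1 e2 e3 k) {B : Finset N} (hsB : s ∉ B)
    (b2 : e2.t.1 ∈ B) (b3 : e3.t.1 ∈ B) : pot D (insert s B) ≤ pot D B + 4 - 2 * cost k := by
  have := pot_add2 hs hsB S.S.h2 S.S.s2 b2 S.S.h3 S.S.s3 b3 S.S.n23
  have := S.add
  omega

/-- a proper set containing s and its ends 2,3 -/
theorem MC.sp_alone (S : Sp D s e1 e2 e3 k) {B : Finset N} (hsB : s ∉ B) (hB : insert s B ⊂ V)
    (b2 : e2.t.1 ∈ B) (b3 : e3.t.1 ∈ B) : 7 + 2 * cost k ≤ pot D B := by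
  have h1 := S.pot_add hm.sym hsB b2 b3
  have h2 := hm.P2 hB (Finset.mem_insert_of_mem b2) (Finset.mem_insert_of_mem b3) (hm.sp_t23 S)
  omega

theorem MC.sp_tri (S : Sp D s e1 e2 e3 k) {A : Finset N} (hsA : s ∉ A) (hA : insert s A ⊂ V)
    (b2 : e2.t.1 ∈ A) (b3 : e3.t.1 ∈ A) (hT : Tri1 D A ⟨e2.t, e3.t, k⟩) : False := by
  have t23 := hm.sp_t23 S
  have n2 : s ≠ e2.t.1 := fun h => hsA (h ▸ b2)
  have n3 : s ≠ e3.t.1 := fun h => hsA (h ▸ b3)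
  have sub : ∀ B ⊆ A, insert s B ⊂ V := fun B hB =>
    lt_of_le_of_lt (Finset.insert_subset_insert s hB) hA
  rcases hT with ⟨hk, h0⟩ | ⟨hk, h1 | ⟨T, hTA, f1, f2⟩⟩
  · have := hm.zex h0 rfl S.S.h2 S.S.h3 (S.S.s2.trans S.S.s3.symm) rfl rfl
    have := S.csum
    omega
  · have h1 : (⟨e2.t, e3.t, 1⟩ : Dart N) ∈ D := h1
    have p1 := pot_add1 hm.sym (A := {e3.t.1}) (v := e2.t.1) (by simpa using t23) h1 rfl (by simp)
    rw [pot_single hm.loop] at p1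
    have cc : cost (⟨e2.t, e3.t, 1⟩ : Dart N).k = 3 := rfl
    simp only at hk
    have ck : cost k = 4 := by rw [hk]; rfl
    have := hm.sp_alone S (B := {e2.t.1, e3.t.1}) (by simp [n2, n3])
      (sub _ (by simp only [Finset.insert_subset_iff, Finset.singleton_subset_iff]; exact ⟨b2, b3⟩))
      (by simp) (by simp)
    omega
  · simp only at hk f1 f2
    have nT2 : e2.t.1 ≠ T.1 := hm.loop _ f1
    have nT3 : T.1 ≠ e3.t.1 := hm.loop _ f2
    have nsT : s ≠ T.1 := fun h => hsA (h ▸ hTA)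
    have p1 := pot_add1 hm.sym (A := {e3.t.1}) (v := T.1) (by simpa using nT3) f2 rfl (by simp)
    rw [pot_single hm.loop] at p1
    have n2 : e2.t.1 ∉ ({T.1, e3.t.1} : Finset N) := by simp [nT2, t23]
    have p2 := pot_add1 hm.sym n2 f1 rfl (by simp)
    have cc : cost (⟨e2.t, T, 0⟩ : Dart N).k = 4 := rfl
    have cc' : cost (⟨T, e3.t, 0⟩ : Dart N).k = 4 := rfl
    have ck : cost k = 4 := by rw [hk]; rfl
    have := hm.sp_alone S (B := {e2.t.1, T.1, e3.t.1}) (by simp [*])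
      (sub _ (by simp only [Finset.insert_subset_iff, Finset.singleton_subset_iff]; exact ⟨b2, hTA, b3⟩))
      (by simp) (by simp)
    omega

/-- extension over one special node -/
theorem MC.sp_ext (S : Sp D s e1 e2 e3 k) {A : Finset N} (hsA : s ∉ A) (h1 : e1.t.1 ∉ A) {σ : N → St}
    (hσ : Good D A σ) (hr : rel k (col σ e2.t) (col σ e3.t) = true) : ∃ m, ∀ c, c ≠ m →
    ∃ st, Good D (insert s A) (Function.update σ s st) ∧ rel 1 (val st e1.s.2) c = true := by
  obtain ⟨m, h⟩ := S.ex _ _ hr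
  refine ⟨m, fun c hc => ?_⟩
  obtain ⟨st, a1, a2, a3⟩ := h c hc
  refine ⟨st, ext_node hm.sym hm.loop hσ hsA st ?_, a1⟩
  intro d hd hs ht
  rcases S.S.all d hd hs with rfl | rfl | rfl
  · exact absurd ht h1
  · exact a2
  · exact a3

/-- two special neighbours of a node -/
theorem MC.twoSp {w s' : N} {f1 f2 f3 : Dart N} {k' : Fin 3} (hw : w ∈ V)
    (S : Sp D s e1 e2 e3 k) (S' : Sp D s' f1 f2 f3 k') (ht : e1.t.1 = w) (ht' : f1.t.1 = w)
    (hss : s ≠ s') (hadj : ∀ d ∈ D, d.s.1 = s → d.t.1 ≠ s') :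
    (∃ σ m m', (∀ c, c ≠ m → c ≠ m' → ∃ τ, Good D (V.erase w) τ ∧
      (∀ P : N × Fin 5, P.1 ≠ s → P.1 ≠ s' → col τ P = col σ P) ∧
      rel 1 (col τ e1.s) c = true ∧ rel 1 (col τ f1.s) c = true)) ∨
    (∃ B ⊆ V.erase w, s ∈ B ∧ s' ∈ B ∧ pot D B ≤ 12) ∨
    (∃ B ⊆ V.erase w, s ∈ B ∧ s' ∈ B ∧ pot D B ≤ 14 ∧
      ∀ x ∈ B, x = s ∨ x = s' ∨ x = e2.t.1 ∨ x = e3.t.1 ∨ x = f2.t.1 ∨ x = f3.t.1) := by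
  have hsV : s ∈ V := S.S.s1 ▸ hm.ins _ S.S.h1
  have hsV' : s' ∈ V := S'.S.s1 ▸ hm.ins _ S'.S.h1
  have hsw : s ≠ w := by rw [← ht, ← S.S.s1]; exact hm.loop _ S.S.h1
  have hsw' : s' ≠ w := by rw [← ht', ← S'.S.s1]; exact hm.loop _ S'.S.h1
  set A : Finset N := ((V.erase w).erase s).erase s' with hA
  have memA : ∀ x, x ∈ A ↔ x ≠ s' ∧ x ≠ s ∧ x ≠ w ∧ x ∈ V := by
    intro x; simp only [hA, Finset.mem_erase]
  have hadj' : ∀ d ∈ D, d.s.1 = s' → d.t.1 ≠ s := fun d hd h1 h2 => hadj d.rev (hm.sym d hd) h2 h1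
  have lp : ∀ d ∈ D, ∀ x, d.s.1 = x → d.t.1 ≠ x := fun d hd x h1 h2 => hm.loop d hd (h1.trans h2.symm)
  have a2 : e2.t.1 ∈ A := (memA _).2 ⟨hadj _ S.S.h2 S.S.s2, lp _ S.S.h2 _ S.S.s2,
    fun h => hm.sp_t12 S (ht.trans h.symm), hm.inst S.S.h2⟩
  have a3 : e3.t.1 ∈ A := (memA _).2 ⟨hadj _ S.S.h3 S.S.s3, lp _ S.S.h3 _ S.S.s3,
    fun h => hm.sp_t13 S (ht.trans h.symm), hm.inst S.S.h3⟩
  have a2' : f2.t.1 ∈ A := (memA _).2 ⟨lp _ S'.S.h2 _ S'.S.s2, hadj' _ S'.S.h2 S'.S.s2,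
    fun h => hm.sp_t12 S' (ht'.trans h.symm), hm.inst S'.S.h2⟩
  have a3' : f3.t.1 ∈ A := (memA _).2 ⟨lp _ S'.S.h3 _ S'.S.s3, hadj' _ S'.S.h3 S'.S.s3,
    fun h => hm.sp_t13 S' (ht'.trans h.symm), hm.inst S'.S.h3⟩
  have sA : s ∉ A := fun h => ((memA _).1 h).2.1 rfl
  have sA' : s' ∉ A := fun h => ((memA _).1 h).1 rfl
  have wA : w ∉ A := fun h => ((memA _).1 h).2.2.1 rfl
  have AV : A ⊆ V := fun x hx => ((memA _).1 hx).2.2.2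
  have ssw : ∀ B : Finset N, B ⊆ V → w ∉ B → B ⊂ V := fun B h1 h2 =>
    Finset.ssubset_iff_subset_ne.2 ⟨h1, fun h => h2 (h ▸ hw)⟩
  have sub1 : ∀ B ⊆ A, insert s B ⊂ V := fun B hB => ssw _
    (Finset.insert_subset hsV (hB.trans AV)) (by simp only [Finset.mem_insert, not_or]; exact ⟨hsw.symm, fun h => wA (hB h)⟩)
  have sub1' : ∀ B ⊆ A, insert s' B ⊂ V := fun B hB => ssw _
    (Finset.insert_subset hsV' (hB.trans AV)) (by simp only [Finset.mem_insert, not_or]; exact ⟨hsw'.symm, fun h => wA (hB h)⟩)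
  have both : ∀ B ⊆ A, e2.t.1 ∈ B → e3.t.1 ∈ B → f2.t.1 ∈ B → f3.t.1 ∈ B →
      insert s' (insert s B) ⊆ V.erase w ∧
      pot D (insert s' (insert s B)) ≤ pot D B + 8 - 2 * cost k - 2 * cost k' := by
    intro B hB b2 b3 b2' b3'
    constructor
    · intro x hx
      simp only [Finset.mem_insert] at hx
      rw [Finset.mem_erase]
      rcases hx with rfl | rfl | hx
      · exact ⟨hsw', hsV'⟩
      · exact ⟨hsw, hsV⟩
      · exact ⟨((memA _).1 (hB hx)).2.2.1, AV (hB hx)⟩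
    · have p1 := S.pot_add hm.sym (fun h => sA (hB h)) b2 b3
      have p2 := S'.pot_add hm.sym (B := insert s B) (by
        simp only [Finset.mem_insert, not_or]; exact ⟨hss.symm, fun h => sA' (hB h)⟩)
        (Finset.mem_insert_of_mem b2') (Finset.mem_insert_of_mem b3')
      omega
  have t23 := hm.sp_t23 S
  have t23' := hm.sp_t23 S'
  rcases hm.gad2 (ssw A AV wA) (g1 := ⟨e2.t, e3.t, k⟩) (g2 := ⟨f2.t, f3.t, k'⟩) ⟨a2, a3⟩ ⟨a2', a3'⟩
    t23 t23' with ⟨σ, hσ, hr, hr'⟩ | ⟨B, hB, hE, hp⟩ | ⟨B, hB, hE, hp⟩ |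
      ⟨B, hB, hE, hE', hp⟩ | hT | hT | ⟨_, B, hB, hE, hE', hin, hp⟩
  · left
    obtain ⟨m, h⟩ := hm.sp_ext S sA (by rw [ht]; exact wA) hσ hr
    obtain ⟨m', h'⟩ := hm.sp_ext S' sA' (by rw [ht']; exact wA) hσ hr'
    refine ⟨σ, m, m', fun c hc hc' => ?_⟩
    obtain ⟨st, g, r⟩ := h c hc
    obtain ⟨st', g', r'⟩ := h' c hc'
    refine ⟨Function.update (Function.update σ s st) s' st', ?_, ?_, ?_, ?_⟩
    · have := ext_node hm.sym hm.loop g (s := s') (by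
        simp only [Finset.mem_insert, not_or]; exact ⟨hss.symm, sA'⟩) st' (by
        intro d hd hs hdt
        have hdt := Finset.mem_of_mem_insert_of_ne hdt (hadj' d hd hs)
        have k1 : d.t.1 ≠ s := fun h => sA (h ▸ hdt)
        have k2 : d.t.1 ≠ s' := fun h => sA' (h ▸ hdt)
        rw [col_upd k1]
        have := g' d hd (by simp [hs]) (Finset.mem_insert_of_mem hdt)
        rwa [col_upd' hs, col_upd k2] at this)
      refine this.mono (subset_refl _) ?_
      intro x hx
      rw [Finset.mem_erase] at hx
      simp only [Finset.mem_insert, memA]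
      by_cases x = s' <;> by_cases x = s <;> tauto
    · intro P h1 h2
      rw [col_upd h2, col_upd h1]
    · rw [col_upd (by rw [S.S.s1]; exact hss), col_upd' S.S.s1]; exact r
    · rw [col_upd' S'.S.s1]; exact r'
  · have := hm.sp_alone S (fun h => sA (hB h)) (sub1 B hB) hE.1 hE.2
    simp only at hp; omega
  · have := hm.sp_alone S' (fun h => sA' (hB h)) (sub1' B hB) hE.1 hE.2
    simp only at hp; omega
  · right; left
    obtain ⟨q1, q2⟩ := both B hB hE.1 hE.2 hE'.1 hE'.2
    refine ⟨_, q1, by simp, by simp, ?_⟩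
    simp only at hp; omega
  · exact (hm.sp_tri S sA (sub1 A (subset_refl _)) a2 a3 hT).elim
  · exact (hm.sp_tri S' sA' (sub1' A (subset_refl _)) a2' a3' hT).elim
  · right; right
    obtain ⟨q1, q2⟩ := both B hB hE.1 hE.2 hE'.1 hE'.2
    refine ⟨_, q1, by simp, by simp, ?_, ?_⟩
    · simp only at hp; omega
    · intro x hx
      simp only [Finset.mem_insert] at hx
      rcases hx with h | h | h
      · tauto
      · tauto
      · have := hin x h; tauto

omit hm in
theorem three_cols : ∀ y m m' : Fin 5, ∃ c, c ≠ m ∧ c ≠ m' ∧ rel 1 c y = true := by decide +kernel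
omit hm in
theorem st_at : ∀ p c : Fin 5, ∃ st, val st p = c := by decide +kernel

/-- the edge from a special node back is the reverse -/
theorem MC.sp_rev (S : Sp D s e1 e2 e3 k) {d : Dart N} (hd : d ∈ D) (h1 : d.s.1 = e1.t.1)
    (h2 : d.t.1 = s) : d.rev = e1 := by
  by_contra hne
  have := hm.tne (hm.sym _ hd) S.S.h1 (h2.trans S.S.s1.symm) hne (by rw [S.k1]; right; decide)
  exact this h1

/-- a 111-vertex has at most one special neighbour -/
theorem MC.L3 {v s' : N} (hv : v ∈ V) {d1 d2 d3 f1 f2 f3 : Dart N} {k' : Fin 3}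
    (T : T111 D v d1 d2 d3) (S : Sp D s e1 e2 e3 k) (S' : Sp D s' f1 f2 f3 k')
    (h1 : d1.t.1 = s) (h2 : d2.t.1 = s') (ht : e1.t.1 = v) (ht' : f1.t.1 = v) : False := by
  obtain ⟨Sv, k1, k2, k3, q1, q2⟩ := id T
  have t12 := hm.tne Sv.h1 Sv.h2 (Sv.s1.trans Sv.s2.symm) Sv.n12 (by rw [k1]; left; decide)
  have t13 := hm.tne Sv.h1 Sv.h3 (Sv.s1.trans Sv.s3.symm) Sv.n13 (by rw [k1]; left; decide)
  have t23 := hm.tne Sv.h2 Sv.h3 (Sv.s2.trans Sv.s3.symm) Sv.n23 (by rw [k2]; left; decide)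
  have r1 : d1.rev = e1 := hm.sp_rev S Sv.h1 (by rw [Sv.s1, ht]) h1
  have r2 : d2.rev = f1 := hm.sp_rev S' Sv.h2 (by rw [Sv.s2, ht']) h2
  have kn2 : ∀ d ∈ D, d.s.1 = s → d.k ≠ 2 := by
    intro d hd hs
    rcases S.S.all d hd hs with rfl | rfl | rfl
    · rw [S.k1]; decide
    · rw [S.k2]; decide
    · rcases S.k3 with h | h <;> rw [h] <;> decide
  have kn2' : ∀ d ∈ D, d.s.1 = s' → d.k ≠ 2 := by
    intro d hd hs
    rcases S'.S.all d hd hs with rfl | rfl | rfl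
    · rw [S'.k1]; decide
    · rw [S'.k2]; decide
    · rcases S'.k3 with h | h <;> rw [h] <;> decide
  have hadj : ∀ d ∈ D, d.s.1 = s → d.t.1 ≠ s' := by
    intro d hd hs hdt
    exact hm.LT hv T hd (kn2 d hd hs) (hs.trans h1.symm) (hdt.trans h2.symm)
  have n3 : ∀ d ∈ D, d.s.1 = s → d.t.1 ≠ d3.t.1 := by
    intro d hd hs hdt
    exact hm.LT hv T.sw23 hd (kn2 d hd hs) (hs.trans h1.symm) hdt
  have n3' : ∀ d ∈ D, d.s.1 = s' → d.t.1 ≠ d3.t.1 := by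
    intro d hd hs hdt
    exact hm.LT hv T.sw12.sw23 hd (kn2' d hd hs) (hs.trans h2.symm) hdt
  have hvB : ∀ B ⊆ V.erase v, v ∉ B ∧ B ⊆ V := fun B hB =>
    ⟨fun h => (Finset.mem_erase.1 (hB h)).1 rfl, hB.trans (Finset.erase_subset _ _)⟩
  rcases hm.twoSp hv S S' ht ht' (by rw [← h1, ← h2]; exact t12) hadj with ⟨σ, m, m', h⟩ |
    ⟨B, hB, b1, b2, hp⟩ | ⟨B, hB, b1, b2, hp, hin⟩
  · obtain ⟨c, c1, c2, c3⟩ := three_cols (col σ d3.t) m m'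
    obtain ⟨τ, g, ag, ra, rb⟩ := h c c1 c2
    obtain ⟨st, hst⟩ := st_at d3.s.2 c
    refine hm.ext3 Sv g ⟨st, ?_, ?_, ?_⟩
    · rw [k1, q1, hst, rel_symm]; rw [← r1] at ra; exact ra
    · rw [k2, q2, hst, rel_symm]; rw [← r2] at rb; exact rb
    · rw [k3, hst, ag d3.t (by rw [← h1]; exact t13.symm) (by rw [← h2]; exact t23.symm)]; exact c3
  · obtain ⟨x1, x2⟩ := hvB B hB
    by_cases b3 : d3.t.1 ∈ B
    · have := pot_add3 hm.sym x1 Sv.h1 Sv.s1 (by rw [h1]; exact b1) Sv.h2 Sv.s2 (by rw [h2]; exact b2)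
        Sv.h3 Sv.s3 b3 Sv.n12 Sv.n13 Sv.n23
      rw [k1, k2, k3, cost1] at this
      have := hm.potge (Finset.insert_subset hv x2) (two_le_card
        (Finset.mem_insert_of_mem b1) (Finset.mem_insert_of_mem b2) (by rw [← h1, ← h2]; exact t12))
      omega
    · have := hm.F111 hv T x2 x1 (by rw [h1]; exact b1) (by rw [h2]; exact b2) b3
      omega
  · obtain ⟨x1, x2⟩ := hvB B hB
    have b3 : d3.t.1 ∉ B := by
      intro h
      rcases hin _ h with h | h | h | h | h | h
      · exact t13 (h1.trans h.symm)
      · exact t23 (h2.trans h.symm)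
      · exact n3 _ S.S.h2 S.S.s2 h.symm
      · exact n3 _ S.S.h3 S.S.s3 h.symm
      · exact n3' _ S'.S.h2 S'.S.s2 h.symm
      · exact n3' _ S'.S.h3 S'.S.s3 h.symm
    have := hm.F111 hv T x2 x1 (by rw [h1]; exact b1) (by rw [h2]; exact b2) b3
    omega
end

end CG

namespace CG
variable {N : Type} [DecidableEq N]

theorem F2222 : ∀ p1 p2 p3 y1 y2 y3, ok4 2 2 2 2 p1 p2 p3 0 y1 y2 y3 0 = true := by
  decide +kernel

theorem avoid4 (p1 p2 p3 p4 y1 y2 y3 y4 : Fin 5) : ∃ st, val st p1 ≠ y1 ∧ val st p2 ≠ y2 ∧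
    val st p3 ≠ y3 ∧ val st p4 ≠ y4 := by
  obtain ⟨st, h1, h2, h3, h4⟩ := norm4 (F2222 (p1 - p4) (p2 - p4) (p3 - p4) (y1 - y4) (y2 - y4) (y3 - y4))
  have : ∀ x y : Fin 5, rel 2 x y = true → x ≠ y := by decide
  exact ⟨st, this _ _ h1, this _ _ h2, this _ _ h3, this _ _ h4⟩

theorem rel2_of : ∀ x y : Fin 5, x ≠ y → rel 2 x y = true := by decide

theorem prop3 {a b c d e : Prop} (h : d ∧ e) : a ∨ b ∨ c ∨ ¬ a ∧ ¬ b ∧ ¬ c ∧ d ∧ e := by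
  by_cases a <;> by_cases b <;> by_cases c <;> simp_all

theorem sum_inn_insert (g : Dart N) (G : Finset (Dart N)) (B : Finset N) :
    ∑ d ∈ inn (insert g G) B, cost d.k ≤ (open Classical in if endsIn g B then cost g.k else 0) +
      ∑ d ∈ inn G B, cost d.k := by
  classical
  by_cases h : endsIn g B
  · rw [if_pos h]
    have : inn (insert g G) B ⊆ insert g (inn G B) := by
      intro d hd
      simp only [mem_inn, Finset.mem_insert] at hd ⊢
      tauto
    refine (sum_cost_mono this).trans ?_
    by_cases hg : g ∈ inn G B
    · rw [Finset.insert_eq_of_mem hg]; have := cost_nonneg g.k; omega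
    · rw [Finset.sum_insert hg]
  · rw [if_neg h]
    have : inn (insert g G) B ⊆ inn G B := by
      intro d hd
      simp only [mem_inn, Finset.mem_insert] at hd ⊢
      rcases hd with ⟨rfl | hd, h'⟩
      · exact absurd h' h
      · exact ⟨hd, h'⟩
    refine (sum_cost_mono this).trans ?_
    omega

theorem T111.rot {D : Finset (Dart N)} {v} {d1 d2 d3 d : Dart N} (T : T111 D v d1 d2 d3)
    (hd : d ∈ D) (hs : d.s.1 = v) : ∃ a b, T111 D v d a b := by
  rcases T.1.all d hd hs with rfl | rfl | rfl
  · exact ⟨_, _, T⟩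
  · exact ⟨_, _, T.sw12⟩
  · exact ⟨_, _, T.sw13⟩

section
variable {D : Finset (Dart N)} {V : Finset N} (hm : MC D V)
include hm

set_option maxHeartbeats 1000000 in
/-- a node of type C has at most two neighbours of type 111 -/
theorem MC.L7 {u : N} {e0 e1 e2 e3 a1 b1 a2 b2 a3 b3 : Dart N} (U : TC D u e0 e1 e2 e3)
    (T1 : T111 D e1.t.1 e1.rev a1 b1) (T2 : T111 D e2.t.1 e2.rev a2 b2)
    (T3 : T111 D e3.t.1 e3.rev a3 b3) : False := by
  obtain ⟨Su, k0, k1, k2, k3⟩ := U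
  have hu : u ∈ V := Su.s1 ▸ hm.ins _ Su.h1
  have t12 := hm.tne Su.h2 Su.h3 (Su.s2.trans Su.s3.symm) Su.n23 (by rw [k1]; left; decide)
  have t13 := hm.tne Su.h2 Su.h4 (Su.s2.trans Su.s4.symm) Su.n24 (by rw [k1]; left; decide)
  have t23 := hm.tne Su.h3 Su.h4 (Su.s3.trans Su.s4.symm) Su.n34 (by rw [k2]; left; decide)
  have t01 := hm.tne Su.h1 Su.h2 (Su.s1.trans Su.s2.symm) Su.n12 (by rw [k1]; right; decide)
  have t02 := hm.tne Su.h1 Su.h3 (Su.s1.trans Su.s3.symm) Su.n13 (by rw [k2]; right; decide)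
  have t03 := hm.tne Su.h1 Su.h4 (Su.s1.trans Su.s4.symm) Su.n14 (by rw [k3]; right; decide)
  have S1 := T1.sp
  have S2 := T2.sp
  have S3' := T3.sp
  have hv1 : e1.t.1 ∈ V := hm.inst Su.h2
  have hv2 : e2.t.1 ∈ V := hm.inst Su.h3
  have hv3 : e3.t.1 ∈ V := hm.inst Su.h4
  have nu1 : e1.t.1 ≠ u := (Finset.mem_erase.1 (hm.mem_er Su.h2 Su.s2)).1
  have nu2 : e2.t.1 ≠ u := (Finset.mem_erase.1 (hm.mem_er Su.h3 Su.s3)).1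
  have nu3 : e3.t.1 ≠ u := (Finset.mem_erase.1 (hm.mem_er Su.h4 Su.s4)).1
  have nu0 : e0.t.1 ≠ u := (Finset.mem_erase.1 (hm.mem_er Su.h1 Su.s1)).1
  -- no edges among the three neighbours
  have key : ∀ {f f' a b : Dart N}, f ∈ D → f.s.1 = u → T111 D f.t.1 f.rev a b →
      f' ∈ D → f'.s.1 = u → f'.k = 1 → f ≠ f' → f.k = 1 →
      a.t.1 ≠ f'.t.1 ∧ b.t.1 ≠ f'.t.1 := by
    intro f f' a b hf hfs T hf' hfs' hk' hne hk
    have hV := hm.inst hf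
    constructor
    · intro h
      exact hm.LT hV T (e := f') hf' (by rw [hk']; decide) (by rw [hfs', rev_t, hfs]) h.symm
    · intro h
      exact hm.LT hV T.sw23 (e := f') hf' (by rw [hk']; decide) (by rw [hfs', rev_t, hfs]) h.symm
  have q12 := key Su.h2 Su.s2 T1 Su.h3 Su.s3 k2 Su.n23 k1
  have q13 := key Su.h2 Su.s2 T1 Su.h4 Su.s4 k3 Su.n24 k1
  have q21 := key Su.h3 Su.s3 T2 Su.h2 Su.s2 k1 Su.n23.symm k2
  have q23 := key Su.h3 Su.s3 T2 Su.h4 Su.s4 k3 Su.n34 k2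
  have q31 := key Su.h4 Su.s4 T3 Su.h2 Su.s2 k1 Su.n24.symm k3
  have q32 := key Su.h4 Su.s4 T3 Su.h3 Su.s3 k2 Su.n34.symm k3
  obtain ⟨A, hA⟩ : ∃ A : Finset N, A = (((V.erase u).erase e1.t.1).erase e2.t.1).erase e3.t.1 := ⟨_, rfl⟩
  have memA : ∀ x, x ∈ A ↔ x ≠ e3.t.1 ∧ x ≠ e2.t.1 ∧ x ≠ e1.t.1 ∧ x ≠ u ∧ x ∈ V := by
    intro x; simp only [hA, Finset.mem_erase]
  have self : ∀ {f a b : Dart N}, f.s.1 = u → T111 D f.t.1 f.rev a b →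
      a.t.1 ≠ f.t.1 ∧ b.t.1 ≠ f.t.1 ∧ a.t.1 ≠ u ∧ b.t.1 ≠ u ∧ a.t.1 ∈ V ∧ b.t.1 ∈ V := by
    intro f a b hfs T
    have x1 := hm.sp_t12 T.sp
    have x2 := hm.sp_t13 T.sp
    rw [rev_t, hfs] at x1 x2
    exact ⟨(Finset.mem_erase.1 (hm.mem_er T.1.h2 T.1.s2)).1, (Finset.mem_erase.1 (hm.mem_er T.1.h3 T.1.s3)).1,
      x1.symm, x2.symm, hm.inst T.1.h2, hm.inst T.1.h3⟩
  obtain ⟨z11, z12, z13, z14, z15, z16⟩ := self Su.s2 T1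
  obtain ⟨z21, z22, z23, z24, z25, z26⟩ := self Su.s3 T2
  obtain ⟨z31, z32, z33, z34, z35, z36⟩ := self Su.s4 T3
  have A1 : a1.t.1 ∈ A := (memA _).2 ⟨q13.1, q12.1, z11, z13, z15⟩
  have B1 : b1.t.1 ∈ A := (memA _).2 ⟨q13.2, q12.2, z12, z14, z16⟩
  have A2 : a2.t.1 ∈ A := (memA _).2 ⟨q23.1, z21, q21.1, z23, z25⟩
  have B2 : b2.t.1 ∈ A := (memA _).2 ⟨q23.2, z22, q21.2, z24, z26⟩
  have A3 : a3.t.1 ∈ A := (memA _).2 ⟨z31, q32.1, q31.1, z33, z35⟩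
  have B3 : b3.t.1 ∈ A := (memA _).2 ⟨z32, q32.2, q31.2, z34, z36⟩
  have m1 : e1.t.1 ∉ A := fun h => ((memA _).1 h).2.2.1 rfl
  have m2 : e2.t.1 ∉ A := fun h => ((memA _).1 h).2.1 rfl
  have m3 : e3.t.1 ∉ A := fun h => ((memA _).1 h).1 rfl
  have mu : u ∉ A := fun h => ((memA _).1 h).2.2.2.1 rfl
  have AV : A ⊆ V := fun x hx => ((memA _).1 hx).2.2.2.2
  have ssu : ∀ B : Finset N, B ⊆ V → u ∉ B → B ⊂ V := fun B h1 h2 =>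
    Finset.ssubset_iff_subset_ne.2 ⟨h1, fun h => h2 (h ▸ hu)⟩
  obtain ⟨g1, hg1⟩ : ∃ g : Dart N, g = ⟨a1.t, b1.t, 1⟩ := ⟨_, rfl⟩
  obtain ⟨g2, hg2⟩ : ∃ g : Dart N, g = ⟨a2.t, b2.t, 1⟩ := ⟨_, rfl⟩
  obtain ⟨g3, hg3⟩ : ∃ g : Dart N, g = ⟨a3.t, b3.t, 1⟩ := ⟨_, rfl⟩
  have l1 := hm.sp_t23 S1
  have l2 := hm.sp_t23 S2
  have l3 := hm.sp_t23 S3'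
  have hG : Loopless ({g1, g2, g3} : Finset (Dart N)) := by
    intro d hd; simp only [Finset.mem_insert, Finset.mem_singleton] at hd
    rcases hd with rfl | rfl | rfl
    · rw [hg1]; exact l1
    · rw [hg2]; exact l2
    · rw [hg3]; exact l3
  have tri : ∀ {f a b : Dart N}, T111 D f.t.1 f.rev a b → (⟨a.t, b.t, 0⟩ : Dart N) ∈ D → False := by
    intro f a b T h
    have := hm.zex h rfl T.1.h2 T.1.h3 (T.1.s2.trans T.1.s3.symm) rfl rfl
    rw [T.2.2.1, T.2.2.2.1, cost1] at this
    omega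
  have c1 : cost g1.k = 3 := by rw [hg1]; rfl
  have c2 : cost g2.k = 3 := by rw [hg2]; rfl
  have c3 : cost g3.k = 3 := by rw [hg3]; rfl
  rcases gadG hm (ssu A AV mu) {g1, g2, g3} hG with ⟨σ, hσ, hg⟩ | ⟨B, hB, hne, hp⟩ | ht
  · have r1 := hg g1 (by simp) (by rw [hg1]; exact A1) (by rw [hg1]; exact B1)
    have r2 := hg g2 (by simp) (by rw [hg2]; exact A2) (by rw [hg2]; exact B2)
    have r3 := hg g3 (by simp) (by rw [hg3]; exact A3) (by rw [hg3]; exact B3)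
    rw [hg1] at r1; rw [hg2] at r2; rw [hg3] at r3
    obtain ⟨n1, x1⟩ := S1.ex _ _ r1
    obtain ⟨n2, x2⟩ := S2.ex _ _ r2
    obtain ⟨n3, x3⟩ := S3'.ex _ _ r3
    obtain ⟨st, y0, y1, y2, y3⟩ := avoid4 e0.s.2 e1.s.2 e2.s.2 e3.s.2 (col σ e0.t) n1 n2 n3
    obtain ⟨s1, o1, o2, o3⟩ := x1 _ y1
    obtain ⟨s2, p1, p2, p3⟩ := x2 _ y2
    obtain ⟨s3, u1, u2, u3⟩ := x3 _ y3
    have E1 := ext_node hm.sym hm.loop hσ m1 s1 (by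
      intro d hd hs ht
      rcases S1.S.all d hd hs with rfl | rfl | rfl
      · rw [rev_t, Su.s2] at ht; exact absurd ht mu
      · exact o2
      · exact o3)
    have E2 := ext_node hm.sym hm.loop E1 (s := e2.t.1) (by simp [t12.symm, m2]) s2 (by
      intro d hd hs ht
      rcases S2.S.all d hd hs with rfl | rfl | rfl
      · rw [rev_t, Su.s3] at ht; simp [nu1.symm, mu] at ht
      · rw [col_upd q21.1]; exact p2
      · rw [col_upd q21.2]; exact p3)
    have E3 := ext_node hm.sym hm.loop E2 (s := e3.t.1) (by simp [t13.symm, t23.symm, m3]) s3 (by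
      intro d hd hs ht
      rcases S3'.S.all d hd hs with rfl | rfl | rfl
      · rw [rev_t, Su.s4] at ht; simp [nu1.symm, nu2.symm, mu] at ht
      · rw [col_upd q32.1, col_upd q31.1]; exact u2
      · rw [col_upd q32.2, col_upd q31.2]; exact u3)
    refine hm.ext4 Su (E3.mono (subset_refl _) ?_) ⟨st, ?_, ?_, ?_, ?_⟩
    · intro x hx
      rw [Finset.mem_erase] at hx
      simp only [Finset.mem_insert, memA]
      exact prop3 hx
    · rw [k0, col_upd t03, col_upd t02, col_upd t01]; exact rel2_of _ _ y0
    · rw [k1, col_upd t13, col_upd t12, col_upd' rfl, rel_symm]; exact o1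
    · rw [k2, col_upd t23, col_upd' rfl, rel_symm]; exact p1
    · rw [k3, col_upd' rfl, rel_symm]; exact u1
  · classical
    have hsum : ∑ d ∈ inn {g1, g2, g3} B, cost d.k ≤ (if endsIn g1 B then 3 else 0) +
        ((if endsIn g2 B then 3 else 0) + (if endsIn g3 B then 3 else 0)) := by
      have w1 := sum_inn_insert g1 {g2, g3} B
      have w2 := sum_inn_insert g2 {g3} B
      have w3 := sum_inn_insert g3 ∅ B
      rw [c1] at w1; rw [c2] at w2; rw [c3] at w3
      have w4 : ∑ d ∈ inn (∅ : Finset (Dart N)) B, cost d.k = 0 := by simp [inn]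
      have : (insert g3 ∅ : Finset (Dart N)) = {g3} := rfl
      rw [this] at w3
      linarith
    have hex : endsIn g1 B ∨ endsIn g2 B ∨ endsIn g3 B := by
      obtain ⟨d, hd⟩ := hne
      simp only [mem_inn, Finset.mem_insert, Finset.mem_singleton] at hd
      rcases hd with ⟨rfl | rfl | rfl, h⟩
      · left; exact h
      · right; left; exact h
      · right; right; exact h
    have BV : B ⊆ V := hB.trans AV
    have uB : u ∉ B := fun h => mu (hB h)
    -- one or two used
    have i1 : endsIn g1 B → a1.t.1 ∈ B ∧ b1.t.1 ∈ B := by rw [hg1]; exact id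
    have i2 : endsIn g2 B → a2.t.1 ∈ B ∧ b2.t.1 ∈ B := by rw [hg2]; exact id
    have i3 : endsIn g3 B → a3.t.1 ∈ B ∧ b3.t.1 ∈ B := by rw [hg3]; exact id
    have one : ∀ {f a b : Dart N}, f ∈ D → f.s.1 = u → f.t.1 ∉ B → T111 D f.t.1 f.rev a b →
        a.t.1 ∈ B → b.t.1 ∈ B → 13 ≤ pot D B := by
      intro f a b hf hfs hfB T ha hb
      have := hm.sp_alone T.sp hfB (ssu _ (Finset.insert_subset (hm.inst hf) BV) (by
        simp only [Finset.mem_insert, not_or]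
        exact ⟨(Finset.mem_erase.1 (hm.mem_er hf hfs)).1.symm, uB⟩)) ha hb
      have c : cost 1 = 3 := rfl
      omega
    have two : ∀ {f a b f' a' b' : Dart N}, f ∈ D → f.s.1 = u → f.t.1 ∉ B → T111 D f.t.1 f.rev a b →
        a.t.1 ∈ B → b.t.1 ∈ B → f' ∈ D → f'.s.1 = u → f'.t.1 ∉ B → T111 D f'.t.1 f'.rev a' b' →
        a'.t.1 ∈ B → b'.t.1 ∈ B → f'.t.1 ≠ f.t.1 → 17 ≤ pot D B := by
      intro f a b f' a' b' hf hfs hfB T ha hb hf' hfs' hfB' T' ha' hb' hne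
      have p1 := T.sp.pot_add hm.sym hfB ha hb
      have c : cost 1 = 3 := rfl
      have := hm.F111 (hm.inst hf') T'.sw12.sw23 (B := insert f.t.1 B)
        (Finset.insert_subset (hm.inst hf) BV) (by simp [hne, hfB']) (by simp [ha']) (by simp [hb'])
        (by simp only [rev_t, hfs', Finset.mem_insert, not_or]
            exact ⟨(Finset.mem_erase.1 (hm.mem_er hf hfs)).1.symm, uB⟩)
      omega
    have f1 : e1.t.1 ∉ B := fun h => m1 (hB h)
    have f2 : e2.t.1 ∉ B := fun h => m2 (hB h)
    have f3 : e3.t.1 ∉ B := fun h => m3 (hB h)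
    by_cases j1 : endsIn g1 B
    · by_cases j2 : endsIn g2 B
      · by_cases j3 : endsIn g3 B
        · simp only [j1, j2, j3, if_true] at hsum
          have p1 := S1.pot_add hm.sym f1 (i1 j1).1 (i1 j1).2
          have p2 := S2.pot_add hm.sym (B := insert e1.t.1 B) (by simp [t12.symm, f2])
            (by simp [(i2 j2).1]) (by simp [(i2 j2).2])
          have p3 := S3'.pot_add hm.sym (B := insert e2.t.1 (insert e1.t.1 B)) (by simp [t13.symm, t23.symm, f3])
            (by simp [(i3 j3).1]) (by simp [(i3 j3).2])
          have c : cost 1 = 3 := rfl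
          have c' : cost 2 = 2 := rfl
          obtain ⟨W, hW⟩ : ∃ W, W = insert e3.t.1 (insert e2.t.1 (insert e1.t.1 B)) := ⟨_, rfl⟩
          rw [← hW] at p3
          have uW : u ∉ W := by simp [hW, nu1.symm, nu2.symm, nu3.symm, uB]
          have WV : W ⊆ V := by
            rw [hW]
            exact Finset.insert_subset hv3 (Finset.insert_subset hv2 (Finset.insert_subset hv1 BV))
          have w1 : e1.t.1 ∈ W := by simp [hW]
          have w2 : e2.t.1 ∈ W := by simp [hW]
          have w3 : e3.t.1 ∈ W := by simp [hW]
          have big := hm.big (R := insert u W) (Finset.insert_subset hu WV) (x := u) (y := e1.t.1)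
            (by simp) (by simp [w1]) nu1.symm
          by_cases w0 : e0.t.1 ∈ W
          · have := pot_add4 hm.sym uW Su.h1 Su.s1 w0 Su.h2 Su.s2 w1 Su.h3 Su.s3 w2 Su.h4 Su.s4 w3
              Su.n12 Su.n13 Su.n23 Su.n14 Su.n24 Su.n34
            rw [k0, k1, k2, k3] at this
            omega
          · have := pot_add3 hm.sym uW Su.h2 Su.s2 w1 Su.h3 Su.s3 w2 Su.h4 Su.s4 w3 Su.n23 Su.n24 Su.n34
            rw [k1, k2, k3] at this
            have hnV : insert u W ≠ V := fun h => by
              have : e0.t.1 ∈ insert u W := h ▸ hm.inst Su.h1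
              simp [nu0, w0] at this
            have big := big.resolve_left (fun h => hnV h.1)
            omega
        · simp only [j1, j2, j3, if_true, if_false] at hsum
          have := two Su.h2 Su.s2 f1 T1 (i1 j1).1 (i1 j1).2 Su.h3 Su.s3 f2 T2 (i2 j2).1 (i2 j2).2 t12.symm
          omega
      · by_cases j3 : endsIn g3 B
        · simp only [j1, j2, j3, if_true, if_false] at hsum
          have := two Su.h2 Su.s2 f1 T1 (i1 j1).1 (i1 j1).2 Su.h4 Su.s4 f3 T3 (i3 j3).1 (i3 j3).2 t13.symm
          omega
        · simp only [j1, j2, j3, if_true, if_false] at hsum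
          have := one Su.h2 Su.s2 f1 T1 (i1 j1).1 (i1 j1).2
          omega
    · by_cases j2 : endsIn g2 B
      · by_cases j3 : endsIn g3 B
        · simp only [j1, j2, j3, if_true, if_false] at hsum
          have := two Su.h3 Su.s3 f2 T2 (i2 j2).1 (i2 j2).2 Su.h4 Su.s4 f3 T3 (i3 j3).1 (i3 j3).2 t23.symm
          omega
        · simp only [j1, j2, j3, if_true, if_false] at hsum
          have := one Su.h3 Su.s3 f2 T2 (i2 j2).1 (i2 j2).2
          omega
      · have j3 : endsIn g3 B := by tauto
        simp only [j1, j2, j3, if_true, if_false] at hsum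
        have := one Su.h4 Su.s4 f3 T3 (i3 j3).1 (i3 j3).2
        omega
  · obtain ⟨g, hgm, -, h0⟩ := triG12 hm.sym (hm.notri_sub AV) (by
      intro g hg; simp only [Finset.mem_insert, Finset.mem_singleton] at hg
      rcases hg with rfl | rfl | rfl
      · rw [hg1]; show (1 : Fin 3) ≠ 0; decide
      · rw [hg2]; show (1 : Fin 3) ≠ 0; decide
      · rw [hg3]; show (1 : Fin 3) ≠ 0; decide) ht
    simp only [Finset.mem_insert, Finset.mem_singleton] at hgm
    rcases hgm with rfl | rfl | rfl
    · rw [hg1] at h0; exact tri T1 h0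
    · rw [hg2] at h0; exact tri T2 h0
    · rw [hg3] at h0; exact tri T3 h0
end

end CG

namespace CG
variable {N : Type} [DecidableEq N]

theorem T2221.sw12 {D : Finset (Dart N)} {v} {d1 d2 d3 d4 : Dart N} (T : T2221 D v d1 d2 d3 d4) :
    T2221 D v d2 d1 d3 d4 := by
  obtain ⟨S, k1, k2, k3, k4, q1, q2, q3⟩ := T
  exact ⟨S.sw12, k2, k1, k3, k4, q2, q1, q3⟩
theorem T2221.sw13 {D : Finset (Dart N)} {v} {d1 d2 d3 d4 : Dart N} (T : T2221 D v d1 d2 d3 d4) :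
    T2221 D v d3 d2 d1 d4 := by
  obtain ⟨S, k1, k2, k3, k4, q1, q2, q3⟩ := T
  exact ⟨S.sw13, k3, k2, k1, k4, q3, q2, q1⟩

theorem avoidc : ∀ a b c d : Fin 5, ∃ x, x ≠ a ∧ x ≠ b ∧ x ≠ c ∧ x ≠ d := by decide +kernel
theorem away0 : ∀ a b c d : Fin 5, rel 0 a d = true →
    ∃ x, rel 2 x a = true ∧ rel 2 x b = true ∧ rel 2 x c = true ∧ rel 1 x d = true := by decide +kernel
theorem flex12 : ∀ a d : Fin 5, rel 2 a d = true → ∃ t : Fin 5, ∀ x, (x = t ∨ x = t + 1) →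
    rel 2 x a = true ∧ rel 1 x d = true := by decide +kernel

section
variable {D : Finset (Dart N)} {V : Finset N} (hm : MC D V)
include hm

theorem MC.L2a {v : N} {d1 d2 d3 d4 e2 e3 : Dart N} {k : Fin 3} (T : T2221 D v d1 d2 d3 d4)
    (S : Sp D d4.t.1 d4.rev e2 e3 k) : False := by
  obtain ⟨Sv, k1, k2, k3, k4, q1, q2, q3⟩ := T
  have hv : v ∈ V := Sv.s1 ▸ hm.ins _ Sv.h1
  have hb : d4.t.1 ∈ V := hm.inst Sv.h4
  have nv : d4.t.1 ≠ v := (Finset.mem_erase.1 (hm.mem_er Sv.h4 Sv.s4)).1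
  have t14 := hm.tne Sv.h1 Sv.h4 (Sv.s1.trans Sv.s4.symm) Sv.n14 (by rw [k4]; right; decide)
  have t24 := hm.tne Sv.h2 Sv.h4 (Sv.s2.trans Sv.s4.symm) Sv.n24 (by rw [k4]; right; decide)
  have t34 := hm.tne Sv.h3 Sv.h4 (Sv.s3.trans Sv.s4.symm) Sv.n34 (by rw [k4]; right; decide)
  obtain ⟨A, hA⟩ : ∃ A : Finset N, A = (V.erase v).erase d4.t.1 := ⟨_, rfl⟩
  have memA : ∀ x, x ∈ A ↔ x ≠ d4.t.1 ∧ x ≠ v ∧ x ∈ V := by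
    intro x; simp only [hA, Finset.mem_erase]
  have x1 := hm.sp_t12 S
  have x2 := hm.sp_t13 S
  rw [rev_t, Sv.s4] at x1 x2
  have A2 : e2.t.1 ∈ A := (memA _).2 ⟨(Finset.mem_erase.1 (hm.mem_er S.S.h2 S.S.s2)).1, x1.symm, hm.inst S.S.h2⟩
  have A3 : e3.t.1 ∈ A := (memA _).2 ⟨(Finset.mem_erase.1 (hm.mem_er S.S.h3 S.S.s3)).1, x2.symm, hm.inst S.S.h3⟩
  have mb : d4.t.1 ∉ A := fun h => ((memA _).1 h).1 rfl
  have mv : v ∉ A := fun h => ((memA _).1 h).2.1 rfl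
  have AV : A ⊆ V := fun x hx => ((memA _).1 hx).2.2
  have ssu : ∀ B : Finset N, B ⊆ V → v ∉ B → B ⊂ V := fun B h1 h2 =>
    Finset.ssubset_iff_subset_ne.2 ⟨h1, fun h => h2 (h ▸ hv)⟩
  have sub : ∀ B ⊆ A, insert d4.t.1 B ⊂ V := fun B hB => ssu _
    (Finset.insert_subset hb (hB.trans AV)) (by
      simp only [Finset.mem_insert, not_or]; exact ⟨nv.symm, fun h => mv (hB h)⟩)
  have tri : Tri1 D A ⟨e2.t, e3.t, k⟩ → False := hm.sp_tri S mb (sub A (subset_refl _)) A2 A3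
  rcases gad1 hm (ssu A AV mv) A2 A3 (hm.sp_t23 S) k with ⟨σ, hσ, hr⟩ | ⟨B, hB, b2, b3, hp⟩ | h | h
  · obtain ⟨m, h⟩ := hm.sp_ext S mb (by rw [rev_t, Sv.s4]; exact mv) hσ hr
    obtain ⟨c, c1, c2, c3, c4⟩ := avoidc m (col σ d1.t) (col σ d2.t) (col σ d3.t)
    obtain ⟨st, g, r⟩ := h c c1
    obtain ⟨sv, hsv⟩ := st_at d4.s.2 c
    refine hm.ext4 Sv (g.mono (subset_refl _) ?_) ⟨sv, ?_, ?_, ?_, ?_⟩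
    · intro x hx
      rw [Finset.mem_erase] at hx
      simp only [Finset.mem_insert, memA]
      by_cases h : x = d4.t.1
      · exact Or.inl h
      · exact Or.inr ⟨h, hx⟩
    · rw [k1, q1, hsv, col_upd t14]; exact rel2_of _ _ c2
    · rw [k2, q2, hsv, col_upd t24]; exact rel2_of _ _ c3
    · rw [k3, q3, hsv, col_upd t34]; exact rel2_of _ _ c4
    · rw [k4, hsv, col_upd' rfl, rel_symm]; exact r
  · have := hm.sp_alone S (fun h => mb (hB h)) (sub B hB) b2 b3
    omega
  · exact tri (Or.inl h)
  · exact tri (Or.inr h)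

theorem MC.L2b {v : N} {d1 d2 d3 d4 : Dart N} (T : T2221 D v d1 d2 d3 d4) :
    (∃ d ∈ D, d.s.1 = d4.t.1 ∧ d.k = 0) ∨ (⟨d4.t, d1.t, 1⟩ : Dart N) ∈ D := by
  obtain ⟨Sv, k1, k2, k3, k4, q1, q2, q3⟩ := T
  have hv : v ∈ V := Sv.s1 ▸ hm.ins _ Sv.h1
  have t14 := hm.tne Sv.h1 Sv.h4 (Sv.s1.trans Sv.s4.symm) Sv.n14 (by rw [k4]; right; decide)
  have c1 : cost 1 = 3 := rfl
  have c2 : cost 2 = 2 := rfl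
  rcases gad1 hm (hm.erase_ss hv) (hm.mem_er Sv.h1 Sv.s1) (hm.mem_er Sv.h4 Sv.s4) t14 0 with
    ⟨σ, hσ, hr⟩ | ⟨B, hB, b1, b4, hp⟩ | ⟨h, -⟩ | ⟨-, h | ⟨P, hP, h0, h0'⟩⟩
  · exfalso
    obtain ⟨c, r1, r2, r3, r4⟩ := away0 _ (col σ d2.t) (col σ d3.t) _ hr
    obtain ⟨sv, hsv⟩ := st_at d4.s.2 c
    refine hm.ext4 Sv hσ ⟨sv, ?_, ?_, ?_, ?_⟩
    · rw [k1, q1, hsv]; exact r1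
    · rw [k2, q2, hsv]; exact r2
    · rw [k3, q3, hsv]; exact r3
    · rw [k4, hsv]; exact r4
  · exfalso
    have c0 : cost 0 = 4 := rfl
    have vB : v ∉ B := fun h => (Finset.mem_erase.1 (hB h)).1 rfl
    have BV : B ⊆ V := hB.trans (Finset.erase_subset _ _)
    have BV' : B ⊂ V := Finset.ssubset_iff_subset_ne.2 ⟨BV, fun h => vB (h ▸ hv)⟩
    have big := hm.big (R := insert v B) (Finset.insert_subset hv BV) (x := d1.t.1) (y := d4.t.1)
      (by simp [b1]) (by simp [b4]) t14
    have prop : ∀ {d : Dart N}, d ∈ D → d.s.1 = v → d.t.1 ∉ B → insert v B ≠ V := by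
      intro d hd hs hn h
      have : d.t.1 ∈ insert v B := h ▸ hm.inst hd
      simp [hn, (Finset.mem_erase.1 (hm.mem_er hd hs)).1] at this
    by_cases b2 : d2.t.1 ∈ B
    · by_cases b3 : d3.t.1 ∈ B
      · have := pot_add4 hm.sym vB Sv.h1 Sv.s1 b1 Sv.h2 Sv.s2 b2 Sv.h3 Sv.s3 b3 Sv.h4 Sv.s4 b4
          Sv.n12 Sv.n13 Sv.n23 Sv.n14 Sv.n24 Sv.n34
        rw [k1, k2, k3, k4] at this
        omega
      · have := pot_add3 hm.sym vB Sv.h1 Sv.s1 b1 Sv.h2 Sv.s2 b2 Sv.h4 Sv.s4 b4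
          Sv.n12 Sv.n14 Sv.n24
        have big := big.resolve_left (fun h => prop Sv.h3 Sv.s3 b3 h.1)
        rw [k1, k2, k4] at this
        omega
    · by_cases b3 : d3.t.1 ∈ B
      · have := pot_add3 hm.sym vB Sv.h1 Sv.s1 b1 Sv.h3 Sv.s3 b3 Sv.h4 Sv.s4 b4
          Sv.n13 Sv.n14 Sv.n34
        have big := big.resolve_left (fun h => prop Sv.h2 Sv.s2 b2 h.1)
        rw [k1, k3, k4] at this
        omega
      · obtain ⟨φ, hφ, hr⟩ := hm.gk2 BV' b1 b4 (fun h => t14 (by rw [h]))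
        obtain ⟨t, ht⟩ := flex12 _ _ hr
        have hsum : ∑ d ∈ ({d1, d4} : Finset (Dart N)), cost d.k = 5 := by
          rw [Finset.sum_pair Sv.n14, k1, k4]; rfl
        refine hm.flex hv ?_ BV vB (two_le_card b1 b4 t14) hφ {d1, d4} ?_ d4.s.2 t ?_ (by omega) (by omega)
        · intro d hd hs
          rcases Sv.all d hd hs with rfl | rfl | rfl | rfl
          · rw [k1]; decide
          · rw [k2]; decide
          · rw [k3]; decide
          · rw [k4]; decide
        · intro d
          simp only [Finset.mem_insert, Finset.mem_singleton]
          constructor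
          · rintro (rfl | rfl)
            · exact ⟨Sv.h1, Sv.s1, b1⟩
            · exact ⟨Sv.h4, Sv.s4, b4⟩
          · rintro ⟨hd, hs, hdt⟩
            rcases Sv.all d hd hs with rfl | rfl | rfl | rfl
            · exact Or.inl rfl
            · exact absurd hdt b2
            · exact absurd hdt b3
            · exact Or.inr rfl
        · intro st hst d hd
          simp only [Finset.mem_insert, Finset.mem_singleton] at hd
          rcases hd with rfl | rfl
          · rw [k1, q1]; exact (ht _ hst).1
          · rw [k4]; exact (ht _ hst).2
  · exact absurd h (by decide)
  · right; exact hm.sym _ h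
  · left; exact ⟨_, hm.sym _ h0', rfl, rfl⟩

theorem TA.rot {v} {d1 d2 d3 d : Dart N} (T : TA D v d1 d2 d3)
    (hd : d ∈ D) (hs : d.s.1 = v) (hk : d.k = 1) : ∃ a b, TA D v d a b := by
  rcases T.1.all d hd hs with rfl | rfl | rfl
  · exact ⟨_, _, T⟩
  · exact ⟨_, _, T.sw12⟩
  · have := T.2.2.2; rw [hk] at this; exact absurd this (by decide)

/-- the 1-neighbour of a 2221-node is strict or of type D -/
theorem MC.L2 {v : N} {d1 d2 d3 d4 : Dart N} (T : T2221 D v d1 d2 d3 d4) :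
    Strict D d4.t.1 ∨ (∃ f1 f2 f3 f4, TD D d4.t.1 f1 f2 f3 f4) := by
  have hd4 : d4 ∈ D := T.1.h4
  have hk4 : d4.k = 1 := T.2.2.2.2.1
  have hb : d4.t.1 ∈ V := hm.inst hd4
  have hor : (∃ d ∈ D, d.s.1 = d4.t.1 ∧ d.k = 0) ∨ ((⟨d4.t, d1.t, 1⟩ : Dart N) ∈ D ∧
      (⟨d4.t, d2.t, 1⟩ : Dart N) ∈ D ∧ (⟨d4.t, d3.t, 1⟩ : Dart N) ∈ D) := by
    rcases hm.L2b T with h | h1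
    · exact Or.inl h
    · rcases hm.L2b T.sw12 with h | h2
      · exact Or.inl h
      · rcases hm.L2b T.sw13 with h | h3
        · exact Or.inl h
        · exact Or.inr ⟨h1, h2, h3⟩
  have hrev : d4.rev ∈ D := hm.sym _ hd4
  -- four 1-darts, or a 0-dart
  obtain ⟨Sv, k1, k2, k3, k4, q1, q2, q3⟩ := id T
  have dd : ∀ {d d' : Dart N}, d ≠ d' → d.k = d'.k → d.s = d'.s → d.t ≠ d'.t := by
    rintro ⟨a, b, c⟩ ⟨a', b', c'⟩ hne h1 h2 h3; apply hne; simp_all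
  have u12 := dd Sv.n12 (k1.trans k2.symm) (q1.trans q2.symm)
  have u13 := dd Sv.n13 (k1.trans k3.symm) (q1.trans q3.symm)
  have u23 := dd Sv.n23 (k2.trans k3.symm) (q2.trans q3.symm)
  have t14 := hm.tne Sv.h1 Sv.h4 (Sv.s1.trans Sv.s4.symm) Sv.n14 (by rw [k4]; right; decide)
  have nv : ∀ {d : Dart N}, d ∈ D → d.s.1 = v → d.t ≠ d4.s := by
    intro d hd hs h
    exact (Finset.mem_erase.1 (hm.mem_er hd hs)).1 (by rw [h, Sv.s4])
  have cnt1 : (∀ d ∈ D, d.s.1 = d4.t.1 → d.k ≠ 0) → ∀ X : Finset (Dart N),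
      (∀ d ∈ D, d.s.1 = d4.t.1 → d.k = 1 → d ∈ X) → 4 ≤ X.card := by
    intro h0 X hX
    rcases hor with ⟨d, hd, hs, hk⟩ | ⟨h1, h2, h3⟩
    · exact absurd hk (h0 d hd hs)
    · have sub : ({⟨d4.t, d1.t, 1⟩, ⟨d4.t, d2.t, 1⟩, ⟨d4.t, d3.t, 1⟩, ⟨d4.t, d4.s, 1⟩} : Finset (Dart N)) ⊆ X := by
        intro d hd
        simp only [Finset.mem_insert, Finset.mem_singleton] at hd
        rcases hd with rfl | rfl | rfl | rfl
        · exact hX _ h1 rfl rfl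
        · exact hX _ h2 rfl rfl
        · exact hX _ h3 rfl rfl
        · refine hX _ ?_ rfl rfl
          have : d4.rev = ⟨d4.t, d4.s, 1⟩ := by rw [Dart.rev, hk4]
          rw [← this]; exact hrev
      refine le_trans ?_ (Finset.card_le_card sub)
      rw [Finset.card_insert_of_notMem, Finset.card_insert_of_notMem, Finset.card_pair]
      · simp [nv Sv.h3 Sv.s3]
      · simp [u23, nv Sv.h2 Sv.s2]
      · simp [u12, u13, nv Sv.h1 Sv.s1]
  rcases hm.classify hb with h | ⟨f1, f2, f3, F⟩ | ⟨f1, f2, f3, F⟩ | ⟨f1, f2, f3, f4, F⟩ |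
    ⟨f1, f2, f3, f4, F⟩ | ⟨f1, f2, f3, f4, F⟩ | h
  · exact Or.inl h
  · exfalso
    obtain ⟨a, b, F'⟩ := F.rot hrev rfl
    exact hm.L2a T F'.sp
  · exfalso
    obtain ⟨a, b, F'⟩ := TA.rot hm F hrev rfl hk4
    obtain ⟨k, S⟩ := F'.sp
    exact hm.L2a T S
  · exfalso
    obtain ⟨S, a1, a2, a3, a4, -⟩ := F
    have := cnt1 (by
      intro d hd hs
      rcases S.all d hd hs with rfl | rfl | rfl | rfl <;> simp [*]) {f4} (by
      intro d hd hs hk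
      rcases S.all d hd hs with rfl | rfl | rfl | rfl <;> simp_all)
    simp at this
  · exfalso
    obtain ⟨S, a1, a2, a3, a4⟩ := F
    have := cnt1 (by
      intro d hd hs
      rcases S.all d hd hs with rfl | rfl | rfl | rfl <;> simp [*]) {f3, f4} (by
      intro d hd hs hk
      rcases S.all d hd hs with rfl | rfl | rfl | rfl <;> simp_all)
    have := Finset.card_le_two (a := f3) (b := f4)
    omega
  · exfalso
    obtain ⟨S, a1, a2, a3, a4⟩ := F
    have := cnt1 (by
      intro d hd hs
      rcases S.all d hd hs with rfl | rfl | rfl | rfl <;> simp [*]) {f2, f3, f4} (by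
      intro d hd hs hk
      rcases S.all d hd hs with rfl | rfl | rfl | rfl <;> simp_all)
    have := Finset.card_le_three (a := f2) (b := f3) (c := f4)
    omega
  · exact Or.inr h

/-- structure around a type D node with a 2221-neighbour -/
theorem MC.L2c {v b : N} {d1 d2 d3 d4 f1 f2 f3 f4 : Dart N} (T : T2221 D v d1 d2 d3 d4)
    (F : TD D b f1 f2 f3 f4) (hb : d4.t.1 = b) {f : Dart N} (hf : f ∈ D) (hfs : f.s.1 = b)
    (hne : f ≠ d4.rev) : ∃ e ∈ D, e.k = 2 ∧ e.s.1 = v ∧ e.t.1 = f.t.1 := by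
  obtain ⟨S, a1, a2, a3, a4⟩ := F
  have all1 : ∀ d ∈ D, d.s.1 = b → d.k = 1 := by
    intro d hd hs
    rcases S.all d hd hs with rfl | rfl | rfl | rfl <;> assumption
  have no0 : ¬ ∃ d ∈ D, d.s.1 = d4.t.1 ∧ d.k = 0 := by
    rintro ⟨d, hd, hs, hk⟩
    rw [all1 d hd (hs.trans hb)] at hk; exact absurd hk (by decide)
  have h1 := (hm.L2b T).resolve_left no0
  have h2 := (hm.L2b T.sw12).resolve_left no0
  have h3 := (hm.L2b T.sw13).resolve_left no0
  obtain ⟨Sv, k1, k2, k3, k4, q1, q2, q3⟩ := T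
  by_contra hcon
  push Not at hcon
  have e1 := hcon d1 Sv.h1 k1 Sv.s1
  have e2 := hcon d2 Sv.h2 k2 Sv.s2
  have e3 := hcon d3 Sv.h3 k3 Sv.s3
  have dd : ∀ {d d' : Dart N}, d ≠ d' → d.k = d'.k → d.s = d'.s → d.t ≠ d'.t := by
    rintro ⟨a, b, c⟩ ⟨a', b', c'⟩ hne h1 h2 h3; apply hne; simp_all
  have u12 := dd Sv.n12 (k1.trans k2.symm) (q1.trans q2.symm)
  have u13 := dd Sv.n13 (k1.trans k3.symm) (q1.trans q3.symm)
  have u23 := dd Sv.n23 (k2.trans k3.symm) (q2.trans q3.symm)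
  have nv : ∀ {d : Dart N}, d ∈ D → d.s.1 = v → d.t ≠ d4.s := by
    intro d hd hs h
    exact (Finset.mem_erase.1 (hm.mem_er hd hs)).1 (by rw [h, Sv.s4])
  have hr : (⟨d4.t, d4.s, 1⟩ : Dart N) ∈ D := by
    have : d4.rev = ⟨d4.t, d4.s, 1⟩ := by rw [Dart.rev, k4]
    rw [← this]; exact hm.sym _ Sv.h4
  have hne' : f ≠ ⟨d4.t, d4.s, 1⟩ := by
    have : d4.rev = ⟨d4.t, d4.s, 1⟩ := by rw [Dart.rev, k4]
    rw [← this]; exact hne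
  have sub : ({f, ⟨d4.t, d1.t, 1⟩, ⟨d4.t, d2.t, 1⟩, ⟨d4.t, d3.t, 1⟩, ⟨d4.t, d4.s, 1⟩} : Finset (Dart N)) ⊆
      {f1, f2, f3, f4} := by
    intro d hd
    simp only [Finset.mem_insert, Finset.mem_singleton] at hd ⊢
    rcases hd with rfl | rfl | rfl | rfl | rfl
    · exact S.all _ hf hfs
    · exact S.all _ h1 hb
    · exact S.all _ h2 hb
    · exact S.all _ h3 hb
    · exact S.all _ hr hb
  have hc := (Finset.card_le_card sub).trans Finset.card_le_four
  rw [Finset.card_insert_of_notMem, Finset.card_insert_of_notMem, Finset.card_insert_of_notMem,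
    Finset.card_pair] at hc
  · omega
  · simp [nv Sv.h3 Sv.s3]
  · simp [u23, nv Sv.h2 Sv.s2]
  · simp [u12, u13, nv Sv.h1 Sv.s1]
  · simp only [Finset.mem_insert, Finset.mem_singleton, not_or]
    refine ⟨?_, ?_, ?_, hne'⟩
    · rintro rfl; exact e1 rfl
    · rintro rfl; exact e2 rfl
    · rintro rfl; exact e3 rfl

/-- a type D node has at most two 2221-neighbours -/
theorem MC.L2d {b : N} {f1 f2 f3 f4 a1 a2 a3 b1 b2 b3 c1 c2 c3 : Dart N}
    (F : TD D b f1 f2 f3 f4) (T1 : T2221 D f1.t.1 a1 a2 a3 f1.rev)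
    (T2 : T2221 D f2.t.1 b1 b2 b3 f2.rev) (T3 : T2221 D f3.t.1 c1 c2 c3 f3.rev) : False := by
  obtain ⟨S, k1, k2, k3, k4⟩ := id F
  have t12 := hm.tne S.h1 S.h2 (S.s1.trans S.s2.symm) S.n12 (by rw [k1]; left; decide)
  have t13 := hm.tne S.h1 S.h3 (S.s1.trans S.s3.symm) S.n13 (by rw [k1]; left; decide)
  have t14 := hm.tne S.h1 S.h4 (S.s1.trans S.s4.symm) S.n14 (by rw [k1]; left; decide)
  have t23 := hm.tne S.h2 S.h3 (S.s2.trans S.s3.symm) S.n23 (by rw [k2]; left; decide)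
  have t24 := hm.tne S.h2 S.h4 (S.s2.trans S.s4.symm) S.n24 (by rw [k2]; left; decide)
  have t34 := hm.tne S.h3 S.h4 (S.s3.trans S.s4.symm) S.n34 (by rw [k3]; left; decide)
  have n1 := (Finset.mem_erase.1 (hm.mem_er S.h1 S.s1)).1
  have n2 := (Finset.mem_erase.1 (hm.mem_er S.h2 S.s2)).1
  have n3 := (Finset.mem_erase.1 (hm.mem_er S.h3 S.s3)).1
  have n4 := (Finset.mem_erase.1 (hm.mem_er S.h4 S.s4)).1
  obtain ⟨x2, X2, y2, z2, w2⟩ := hm.L2c T1 F (by simpa using S.s1) S.h2 S.s2 (by simpa using S.n12.symm)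
  obtain ⟨x3, X3, y3, z3, w3⟩ := hm.L2c T1 F (by simpa using S.s1) S.h3 S.s3 (by simpa using S.n13.symm)
  obtain ⟨x4, X4, y4, z4, w4⟩ := hm.L2c T1 F (by simpa using S.s1) S.h4 S.s4 (by simpa using S.n14.symm)
  obtain ⟨x3', X3', y3', z3', w3'⟩ := hm.L2c T2 F (by simpa using S.s2) S.h3 S.s3 (by simpa using S.n23.symm)
  obtain ⟨x4', X4', y4', z4', w4'⟩ := hm.L2c T2 F (by simpa using S.s2) S.h4 S.s4 (by simpa using S.n24.symm)
  obtain ⟨x5, X5, y5, z5, w5⟩ := hm.L2c T3 F (by simpa using S.s3) S.h4 S.s4 (by simpa using S.n34.symm)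
  have p0 := pot_single hm.loop f4.t.1
  have p1 := pot_add1 hm.sym (A := {f4.t.1}) (v := f3.t.1) (by simp [t34]) X5 z5 (by simp [w5])
  have p2 := pot_add2 hm.sym (A := {f3.t.1, f4.t.1}) (v := f2.t.1) (by simp [t23, t24]) X3' z3' (by simp [w3'])
    X4' z4' (by simp [w4']) (by rintro rfl; exact t34 (w3'.symm.trans w4'))
  have p3 := pot_add3 hm.sym (A := {f2.t.1, f3.t.1, f4.t.1}) (v := f1.t.1) (by simp [t12, t13, t14])
    X2 z2 (by simp [w2]) X3 z3 (by simp [w3]) X4 z4 (by simp [w4])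
    (by rintro rfl; exact t23 (w2.symm.trans w3)) (by rintro rfl; exact t24 (w2.symm.trans w4))
    (by rintro rfl; exact t34 (w3.symm.trans w4))
  have p4 := pot_add4 hm.sym (A := {f1.t.1, f2.t.1, f3.t.1, f4.t.1}) (v := b)
    (by simp [n1.symm, n2.symm, n3.symm, n4.symm])
    S.h1 S.s1 (by simp) S.h2 S.s2 (by simp) S.h3 S.s3 (by simp) S.h4 S.s4 (by simp)
    S.n12 S.n13 S.n23 S.n14 S.n24 S.n34
  have hb : b ∈ V := S.s1 ▸ hm.ins _ S.h1
  have := hm.potge (R := {b, f1.t.1, f2.t.1, f3.t.1, f4.t.1}) (by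
    intro x hx
    simp only [Finset.mem_insert, Finset.mem_singleton] at hx
    rcases hx with rfl | rfl | rfl | rfl | rfl
    · exact hb
    · exact hm.inst S.h1
    · exact hm.inst S.h2
    · exact hm.inst S.h3
    · exact hm.inst S.h4) (two_le_card (x := b) (y := f1.t.1) (by simp) (by simp) n1.symm)
  rw [k1, k2, k3, k4] at p4
  rw [y2, y3, y4] at p3
  rw [y3', y4'] at p2
  rw [y5] at p1
  have c1 : cost 1 = 3 := rfl
  have c2 : cost 2 = 2 := rfl
  omega
end

end CG

namespace CG
variable {N : Type} [DecidableEq N]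

theorem F122 : ∀ p1 p2 y1 y2, ok3 2 2 1 p1 p2 0 y1 y2 0 = true := by decide +kernel

section
variable {D : Finset (Dart N)} {V : Finset N} (hm : MC D V)
include hm

/-- the two 1-ends of a type B node attached at the same position cannot lie in a small set -/
theorem MC.TBflex {u : N} {d1 d2 d3 d4 : Dart N} (U : TB D u d1 d2 d3 d4) (hp : d3.s = d4.s)
    (h0 : ∀ d ∈ D, d.s.1 = d3.t.1 → d.t.1 = d4.t.1 → False) {B : Finset N} (hB : B ⊆ V.erase u)
    (b3 : d3.t.1 ∈ B) (b4 : d4.t.1 ∈ B) (hpot : pot D B ≤ 14) : False := by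
  obtain ⟨Su, k1, k2, k3, k4⟩ := U
  have hu : u ∈ V := Su.s1 ▸ hm.ins _ Su.h1
  have t34 := hm.tne Su.h3 Su.h4 (Su.s3.trans Su.s4.symm) Su.n34 (by rw [k3]; left; decide)
  have c1 : cost 1 = 3 := rfl
  have c2 : cost 2 = 2 := rfl
  have uB : u ∉ B := fun h => (Finset.mem_erase.1 (hB h)).1 rfl
  have BV : B ⊆ V := hB.trans (Finset.erase_subset _ _)
  have BV' : B ⊂ V := Finset.ssubset_iff_subset_ne.2 ⟨BV, fun h => uB (h ▸ hu)⟩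
  have big := hm.big (R := insert u B) (Finset.insert_subset hu BV) (x := d3.t.1) (y := d4.t.1)
    (by simp [b3]) (by simp [b4]) t34
  have prop : ∀ {d : Dart N}, d ∈ D → d.s.1 = u → d.t.1 ∉ B → insert u B ≠ V := by
    intro d hd hs hn h
    have : d.t.1 ∈ insert u B := h ▸ hm.inst hd
    simp [hn, (Finset.mem_erase.1 (hm.mem_er hd hs)).1] at this
  by_cases b1 : d1.t.1 ∈ B
  · by_cases b2 : d2.t.1 ∈ B
    · have := pot_add4 hm.sym uB Su.h1 Su.s1 b1 Su.h2 Su.s2 b2 Su.h3 Su.s3 b3 Su.h4 Su.s4 b4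
        Su.n12 Su.n13 Su.n23 Su.n14 Su.n24 Su.n34
      rw [k1, k2, k3, k4] at this
      omega
    · have := pot_add3 hm.sym uB Su.h1 Su.s1 b1 Su.h3 Su.s3 b3 Su.h4 Su.s4 b4 Su.n13 Su.n14 Su.n34
      have big := big.resolve_left (fun h => prop Su.h2 Su.s2 b2 h.1)
      rw [k1, k3, k4] at this
      omega
  · by_cases b2 : d2.t.1 ∈ B
    · have := pot_add3 hm.sym uB Su.h2 Su.s2 b2 Su.h3 Su.s3 b3 Su.h4 Su.s4 b4 Su.n23 Su.n24 Su.n34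
      have big := big.resolve_left (fun h => prop Su.h1 Su.s1 b1 h.1)
      rw [k2, k3, k4] at this
      omega
    · rcases hm.gk1 BV' b3 b4 t34 with ⟨φ, hφ, hr⟩ | h
      · obtain ⟨t, r1, r2, r3, r4⟩ := near_t _ _ hr
        have hsum : ∑ d ∈ ({d3, d4} : Finset (Dart N)), cost d.k = 6 := by
          rw [Finset.sum_pair Su.n34, k3, k4]; rfl
        refine hm.flex hu ?_ BV uB (two_le_card b3 b4 t34) hφ {d3, d4} ?_ d4.s.2 t ?_ (by omega) (by omega)
        · intro d hd hs
          rcases Su.all d hd hs with rfl | rfl | rfl | rfl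
          · rw [k1]; decide
          · rw [k2]; decide
          · rw [k3]; decide
          · rw [k4]; decide
        · intro d
          simp only [Finset.mem_insert, Finset.mem_singleton]
          constructor
          · rintro (rfl | rfl)
            · exact ⟨Su.h3, Su.s3, b3⟩
            · exact ⟨Su.h4, Su.s4, b4⟩
          · rintro ⟨hd, hs, hdt⟩
            rcases Su.all d hd hs with rfl | rfl | rfl | rfl
            · exact absurd hdt b1
            · exact absurd hdt b2
            · exact Or.inl rfl
            · exact Or.inr rfl
        · intro st hst d hd
          simp only [Finset.mem_insert, Finset.mem_singleton] at hd
          rcases hd with rfl | rfl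
          · rw [k3, hp]
            rcases hst with h | h <;> rw [h] <;> assumption
          · rw [k4]
            rcases hst with h | h <;> rw [h] <;> assumption
      · exact h0 _ h rfl rfl

/-- a T111 neighbour of u is not adjacent to the other 1-neighbours of u -/
theorem MC.nadj {u : N} {d3 d4 x y : Dart N} (h3 : d3 ∈ D) (h4 : d4 ∈ D) (s3 : d3.s.1 = u)
    (s4 : d4.s.1 = u) (k4 : d4.k = 1) (hne : d3.t.1 ≠ d4.t.1) (T : T111 D d3.t.1 d3.rev x y) :
    ∀ d ∈ D, d.s.1 = d3.t.1 → d.t.1 = d4.t.1 → False := by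
  intro d hd hs ht
  have kk : d4.k ≠ 2 := by rw [k4]; decide
  rcases T.1.all d hd hs with rfl | rfl | rfl
  · exact hm.loop _ h4 (s4.trans (s3.symm.trans ht))
  · exact hm.LT (hm.inst h3) T h4 kk (s4.trans s3.symm) ht.symm
  · exact hm.LT (hm.inst h3) T.sw23 h4 kk (s4.trans s3.symm) ht.symm

theorem MC.L5 {u : N} {d1 d2 d3 d4 x y f2 f3 : Dart N} {k : Fin 3} (U : TB D u d1 d2 d3 d4)
    (hp : d3.s = d4.s) (T : T111 D d3.t.1 d3.rev x y) (S : Sp D d4.t.1 d4.rev f2 f3 k) : False := by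
  obtain ⟨Su, k1, k2, k3, k4⟩ := id U
  have hu : u ∈ V := Su.s1 ▸ hm.ins _ Su.h1
  have t34 := hm.tne Su.h3 Su.h4 (Su.s3.trans Su.s4.symm) Su.n34 (by rw [k3]; left; decide)
  have t13 := hm.tne Su.h1 Su.h3 (Su.s1.trans Su.s3.symm) Su.n13 (by rw [k3]; right; decide)
  have t14 := hm.tne Su.h1 Su.h4 (Su.s1.trans Su.s4.symm) Su.n14 (by rw [k4]; right; decide)
  have t23 := hm.tne Su.h2 Su.h3 (Su.s2.trans Su.s3.symm) Su.n23 (by rw [k3]; right; decide)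
  have t24 := hm.tne Su.h2 Su.h4 (Su.s2.trans Su.s4.symm) Su.n24 (by rw [k4]; right; decide)
  have na := hm.nadj Su.h3 Su.h4 Su.s3 Su.s4 k4 t34 T
  rcases hm.twoSp hu T.sp S (by rw [rev_t, Su.s3]) (by rw [rev_t, Su.s4]) t34 (fun d hd h1 h2 => na d hd h1 h2)
    with ⟨σ, m, m', h⟩ | ⟨B, hB, b1, b2, hpt⟩ | ⟨B, hB, b1, b2, hpt, -⟩
  · obtain ⟨st, y1, y2, y3, y4⟩ := avoid4 d1.s.2 d2.s.2 d4.s.2 d4.s.2 (col σ d1.t) (col σ d2.t) m m'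
    obtain ⟨τ, g, ag, ra, rb⟩ := h _ y3 y4
    refine hm.ext4 Su g ⟨st, ?_, ?_, ?_, ?_⟩
    · rw [k1, ag _ t13 t14]; exact rel2_of _ _ y1
    · rw [k2, ag _ t23 t24]; exact rel2_of _ _ y2
    · rw [k3, hp, rel_symm]; exact ra
    · rw [k4, rel_symm]; exact rb
  · exact hm.TBflex U hp na hB b1 b2 (by omega)
  · exact hm.TBflex U hp na hB b1 b2 (by omega)

theorem MC.L4s {u : N} {d1 d2 d3 d4 x y : Dart N} (U : TB D u d1 d2 d3 d4)
    (hp : d3.s = d4.s) (T : T111 D d3.t.1 d3.rev x y) : ∃ d ∈ D, d.s.1 = d4.t.1 ∧ d.k = 0 := by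
  obtain ⟨Su, k1, k2, k3, k4⟩ := id U
  obtain ⟨Sv, l1, l2, l3, q1, q2⟩ := id T
  have hu : u ∈ V := Su.s1 ▸ hm.ins _ Su.h1
  have hv : d3.t.1 ∈ V := hm.inst Su.h3
  have hvu : d3.t.1 ≠ u := (Finset.mem_erase.1 (hm.mem_er Su.h3 Su.s3)).1
  have t34 := hm.tne Su.h3 Su.h4 (Su.s3.trans Su.s4.symm) Su.n34 (by rw [k3]; left; decide)
  have t13 := hm.tne Su.h1 Su.h3 (Su.s1.trans Su.s3.symm) Su.n13 (by rw [k3]; right; decide)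
  have t23 := hm.tne Su.h2 Su.h3 (Su.s2.trans Su.s3.symm) Su.n23 (by rw [k3]; right; decide)
  have na := hm.nadj Su.h3 Su.h4 Su.s3 Su.s4 k4 t34 T
  have c1 : cost 1 = 3 := rfl
  obtain ⟨A, hA⟩ : ∃ A : Finset N, A = (V.erase u).erase d3.t.1 := ⟨_, rfl⟩
  have memA : ∀ z, z ∈ A ↔ z ≠ d3.t.1 ∧ z ≠ u ∧ z ∈ V := by
    intro z; simp only [hA, Finset.mem_erase]
  have x1 := hm.sp_t12 T.sp
  have x2 := hm.sp_t13 T.sp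
  have x3 := hm.sp_t23 T.sp
  rw [rev_t, Su.s3] at x1 x2
  have Ax : x.t.1 ∈ A := (memA _).2 ⟨(Finset.mem_erase.1 (hm.mem_er Sv.h2 Sv.s2)).1, x1.symm, hm.inst Sv.h2⟩
  have Ay : y.t.1 ∈ A := (memA _).2 ⟨(Finset.mem_erase.1 (hm.mem_er Sv.h3 Sv.s3)).1, x2.symm, hm.inst Sv.h3⟩
  have Ab : d4.t.1 ∈ A := (memA _).2 ⟨t34.symm, (Finset.mem_erase.1 (hm.mem_er Su.h4 Su.s4)).1, hm.inst Su.h4⟩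
  have mv : d3.t.1 ∉ A := fun h => ((memA _).1 h).1 rfl
  have mu : u ∉ A := fun h => ((memA _).1 h).2.1 rfl
  have AV : A ⊆ V := fun x hx => ((memA _).1 hx).2.2
  have ssu : ∀ B : Finset N, B ⊆ V → u ∉ B → B ⊂ V := fun B h1 h2 =>
    Finset.ssubset_iff_subset_ne.2 ⟨h1, fun h => h2 (h ▸ hu)⟩
  have nx : x.t.1 ≠ d4.t.1 := fun h => na x Sv.h2 Sv.s2 h
  have ny : y.t.1 ≠ d4.t.1 := fun h => na y Sv.h3 Sv.s3 h
  have single : ∀ B ⊆ A, ∀ p q : N, p ∈ B → q ∈ B → p ≠ q → pot D B ≤ 10 → False := by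
    intro B hB p q hp hq hne h
    have := hm.P2 (ssu B (hB.trans AV) (fun h => mu (hB h))) hp hq hne
    omega
  rcases hm.gad2 (ssu A AV mu) (g1 := ⟨x.t, d4.t, 1⟩) (g2 := ⟨y.t, d4.t, 1⟩) ⟨Ax, Ab⟩ ⟨Ay, Ab⟩
    nx ny with ⟨σ, hσ, hr, hr'⟩ | ⟨B, hB, hE, hpt⟩ | ⟨B, hB, hE, hpt⟩ |
      ⟨B, hB, hE, hE', hpt⟩ | hT | hT | ⟨h, -⟩
  · exfalso
    simp only at hr hr'
    obtain ⟨sv, hsv⟩ := st_at y.s.2 (col σ d4.t)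
    have E := ext_node hm.sym hm.loop hσ mv sv (by
      intro d hd hs ht
      rcases Sv.all d hd hs with rfl | rfl | rfl
      · rw [rev_t, Su.s3] at ht; exact absurd ht mu
      · rw [l2, q2, hsv, rel_symm]; exact hr
      · rw [l3, hsv, rel_symm]; exact hr')
    obtain ⟨st, o1, o2, o3⟩ := norm3 (F122 (d1.s.2 - d4.s.2) (d2.s.2 - d4.s.2) (col σ d1.t - col σ d4.t)
      (col σ d2.t - col σ d4.t))
    refine hm.ext4 Su (E.mono (subset_refl _) ?_) ⟨st, ?_, ?_, ?_, ?_⟩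
    · intro z hz
      rw [Finset.mem_erase] at hz
      simp only [Finset.mem_insert, memA]
      by_cases h : z = d3.t.1
      · exact Or.inl h
      · exact Or.inr ⟨h, hz⟩
    · rw [k1, col_upd t13]; exact o1
    · rw [k2, col_upd t23]; exact o2
    · rw [k3, hp, col_upd' rfl]
      have : d3.t.2 = y.s.2 := congrArg Prod.snd q1
      rw [this, hsv]; exact o3
    · rw [k4, col_upd t34.symm]; exact o3
  · exact (single B hB _ _ hE.1 hE.2 nx (by simp only at hpt; omega)).elim
  · exact (single B hB _ _ hE.1 hE.2 ny (by simp only at hpt; omega)).elim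
  · exfalso
    have p1 := T.sp.pot_add hm.sym (B := B) (fun h => mv (hB h)) hE.1 hE'.1
    refine hm.TBflex U hp na (B := insert d3.t.1 B) ?_ (by simp) (Finset.mem_insert_of_mem hE.2) ?_
    · intro z hz
      rw [Finset.mem_insert] at hz
      rw [Finset.mem_erase]
      rcases hz with rfl | hz
      · exact ⟨hvu, hv⟩
      · exact ((memA _).1 (hB hz)).2
    · simp only at hpt; omega
  · rcases hT with ⟨-, h⟩ | ⟨h, -⟩
    · exact ⟨_, hm.sym _ h, rfl, rfl⟩
    · exact absurd h (show (1 : Fin 3) ≠ 0 by decide)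
  · rcases hT with ⟨-, h⟩ | ⟨h, -⟩
    · exact ⟨_, hm.sym _ h, rfl, rfl⟩
    · exact absurd h (show (1 : Fin 3) ≠ 0 by decide)
  · rcases h with h | h
    · exact absurd h (show (1 : Fin 3) ≠ 0 by decide)
    · exact absurd h (show (1 : Fin 3) ≠ 0 by decide)
end

end CG

namespace CG
variable {N : Type} [DecidableEq N]
def fα (p1 p2 p3 : Fin 5) : Prop := ∀ m a1 a2, ok4 2 2 2 1 p1 p2 p3 0 a1 a2 m 0 = true
def fβ (p1 p2 p3 : Fin 5) : Prop := ∀ a1 a2 c, rel 2 a1 0 = true → ok4 2 2 1 1 p1 p2 p3 0 a1 a2 c 0 = true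
def fγ (p1 p2 p3 : Fin 5) : Prop := ∀ a1 a2 c, rel 1 a1 0 = true → ok4 2 2 1 1 p1 p2 p3 0 a1 a2 c 0 = true
def fε (p1 p2 p3 : Fin 5) : Prop := ∀ a1, rel 0 a1 0 = true → ∃ m, ∀ a2 c, rel 1 c m = true →
  ok4 2 2 1 1 p1 p2 p3 0 a1 a2 c 0 = true
instance (p1 p2 p3) : Decidable (fα p1 p2 p3) := by unfold fα; infer_instance
instance (p1 p2 p3) : Decidable (fβ p1 p2 p3) := by unfold fβ; infer_instance
instance (p1 p2 p3) : Decidable (fγ p1 p2 p3) := by unfold fγ; infer_instance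
instance (p1 p2 p3) : Decidable (fε p1 p2 p3) := by unfold fε; infer_instance
set_option maxRecDepth 4000 in
theorem Fd : ∀ p1 p2 p3 : Fin 5, p3 ≠ 0 → fα p1 p2 p3 ∨ fβ p1 p2 p3 ∨ fβ p2 p1 p3 ∨
   (fγ p1 p2 p3 ∧ fε p1 p2 p3) ∨ (fγ p2 p1 p3 ∧ fε p2 p1 p3) := by decide +kernel

theorem TB.sw12 {D : Finset (Dart N)} {v} {d1 d2 d3 d4 : Dart N} (T : TB D v d1 d2 d3 d4) :
    TB D v d2 d1 d3 d4 := by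
  obtain ⟨S, k1, k2, k3, k4⟩ := T
  exact ⟨S.sw12, k2, k1, k3, k4⟩

section
variable {D : Finset (Dart N)} {V : Finset N} (hm : MC D V)
include hm

theorem MC.L4a {u : N} {d1 d2 d3 d4 x y : Dart N} (U : TB D u d1 d2 d3 d4)
    (T : T111 D d3.t.1 d3.rev x y)
    (hf : fα (d1.s.2 - d4.s.2) (d2.s.2 - d4.s.2) (d3.s.2 - d4.s.2)) : False := by
  obtain ⟨Su, k1, k2, k3, k4⟩ := id U
  have S := T.sp
  have hu : u ∈ V := Su.s1 ▸ hm.ins _ Su.h1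
  have hv : d3.t.1 ∈ V := hm.inst Su.h3
  have nv : d3.t.1 ≠ u := (Finset.mem_erase.1 (hm.mem_er Su.h3 Su.s3)).1
  have t34 := hm.tne Su.h3 Su.h4 (Su.s3.trans Su.s4.symm) Su.n34 (by rw [k3]; left; decide)
  have t13 := hm.tne Su.h1 Su.h3 (Su.s1.trans Su.s3.symm) Su.n13 (by rw [k3]; right; decide)
  have t23 := hm.tne Su.h2 Su.h3 (Su.s2.trans Su.s3.symm) Su.n23 (by rw [k3]; right; decide)
  obtain ⟨A, hA⟩ : ∃ A : Finset N, A = (V.erase u).erase d3.t.1 := ⟨_, rfl⟩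
  have memA : ∀ z, z ∈ A ↔ z ≠ d3.t.1 ∧ z ≠ u ∧ z ∈ V := by
    intro z; simp only [hA, Finset.mem_erase]
  have x1 := hm.sp_t12 S
  have x2 := hm.sp_t13 S
  rw [rev_t, Su.s3] at x1 x2
  have A2 : x.t.1 ∈ A := (memA _).2 ⟨(Finset.mem_erase.1 (hm.mem_er S.S.h2 S.S.s2)).1, x1.symm, hm.inst S.S.h2⟩
  have A3 : y.t.1 ∈ A := (memA _).2 ⟨(Finset.mem_erase.1 (hm.mem_er S.S.h3 S.S.s3)).1, x2.symm, hm.inst S.S.h3⟩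
  have mb : d3.t.1 ∉ A := fun h => ((memA _).1 h).1 rfl
  have mu : u ∉ A := fun h => ((memA _).1 h).2.1 rfl
  have AV : A ⊆ V := fun x hx => ((memA _).1 hx).2.2
  have ssu : ∀ B : Finset N, B ⊆ V → u ∉ B → B ⊂ V := fun B h1 h2 =>
    Finset.ssubset_iff_subset_ne.2 ⟨h1, fun h => h2 (h ▸ hu)⟩
  have sub : ∀ B ⊆ A, insert d3.t.1 B ⊂ V := fun B hB => ssu _
    (Finset.insert_subset hv (hB.trans AV)) (by
      simp only [Finset.mem_insert, not_or]; exact ⟨nv.symm, fun h => mu (hB h)⟩)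
  have tri : Tri1 D A ⟨x.t, y.t, 1⟩ → False := hm.sp_tri S mb (sub A (subset_refl _)) A2 A3
  rcases gad1 hm (ssu A AV mu) A2 A3 (hm.sp_t23 S) 1 with ⟨σ, hσ, hr⟩ | ⟨B, hB, b2, b3, hp⟩ | h | h
  · obtain ⟨m, h⟩ := hm.sp_ext S mb (by rw [rev_t, Su.s3]; exact mu) hσ hr
    obtain ⟨st, o1, o2, o3, o4⟩ := norm4 (hf (m - col σ d4.t) (col σ d1.t - col σ d4.t)
      (col σ d2.t - col σ d4.t))
    obtain ⟨sv, g, r⟩ := h (val st d3.s.2) (by simpa [rel] using o3)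
    refine hm.ext4 Su (g.mono (subset_refl _) ?_) ⟨st, ?_, ?_, ?_, ?_⟩
    · intro z hz
      rw [Finset.mem_erase] at hz
      simp only [Finset.mem_insert, memA]
      by_cases h : z = d3.t.1
      · exact Or.inl h
      · exact Or.inr ⟨h, hz⟩
    · rw [k1, col_upd t13]; exact o1
    · rw [k2, col_upd t23]; exact o2
    · rw [k3, col_upd' rfl, rel_symm]; exact r
    · rw [k4, col_upd t34.symm]; exact o4
  · have := hm.sp_alone S (fun h => mb (hB h)) (sub B hB) b2 b3
    omega
  · exact tri (Or.inl h)
  · exact tri (Or.inr h)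

theorem MC.L4b {u : N} {d1 d2 d3 d4 : Dart N} (U : TB D u d1 d2 d3 d4)
    (hf : fβ (d1.s.2 - d4.s.2) (d2.s.2 - d4.s.2) (d3.s.2 - d4.s.2)) : False := by
  obtain ⟨Su, k1, k2, k3, k4⟩ := id U
  have hu : u ∈ V := Su.s1 ▸ hm.ins _ Su.h1
  have t14 := hm.tne Su.h1 Su.h4 (Su.s1.trans Su.s4.symm) Su.n14 (by rw [k4]; right; decide)
  obtain ⟨σ, hσ, hr⟩ := hm.gk2 (hm.erase_ss hu) (hm.mem_er Su.h1 Su.s1) (hm.mem_er Su.h4 Su.s4)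
    (fun h => t14 (congrArg Prod.fst h))
  refine hm.ext4 Su hσ ?_
  rw [k1, k2, k3, k4]
  exact norm4 (hf _ _ _ (by rw [relz]; exact hr))

theorem MC.L4e {u : N} {d1 d2 d3 d4 x y : Dart N} (U : TB D u d1 d2 d3 d4)
    (T : T111 D d3.t.1 d3.rev x y) (h0 : (⟨d1.t, d4.t, 0⟩ : Dart N) ∈ D)
    (hf : fε (d1.s.2 - d4.s.2) (d2.s.2 - d4.s.2) (d3.s.2 - d4.s.2)) : False := by
  obtain ⟨Su, k1, k2, k3, k4⟩ := id U
  obtain ⟨Sv, l1, l2, l3, q1, q2⟩ := id T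
  have hu : u ∈ V := Su.s1 ▸ hm.ins _ Su.h1
  have hv : d3.t.1 ∈ V := hm.inst Su.h3
  have n1 := (Finset.mem_erase.1 (hm.mem_er Su.h1 Su.s1)).1
  have n2 := (Finset.mem_erase.1 (hm.mem_er Su.h2 Su.s2)).1
  have n3 := (Finset.mem_erase.1 (hm.mem_er Su.h3 Su.s3)).1
  have n4 := (Finset.mem_erase.1 (hm.mem_er Su.h4 Su.s4)).1
  have t34 := hm.tne Su.h3 Su.h4 (Su.s3.trans Su.s4.symm) Su.n34 (by rw [k3]; left; decide)
  have t13 := hm.tne Su.h1 Su.h3 (Su.s1.trans Su.s3.symm) Su.n13 (by rw [k3]; right; decide)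
  have t23 := hm.tne Su.h2 Su.h3 (Su.s2.trans Su.s3.symm) Su.n23 (by rw [k3]; right; decide)
  have t14 := hm.tne Su.h1 Su.h4 (Su.s1.trans Su.s4.symm) Su.n14 (by rw [k4]; right; decide)
  have t24 := hm.tne Su.h2 Su.h4 (Su.s2.trans Su.s4.symm) Su.n24 (by rw [k4]; right; decide)
  have c0 : cost 0 = 4 := rfl
  have c1 : cost 1 = 3 := rfl
  have c2 : cost 2 = 2 := rfl
  -- no 0-darts at v
  have v0 : ∀ d ∈ D, d.s.1 = d3.t.1 → d.k ≠ 0 := by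
    intro d hd hs
    rcases Sv.all d hd hs with rfl | rfl | rfl
    · rw [l1]; decide
    · rw [l2]; decide
    · rw [l3]; decide
  obtain ⟨R, hR⟩ : ∃ R : Finset N, R = insert u (insert d1.t.1 {d4.t.1}) := ⟨_, rfl⟩
  have memR : ∀ z, z ∈ R ↔ z = u ∨ z = d1.t.1 ∨ z = d4.t.1 := by
    intro z; simp [hR]
  have uR : u ∈ R := (memR _).2 (Or.inl rfl)
  have aR : d1.t.1 ∈ R := (memR _).2 (Or.inr (Or.inl rfl))
  have bR : d4.t.1 ∈ R := (memR _).2 (Or.inr (Or.inr rfl))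
  have vR : d3.t.1 ∉ R := by
    rw [memR]; rintro (h | h | h)
    · exact n3 h
    · exact t13 h.symm
    · exact t34 h
  have RV : R ⊆ V := by
    intro z hz
    rcases (memR z).1 hz with rfl | rfl | rfl
    · exact hu
    · exact hm.inst Su.h1
    · exact hm.inst Su.h4
  have ssv : ∀ B : Finset N, B ⊆ V → d3.t.1 ∉ B → B ⊂ V := fun B h1 h2 =>
    Finset.ssubset_iff_subset_ne.2 ⟨h1, fun h => h2 (h ▸ hv)⟩
  have big : ∀ B : Finset N, R ⊆ B → B ⊆ V → pot D B ≤ 10 → d3.t.1 ∈ B := by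
    intro B h1 h2 h3
    by_contra h4
    have := hm.P2 (ssv B h2 h4) (h1 aR) (h1 bR) t14
    omega
  have ps : pot D {d4.t.1} = 10 := pot_single hm.loop _
  have pa : pot D (insert d1.t.1 {d4.t.1}) ≤ 12 := by
    have := pot_add1 hm.sym (A := {d4.t.1}) (by simpa using t14) h0 rfl (by simp)
    simp only at this
    omega
  have uab : u ∉ insert d1.t.1 ({d4.t.1} : Finset N) := by
    simp only [Finset.mem_insert, Finset.mem_singleton, not_or]; exact ⟨n1.symm, n4.symm⟩
  have pR : pot D R ≤ 12 := by
    have := pot_add2 hm.sym uab Su.h1 Su.s1 (by simp) Su.h4 Su.s4 (by simp) Su.n14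
    rw [k1, k4] at this
    rw [hR]; omega
  have a2R : d2.t.1 ∉ R := by
    intro h
    have hb : d2.t.1 ∈ insert d1.t.1 ({d4.t.1} : Finset N) := by
      rcases (memR _).1 h with h | h | h
      · exact absurd h n2
      · simp [h]
      · simp [h]
    have := pot_add3 hm.sym uab Su.h1 Su.s1 (by simp) Su.h2 Su.s2 hb Su.h4 Su.s4 (by simp)
      Su.n12 Su.n14 Su.n24
    rw [k1, k2, k4] at this
    exact vR (big R (subset_refl _) RV (by rw [hR]; omega))
  obtain ⟨φ, hφ⟩ := hm.sub R (ssv R RV vR)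
  have r0 := hφ _ h0 aR bR
  simp only at r0
  obtain ⟨m, hmm⟩ := hf (col φ d1.t - col φ d4.t) (by rw [relz]; exact r0)
  obtain ⟨i, hi⟩ := val_surj (φ u) (m + col φ d4.t)
  let g : Dart N := ⟨d3.t, (u, i), 1⟩
  have key := hm.lemKM' RV (two_le_card aR bR t14) hφ (F := {d3.rev, d2.rev})
    (by
      intro d hd
      simp only [Finset.mem_insert, Finset.mem_singleton] at hd
      rcases hd with rfl | rfl
      · exact hm.sym _ Su.h3
      · exact hm.sym _ Su.h2)
    (by
      intro d hd
      simp only [Finset.mem_insert, Finset.mem_singleton] at hd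
      rcases hd with rfl | rfl
      · exact ⟨vR, by rw [rev_t, Su.s3]; exact uR⟩
      · exact ⟨a2R, by rw [rev_t, Su.s2]; exact uR⟩)
    (g := g) vR uR hv (by
      intro σ hσ hag
      have hg := hσ g (mem_addG.2 (Or.inr ⟨g, by simp, Or.inl rfl⟩)) hv (RV uR)
      have e2 : col σ g.t = m + col φ d4.t := by simp only [col, g]; rw [hag _ uR, hi]; rfl
      rw [e2] at hg
      have e4 : col σ d4.t = col φ d4.t := by unfold col; rw [hag _ bR]
      have e1 : col σ d1.t = col φ d1.t := by unfold col; rw [hag _ aR]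
      have hg' : rel 1 (col σ d3.t - col φ d4.t) m = true := by
        have e : ∀ m x : Fin 5, m = (m + x) - x := by decide
        rw [e m (col φ d4.t), rel_shift]; exact hg
      have ok := norm4 (hmm (col σ d2.t - col φ d4.t) _ hg')
      rw [← e4, ← e1] at ok
      refine hm.ext4 Su (σ := σ) ?_ (by rw [k1, k2, k3, k4]; exact ok)
      intro d hd h1 h2
      rw [Finset.mem_erase] at h1 h2
      refine hσ d (mem_addG.2 (Or.inl (mem_rm.2 ⟨hd, ?_, ?_⟩))) h1.2 h2.2
      · intro h
        simp only [Finset.mem_insert, Finset.mem_singleton] at h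
        rcases h with rfl | rfl
        · exact h2.1 Su.s3
        · exact h2.1 Su.s2
      · intro h
        simp only [Finset.mem_insert, Finset.mem_singleton] at h
        rcases h with h | h
        · rw [← rev_rev d, h, rev_rev] at h1; exact h1.1 Su.s3
        · rw [← rev_rev d, h, rev_rev] at h1; exact h1.1 Su.s2)
  have rn : d3.rev ≠ d2.rev := fun h => t23 (by
    have := congrArg (fun d : Dart N => d.s.1) h; simpa using this.symm)
  have dG0 : ∀ P Q : N × Fin 5, (⟨P, Q, 0⟩ : Dart N) ∈ addG (rm D {d3.rev, d2.rev}) {g} →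
      (⟨P, Q, 0⟩ : Dart N) ∈ D := by
    intro P Q h
    rcases mem_addG.1 h with h | ⟨e, he, h⟩
    · exact (mem_rm.1 h).1
    · exfalso
      rw [Finset.mem_singleton] at he; subst he
      rcases h with h | h
      · simp only [g, Dart.mk.injEq] at h; exact absurd h.2.2 (by decide)
      · simp only [g, Dart.rev, Dart.mk.injEq] at h; exact absurd h.2.2 (by decide)
  rcases key with ⟨W, hW, hWR, hgW, h⟩ | ⟨W, hW, hWR, hgW, h⟩ |
    ⟨P, P', Q, hP, hP', hQ, hQR, d0, d1'⟩ | ⟨P, P', Q, S, hP, hP', hQ, hQR, hS, hSR, d0, d1', d2'⟩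
  · have hu' : u ∈ R ∪ W := Finset.mem_union_left _ uR
    have hv' : d3.t.1 ∈ R ∪ W := Finset.mem_union_right _ hgW
    have cg : cost g.k = 3 := rfl
    have in3 : d3.rev ∈ inn {d3.rev, d2.rev} (R ∪ W) :=
      mem_inn.2 ⟨by simp, hv', by rw [rev_t, Su.s3]; exact hu'⟩
    rcases hm.big (Finset.union_subset RV hW) (Finset.mem_union_left _ aR)
      (Finset.mem_union_left _ bR) t14 with ⟨hV, h5⟩ | ⟨-, h11⟩
    · have in2 : d2.rev ∈ inn {d3.rev, d2.rev} (R ∪ W) :=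
        mem_inn.2 ⟨by simp, by rw [hV]; exact hm.inst Su.h2, by rw [rev_t, Su.s2]; exact hu'⟩
      have := sum_cost_mono (F := {d3.rev, d2.rev}) (F' := inn {d3.rev, d2.rev} (R ∪ W)) (by
        intro d hd
        simp only [Finset.mem_insert, Finset.mem_singleton] at hd
        rcases hd with rfl | rfl
        · exact in3
        · exact in2)
      rw [Finset.sum_pair rn, rev_k, rev_k, k3, k2] at this
      omega
    · have := sum_cost_mono (F := {d3.rev}) (F' := inn {d3.rev, d2.rev} (R ∪ W)) (by
        intro d hd
        simp only [Finset.mem_singleton] at hd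
        subst hd; exact in3)
      rw [Finset.sum_singleton, rev_k, k3] at this
      omega
  · have h1 : 0 ≤ ∑ d ∈ inn {d3.rev, d2.rev} (R ∪ W), cost d.k := Finset.sum_nonneg (fun d _ => cost_nonneg _)
    have := big (R ∪ W) Finset.subset_union_left (Finset.union_subset RV hW) (by omega)
    rcases Finset.mem_union.1 this with h | h
    · exact vR h
    · exact hgW h
  · have e0 := dG0 _ _ d0
    have hQv : Q.1 ≠ d3.t.1 := fun h => v0 _ (hm.sym _ e0) h rfl
    have e1 : (⟨P', Q, 1⟩ : Dart N) ∈ D := by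
      rcases mem_addG.1 d1' with h | ⟨e, he, h⟩
      · exact (mem_rm.1 h).1
      · exfalso
        rw [Finset.mem_singleton] at he; subst he
        rcases h with h | h
        · simp only [g, Dart.mk.injEq] at h; exact vR (h.1 ▸ hP')
        · simp only [g, Dart.rev, Dart.mk.injEq] at h; exact hQv (by rw [h.2.1])
    have h3 := pot_add2 hm.sym hQR (hm.sym _ e0) rfl hP (hm.sym _ e1) rfl hP'
      (by intro h; simpa using congrArg Dart.k h)
    simp only [rev_k, cost0, cost1] at h3
    have := big (insert Q.1 R) (Finset.subset_insert _ _) (Finset.insert_subset hQ RV) (by omega)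
    rcases Finset.mem_insert.1 this with h | h
    · exact hQv h.symm
    · exact vR h
  · have e0 := dG0 _ _ d0
    have e1 := dG0 _ _ d1'
    have e2 := dG0 _ _ d2'
    have hQv : Q.1 ≠ d3.t.1 := fun h => v0 _ e1 h rfl
    have hSv : S.1 ≠ d3.t.1 := fun h => v0 _ e2 h rfl
    have hQS : Q.1 ≠ S.1 := hm.loop _ e1
    have hSR' : S.1 ∉ insert Q.1 R := by simp [hSR, hQS.symm]
    have h3 := pot_add1 hm.sym hQR (hm.sym _ e0) rfl hP
    have h4 := pot_add2 hm.sym hSR' (hm.sym _ e1) rfl (Finset.mem_insert_self _ _) e2 rfl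
      (Finset.mem_insert_of_mem hP')
      (by intro h; have := congrArg (fun d => d.t.1) h; simp at this; exact hQR (this ▸ hP'))
    simp only [rev_k, cost0, cost1] at h3 h4
    have := big (insert S.1 (insert Q.1 R)) ((Finset.subset_insert _ _).trans (Finset.subset_insert _ _))
      (Finset.insert_subset hS (Finset.insert_subset hQ RV)) (by omega)
    simp only [Finset.mem_insert] at this
    rcases this with h | h | h
    · exact hSv h.symm
    · exact hQv h.symm
    · exact vR h

theorem MC.L4g {u : N} {d1 d2 d3 d4 x y : Dart N} (U : TB D u d1 d2 d3 d4)
    (T : T111 D d3.t.1 d3.rev x y)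
    (hg : fγ (d1.s.2 - d4.s.2) (d2.s.2 - d4.s.2) (d3.s.2 - d4.s.2))
    (hf : fε (d1.s.2 - d4.s.2) (d2.s.2 - d4.s.2) (d3.s.2 - d4.s.2)) : False := by
  obtain ⟨Su, k1, k2, k3, k4⟩ := id U
  have hu : u ∈ V := Su.s1 ▸ hm.ins _ Su.h1
  have t14 := hm.tne Su.h1 Su.h4 (Su.s1.trans Su.s4.symm) Su.n14 (by rw [k4]; right; decide)
  rcases hm.gk1 (hm.erase_ss hu) (hm.mem_er Su.h1 Su.s1) (hm.mem_er Su.h4 Su.s4) t14 with ⟨σ, hσ, hr⟩ | h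
  · refine hm.ext4 Su hσ ?_
    rw [k1, k2, k3, k4]
    exact norm4 (hg _ _ _ (by rw [relz]; exact hr))
  · exact hm.L4e U T h hf

/-- a TB node with a T111 neighbour has its two 1-darts at the same position -/
theorem MC.L4d {u : N} {d1 d2 d3 d4 x y : Dart N} (U : TB D u d1 d2 d3 d4)
    (T : T111 D d3.t.1 d3.rev x y) : d3.s = d4.s := by
  by_contra hne
  have e : ∀ x y : Fin 5, x - y = 0 → x = y := by decide
  have hp : d3.s.2 - d4.s.2 ≠ 0 := fun h =>
    hne (Prod.ext (U.1.s3.trans U.1.s4.symm) (e _ _ h))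
  rcases Fd (d1.s.2 - d4.s.2) (d2.s.2 - d4.s.2) _ hp with h | h | h | h | h
  · exact hm.L4a U T h
  · exact hm.L4b U h
  · exact hm.L4b U.sw12 h
  · exact hm.L4g U T h.1 h.2
  · exact hm.L4g U.sw12 T h.1 h.2
end

end CG

namespace CG
variable {N : Type} [DecidableEq N]

/-- the number of 1-darts at a node -/
def n1 (D : Finset (Dart N)) (v : N) : ℕ := ∑ d ∈ out D v, if d.k = 1 then 1 else 0
instance (D : Finset (Dart N)) (v : N) : Decidable (Strict D v) := by unfold Strict; infer_instance
/-- the type code of a node -/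
def ty (D : Finset (Dart N)) (v : N) : ℕ :=
  if Strict D v then 0 else (out D v).card * 10 + n1 D v

section
variable {D : Finset (Dart N)} {v : N} {d1 d2 d3 d4 : Dart N}
theorem S3.ty (S : S3 D v d1 d2 d3) (h : sw d1.k + (sw d2.k + sw d3.k) ≤ 4) : ty D v = 30 +
    ((if d1.k = 1 then 1 else 0) + ((if d2.k = 1 then 1 else 0) + (if d3.k = 1 then 1 else 0))) := by
  have ns : ¬ Strict D v := by unfold Strict; rw [S.sum (fun d => sw d.k)]; omega
  have c : (CG.out D v).card = 3 := by
    rw [Finset.card_eq_sum_ones, S.sum (fun _ => 1)]; rfl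
  unfold CG.ty
  rw [if_neg ns, c, n1, S.sum (fun d => if d.k = 1 then 1 else 0)]
theorem S4.ty (S : S4 D v d1 d2 d3 d4) (h : sw d1.k + (sw d2.k + (sw d3.k + sw d4.k)) ≤ 4) :
    ty D v = 40 + ((if d1.k = 1 then 1 else 0) + ((if d2.k = 1 then 1 else 0) +
      ((if d3.k = 1 then 1 else 0) + (if d4.k = 1 then 1 else 0)))) := by
  have ns : ¬ Strict D v := by unfold Strict; rw [S.sum (fun d => sw d.k)]; omega
  have c : (CG.out D v).card = 4 := by
    rw [Finset.card_eq_sum_ones, S.sum (fun _ => 1)]; rfl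
  unfold CG.ty
  rw [if_neg ns, c, n1, S.sum (fun d => if d.k = 1 then 1 else 0)]
theorem Strict.ty (h : Strict D v) : ty D v = 0 := by unfold CG.ty; rw [if_pos h]
theorem T111.ty (T : T111 D v d1 d2 d3) : ty D v = 33 := by
  obtain ⟨S, k1, k2, k3, -⟩ := T
  rw [S.ty (by rw [k1, k2, k3]; decide), k1, k2, k3]; rfl
theorem TA.ty (T : TA D v d1 d2 d3) : ty D v = 32 := by
  obtain ⟨S, k1, k2, k3⟩ := T
  rw [S.ty (by rw [k1, k2, k3]; decide), k1, k2, k3]; rfl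
theorem T2221.ty (T : T2221 D v d1 d2 d3 d4) : ty D v = 41 := by
  obtain ⟨S, k1, k2, k3, k4, -⟩ := T
  rw [S.ty (by rw [k1, k2, k3, k4]; decide), k1, k2, k3, k4]; rfl
theorem TB.ty (T : TB D v d1 d2 d3 d4) : ty D v = 42 := by
  obtain ⟨S, k1, k2, k3, k4⟩ := T
  rw [S.ty (by rw [k1, k2, k3, k4]; decide), k1, k2, k3, k4]; rfl
theorem TC.ty (T : TC D v d1 d2 d3 d4) : ty D v = 43 := by
  obtain ⟨S, k1, k2, k3, k4⟩ := T
  rw [S.ty (by rw [k1, k2, k3, k4]; decide), k1, k2, k3, k4]; rfl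
theorem TD.ty (T : TD D v d1 d2 d3 d4) : ty D v = 44 := by
  obtain ⟨S, k1, k2, k3, k4⟩ := T
  rw [S.ty (by rw [k1, k2, k3, k4]; decide), k1, k2, k3, k4]; rfl

theorem TB.sw34 (T : TB D v d1 d2 d3 d4) : TB D v d1 d2 d4 d3 := by
  obtain ⟨S, k1, k2, k3, k4⟩ := T
  exact ⟨S.sw34, k1, k2, k4, k3⟩
theorem TD.sw12 (T : TD D v d1 d2 d3 d4) : TD D v d2 d1 d3 d4 := by
  obtain ⟨S, k1, k2, k3, k4⟩ := T
  exact ⟨S.sw12, k2, k1, k3, k4⟩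
theorem TD.sw23 (T : TD D v d1 d2 d3 d4) : TD D v d1 d3 d2 d4 := by
  obtain ⟨S, k1, k2, k3, k4⟩ := T
  exact ⟨S.sw23, k1, k3, k2, k4⟩
theorem TD.sw34 (T : TD D v d1 d2 d3 d4) : TD D v d1 d2 d4 d3 := by
  obtain ⟨S, k1, k2, k3, k4⟩ := T
  exact ⟨S.sw34, k1, k2, k4, k3⟩
end

/-- v has a 1-neighbour with type code a -/
def hasT (D : Finset (Dart N)) (a : ℕ) (v : N) : Prop := ∃ e ∈ D, e.s.1 = v ∧ e.k = 1 ∧ ty D e.t.1 = a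

open Classical in
/-- the discharging rule -/
noncomputable def gv (D : Finset (Dart N)) (d : Dart N) : ℤ :=
  if d.k ≠ 1 then 0
  else if ty D d.s.1 = 33 then
    (if ty D d.t.1 = 0 then 2 else if ty D d.t.1 = 43 ∨ ty D d.t.1 = 44 then 1 else
      if ty D d.t.1 = 42 ∧ hasT D 0 d.t.1 then 2 else 0)
  else if ty D d.s.1 = 41 then (if ty D d.t.1 = 0 ∨ ty D d.t.1 = 44 then 2 else 0)
  else if ty D d.s.1 = 42 ∧ ty D d.t.1 = 0 ∧ hasT D 33 d.s.1 then 2 else 0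

theorem gv_nonneg (D : Finset (Dart N)) (d : Dart N) : 0 ≤ gv D d := by
  unfold gv; split_ifs <;> norm_num
theorem gv_le (D : Finset (Dart N)) (d : Dart N) : gv D d ≤ 2 := by
  unfold gv; split_ifs <;> norm_num
theorem gv_k {D : Finset (Dart N)} {d : Dart N} (h : d.k ≠ 1) : gv D d = 0 := by
  unfold gv; rw [if_pos h]

section
variable {D : Finset (Dart N)} {V : Finset N} (hm : MC D V)
include hm

theorem MC.t111 {v} (hv : v ∈ V) (h : ty D v = 33) : ∃ d1 d2 d3, T111 D v d1 d2 d3 := by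
  rcases hm.classify hv with T | T | ⟨_, _, _, T⟩ | ⟨_, _, _, _, T⟩ | ⟨_, _, _, _, T⟩ | ⟨_, _, _, _, T⟩ | ⟨_, _, _, _, T⟩
  · rw [T.ty] at h; omega
  · exact T
  all_goals rw [T.ty] at h; omega

theorem MC.t2221 {v} (hv : v ∈ V) (h : ty D v = 41) : ∃ d1 d2 d3 d4, T2221 D v d1 d2 d3 d4 := by
  rcases hm.classify hv with T | ⟨_, _, _, T⟩ | ⟨_, _, _, T⟩ | T | ⟨_, _, _, _, T⟩ | ⟨_, _, _, _, T⟩ | ⟨_, _, _, _, T⟩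
  · rw [T.ty] at h; omega
  · rw [T.ty] at h; omega
  · rw [T.ty] at h; omega
  · exact T
  all_goals rw [T.ty] at h; omega

omit hm in
theorem T2221.rot {v} {d1 d2 d3 d4 d : Dart N} (T : T2221 D v d1 d2 d3 d4) (hd : d ∈ D)
    (hs : d.s.1 = v) (hk : d.k = 1) : T2221 D v d1 d2 d3 d := by
  obtain ⟨S, k1, k2, k3, k4, q⟩ := id T
  rcases S.all d hd hs with rfl | rfl | rfl | rfl
  · rw [hk] at k1; exact absurd k1 (by decide)
  · rw [hk] at k2; exact absurd k2 (by decide)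
  · rw [hk] at k3; exact absurd k3 (by decide)
  · exact T

/-- a node with a 0-dart is strict or of type A -/
theorem MC.zeroT {v} {d : Dart N} (hd : d ∈ D) (hs : d.s.1 = v) (hk : d.k = 0) :
    Strict D v ∨ ∃ d1 d2 d3, TA D v d1 d2 d3 := by
  have hv : v ∈ V := hs ▸ hm.ins _ hd
  rcases hm.classify hv with T | ⟨_, _, _, S, k1, k2, k3, -⟩ | T | ⟨_, _, _, _, S, k1, k2, k3, k4, -⟩ | ⟨_, _, _, _, S, k1, k2, k3, k4⟩ | ⟨_, _, _, _, S, k1, k2, k3, k4⟩ | ⟨_, _, _, _, S, k1, k2, k3, k4⟩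
  · exact Or.inl T
  · exfalso
    rcases S.all d hd hs with rfl | rfl | rfl <;> simp_all
  · exact Or.inr T
  all_goals
    exfalso
    rcases S.all d hd hs with rfl | rfl | rfl | rfl <;> simp_all

/-- what a 111-node gives along a dart -/
theorem MC.give {v} {d a b : Dart N} (T : T111 D v d a b) : 1 ≤ gv D d ∨
    ∃ e2 e3 k, Sp D d.t.1 d.rev e2 e3 k := by
  obtain ⟨Sv, k1, -⟩ := id T
  have hs : ty D d.s.1 = 33 := by rw [Sv.s1]; exact T.ty
  have hr : d.rev ∈ D := hm.sym _ Sv.h1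
  have hg : gv D d = (by classical exact
    (if ty D d.t.1 = 0 then 2 else if ty D d.t.1 = 43 ∨ ty D d.t.1 = 44 then 1 else
      if ty D d.t.1 = 42 ∧ hasT D 0 d.t.1 then 2 else 0)) := by
    unfold gv
    rw [if_neg (by simpa using k1), if_pos hs]
  rcases hm.classify (hm.inst Sv.h1) with T' | ⟨_, _, _, T'⟩ | ⟨_, _, _, T'⟩ | ⟨_, _, _, _, T'⟩ | ⟨e1, e2, e3, e4, T'⟩ | ⟨_, _, _, _, T'⟩ | ⟨_, _, _, _, T'⟩
  · left; rw [hg, if_pos T'.ty]; norm_num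
  · right
    obtain ⟨x, y, T2⟩ := T'.rot hr rfl
    exact ⟨_, _, _, T2.sp⟩
  · right
    obtain ⟨x, y, T2⟩ := TA.rot hm T' hr rfl k1
    obtain ⟨k, S⟩ := T2.sp
    exact ⟨_, _, _, S⟩
  · exfalso
    have T2 := T'.rot hr rfl k1
    have hv : d.rev.t.1 = v := Sv.s1
    rcases hm.L2 T2 with h | ⟨_, _, _, _, h⟩
    · have := h.ty; rw [hv, T.ty] at this; omega
    · have := h.ty; rw [hv, T.ty] at this; omega
  · left
    have U : ∃ f, TB D d.t.1 e1 e2 d.rev f := by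
      rcases T'.1.all _ hr rfl with h | h | h | h
      · have := T'.2.1; rw [← h, rev_k, k1] at this; exact absurd this (by decide)
      · have := T'.2.2.1; rw [← h, rev_k, k1] at this; exact absurd this (by decide)
      · exact ⟨e4, h ▸ T'⟩
      · exact ⟨e3, h ▸ T'.sw34⟩
    obtain ⟨f, U⟩ := U
    have T2 : T111 D d.rev.t.1 d.rev.rev a b := by rw [rev_rev, rev_t, Sv.s1]; exact T
    have hp := hm.L4d U T2
    obtain ⟨z, hz, zs, zk⟩ := hm.L4s U hp T2
    have kf : f.k = 1 := U.2.2.2.2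
    have : hasT D 0 d.t.1 := by
      rcases hm.zeroT hz zs zk with h | ⟨_, _, _, h⟩
      · exact ⟨f, U.1.h4, U.1.s4, kf, h.ty⟩
      · exfalso
        obtain ⟨x, y, T3⟩ := TA.rot hm h (hm.sym _ U.1.h4) rfl kf
        obtain ⟨k, S⟩ := T3.sp
        exact hm.L5 U hp T2 S
    rw [hg, if_neg (by rw [U.ty]; decide), if_neg (by rw [U.ty]; decide), if_pos ⟨U.ty, this⟩]
    norm_num
  · left; rw [hg, if_neg (by rw [T'.ty]; decide), if_pos (by rw [T'.ty]; decide)]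
  · left; rw [hg, if_neg (by rw [T'.ty]; decide), if_pos (by rw [T'.ty]; decide)]

omit hm in
/-- nodes with codes 33, 32, 41 receive nothing -/
theorem gv_in0 {d : Dart N} (h : ty D d.t.1 = 33 ∨ ty D d.t.1 = 32 ∨ ty D d.t.1 = 41) : gv D d = 0 := by
  unfold gv
  rcases h with h | h | h <;> rw [h] <;> simp

theorem MC.fin111 {v} {d1 d2 d3 : Dart N} (T : T111 D v d1 d2 d3) :
    2 ≤ gv D d1 + (gv D d2 + gv D d3) := by
  have hv : v ∈ V := T.1.s1 ▸ hm.ins _ T.1.h1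
  have p1 := gv_nonneg D d1
  have p2 := gv_nonneg D d2
  have p3 := gv_nonneg D d3
  have c1 := hm.give T
  have c2 := hm.give T.sw12
  have c3 := hm.give T.sw13
  rcases c1 with c1 | ⟨_, _, _, S1⟩
  · rcases c2 with c2 | ⟨_, _, _, S2⟩
    · omega
    · rcases c3 with c3 | ⟨_, _, _, S3⟩
      · omega
      · exact (hm.L3 hv T.sw12.sw23 S2 S3 rfl rfl T.1.s2 T.1.s3).elim
  · rcases c2 with c2 | ⟨_, _, _, S2⟩
    · rcases c3 with c3 | ⟨_, _, _, S3⟩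
      · omega
      · exact (hm.L3 hv T.sw23 S1 S3 rfl rfl T.1.s1 T.1.s3).elim
    · exact (hm.L3 hv T S1 S2 rfl rfl T.1.s1 T.1.s2).elim

theorem MC.fin2221 {v} {d1 d2 d3 d4 : Dart N} (T : T2221 D v d1 d2 d3 d4) : gv D d4 = 2 := by
  obtain ⟨S, k1, k2, k3, k4, -⟩ := id T
  have hs : ty D d4.s.1 = 41 := by rw [S.s4]; exact T.ty
  unfold gv
  rw [if_neg (by simpa using k4), if_neg (by rw [hs]; decide), if_pos hs]
  rcases hm.L2 T with h | ⟨_, _, _, _, h⟩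
  · rw [if_pos (Or.inl h.ty)]
  · rw [if_pos (Or.inr h.ty)]

omit hm in
theorem gv42 {d : Dart N} (hk : d.k = 1) (h : ty D d.t.1 = 42) :
    gv D d = 0 ∨ (ty D d.s.1 = 33 ∧ hasT D 0 d.t.1) := by
  by_cases h3 : ty D d.s.1 = 33 ∧ hasT D 0 d.t.1
  · exact Or.inr h3
  · left
    unfold gv
    rw [h]
    simp
    tauto

theorem MC.finB1 {v} {d1 d2 d3 d4 : Dart N} (T : TB D v d1 d2 d3 d4) (h : ty D d3.t.1 = 33)
    (h0 : hasT D 0 v) : gv D d4.rev = 0 ∧ gv D d4 = 2 := by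
  obtain ⟨S, k1, k2, k3, k4⟩ := id T
  obtain ⟨e, he, es, ek, et⟩ := h0
  have e4 : ty D d4.t.1 = 0 := by
    rcases S.all e he es with rfl | rfl | rfl | rfl
    · rw [k1] at ek; exact absurd ek (by decide)
    · rw [k2] at ek; exact absurd ek (by decide)
    · omega
    · exact et
  have tv : ty D v = 42 := T.ty
  constructor
  · rcases gv42 (D := D) (d := d4.rev) k4 (by rw [rev_t, S.s4]; exact tv) with h | h
    · exact h
    · rw [rev_s] at h; omega
  · have : hasT D 33 v := ⟨d3, S.h3, S.s3, k3, h⟩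
    unfold gv
    rw [S.s4, tv, e4]
    simp [k4, this]

theorem MC.finB {v} {d1 d2 d3 d4 : Dart N} (T : TB D v d1 d2 d3 d4) :
    gv D d3.rev + gv D d4.rev ≤ gv D d3 + gv D d4 := by
  obtain ⟨S, k1, k2, k3, k4⟩ := id T
  have p3 := gv_nonneg D d3
  have p4 := gv_nonneg D d4
  have q3 := gv_le D d3.rev
  have q4 := gv_le D d4.rev
  have tv : ty D v = 42 := T.ty
  rcases gv42 (D := D) (d := d3.rev) k3 (by rw [rev_t, S.s3]; exact tv) with h | ⟨h, h'⟩
  · rcases gv42 (D := D) (d := d4.rev) k4 (by rw [rev_t, S.s4]; exact tv) with h | ⟨h, h'⟩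
    · omega
    · rw [rev_t, S.s4] at h'
      have := hm.finB1 T.sw34 h h'
      omega
  · rw [rev_t, S.s3] at h'
    have := hm.finB1 T h h'
    omega

omit hm in
theorem gv43 {d : Dart N} (hk : d.k = 1) (h : ty D d.t.1 = 43) :
    gv D d = 0 ∨ (gv D d = 1 ∧ ty D d.s.1 = 33) := by
  by_cases h3 : ty D d.s.1 = 33
  · right; refine ⟨?_, h3⟩
    unfold gv; rw [h, h3]; simp [hk]
  · left; unfold gv; rw [h]; simp [h3]
omit hm in
theorem gv44 {d : Dart N} (hk : d.k = 1) (h : ty D d.t.1 = 44) :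
    gv D d = 0 ∨ (gv D d = 1 ∧ ty D d.s.1 = 33) ∨ (gv D d = 2 ∧ ty D d.s.1 = 41) := by
  by_cases h3 : ty D d.s.1 = 33
  · right; left; refine ⟨?_, h3⟩
    unfold gv; rw [h, h3]; simp [hk]
  · by_cases h4 : ty D d.s.1 = 41
    · right; right; refine ⟨?_, h4⟩
      unfold gv; rw [h, h4]; simp [hk]
    · left; unfold gv; rw [h]; simp [h3, h4]

/-- the T111 structure at the far end of a 1-dart -/
theorem MC.far111 {d : Dart N} (hd : d ∈ D) (h : ty D d.t.1 = 33) : ∃ a b, T111 D d.t.1 d.rev a b := by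
  obtain ⟨_, _, _, T⟩ := hm.t111 (hm.inst hd) h
  exact T.rot (hm.sym _ hd) rfl
theorem MC.far2221 {d : Dart N} (hd : d ∈ D) (hk : d.k = 1) (h : ty D d.t.1 = 41) :
    ∃ a b c, T2221 D d.t.1 a b c d.rev := by
  obtain ⟨a, b, c, _, T⟩ := hm.t2221 (hm.inst hd) h
  exact ⟨a, b, c, T.rot (hm.sym _ hd) rfl hk⟩

theorem MC.finC {v} {d1 d2 d3 d4 : Dart N} (T : TC D v d1 d2 d3 d4) :
    gv D d2.rev + (gv D d3.rev + gv D d4.rev) ≤ 2 := by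
  obtain ⟨S, k1, k2, k3, k4⟩ := id T
  have tv : ty D v = 43 := T.ty
  have g2 := gv43 (D := D) (d := d2.rev) k2 (by rw [rev_t, S.s2]; exact tv)
  have g3 := gv43 (D := D) (d := d3.rev) k3 (by rw [rev_t, S.s3]; exact tv)
  have g4 := gv43 (D := D) (d := d4.rev) k4 (by rw [rev_t, S.s4]; exact tv)
  rcases g2 with g2 | ⟨g2, h2⟩
  · omega
  rcases g3 with g3 | ⟨g3, h3⟩
  · omega
  rcases g4 with g4 | ⟨g4, h4⟩
  · omega
  obtain ⟨_, _, T2⟩ := hm.far111 S.h2 h2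
  obtain ⟨_, _, T3⟩ := hm.far111 S.h3 h3
  obtain ⟨_, _, T4⟩ := hm.far111 S.h4 h4
  exact (hm.L7 T T2 T3 T4).elim

theorem MC.finD1 {v} {d1 d2 d3 d4 f f' : Dart N} (T : TD D v d1 d2 d3 d4) (hf : f ∈ D) (hf' : f' ∈ D)
    (fs : f.s.1 = v) (fs' : f'.s.1 = v) (fk : f.k = 1) (hne : f ≠ f') (h : ty D f.t.1 = 41)
    (h' : ty D f'.t.1 = 33) : False := by
  obtain ⟨_, _, _, T2⟩ := hm.far2221 hf fk h
  obtain ⟨_, _, T3⟩ := hm.far111 hf' h'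
  obtain ⟨e, he, ek, -, et⟩ := hm.L2c T2 T fs hf' fs' (by rw [rev_rev]; exact hne.symm)
  obtain ⟨S, k1, k2, k3, -⟩ := T3
  rcases S.all e.rev (hm.sym _ he) et with h | h | h
  · rw [← h, rev_k, ek] at k1; exact absurd k1 (by decide)
  · rw [← h, rev_k, ek] at k2; exact absurd k2 (by decide)
  · rw [← h, rev_k, ek] at k3; exact absurd k3 (by decide)

theorem MC.finD2 {v} {d1 d2 d3 d4 : Dart N} (T : TD D v d1 d2 d3 d4) (h1 : ty D d1.t.1 = 41)
    (h2 : ty D d2.t.1 = 41) (h3 : ty D d3.t.1 = 41) : False := by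
  obtain ⟨S, k1, k2, k3, k4⟩ := id T
  obtain ⟨_, _, _, T1⟩ := hm.far2221 S.h1 k1 h1
  obtain ⟨_, _, _, T2⟩ := hm.far2221 S.h2 k2 h2
  obtain ⟨_, _, _, T3⟩ := hm.far2221 S.h3 k3 h3
  exact hm.L2d T T1 T2 T3

omit hm in
theorem numD {a b c d A B C E : ℤ} {ta tb tc td : ℕ}
    (ha : a = 0 ∨ (a = 1 ∧ ta = 33) ∨ (a = 2 ∧ ta = 41))
    (hb : b = 0 ∨ (b = 1 ∧ tb = 33) ∨ (b = 2 ∧ tb = 41))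
    (hc : c = 0 ∨ (c = 1 ∧ tc = 33) ∨ (c = 2 ∧ tc = 41))
    (hd : d = 0 ∨ (d = 1 ∧ td = 33) ∨ (d = 2 ∧ td = 41))
    (ab : ¬ (ta = 41 ∧ tb = 33)) (ac : ¬ (ta = 41 ∧ tc = 33)) (ad : ¬ (ta = 41 ∧ td = 33))
    (ba : ¬ (tb = 41 ∧ ta = 33)) (bc : ¬ (tb = 41 ∧ tc = 33)) (bd : ¬ (tb = 41 ∧ td = 33))
    (ca : ¬ (tc = 41 ∧ ta = 33)) (cb : ¬ (tc = 41 ∧ tb = 33)) (cd : ¬ (tc = 41 ∧ td = 33))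
    (da : ¬ (td = 41 ∧ ta = 33)) (db : ¬ (td = 41 ∧ tb = 33)) (dc : ¬ (td = 41 ∧ tc = 33))
    (x1 : ¬ (ta = 41 ∧ tb = 41 ∧ tc = 41)) (x2 : ¬ (ta = 41 ∧ tb = 41 ∧ td = 41))
    (x3 : ¬ (ta = 41 ∧ tc = 41 ∧ td = 41)) (x4 : ¬ (tb = 41 ∧ tc = 41 ∧ td = 41)) :
    a + (b + (c + d)) ≤ 4 := by
  rcases ha with ha | ⟨ha, ha'⟩ | ⟨ha, ha'⟩ <;> rcases hb with hb | ⟨hb, hb'⟩ | ⟨hb, hb'⟩ <;>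
  rcases hc with hc | ⟨hc, hc'⟩ | ⟨hc, hc'⟩ <;> rcases hd with hd | ⟨hd, hd'⟩ | ⟨hd, hd'⟩ <;> omega

theorem MC.finD {v} {d1 d2 d3 d4 : Dart N} (T : TD D v d1 d2 d3 d4) :
    gv D d1.rev + (gv D d2.rev + (gv D d3.rev + gv D d4.rev)) ≤ 4 := by
  obtain ⟨S, k1, k2, k3, k4⟩ := id T
  have tv : ty D v = 44 := T.ty
  have g1 := gv44 (D := D) (d := d1.rev) k1 (by rw [rev_t, S.s1]; exact tv)
  have g2 := gv44 (D := D) (d := d2.rev) k2 (by rw [rev_t, S.s2]; exact tv)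
  have g3 := gv44 (D := D) (d := d3.rev) k3 (by rw [rev_t, S.s3]; exact tv)
  have g4 := gv44 (D := D) (d := d4.rev) k4 (by rw [rev_t, S.s4]; exact tv)
  rw [rev_s] at g1 g2 g3 g4
  refine numD (A := 0) (B := 0) (C := 0) (E := 0) g1 g2 g3 g4
    (fun h => hm.finD1 T S.h1 S.h2 S.s1 S.s2 k1 S.n12 h.1 h.2)
    (fun h => hm.finD1 T S.h1 S.h3 S.s1 S.s3 k1 S.n13 h.1 h.2)
    (fun h => hm.finD1 T S.h1 S.h4 S.s1 S.s4 k1 S.n14 h.1 h.2)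
    (fun h => hm.finD1 T S.h2 S.h1 S.s2 S.s1 k2 S.n12.symm h.1 h.2)
    (fun h => hm.finD1 T S.h2 S.h3 S.s2 S.s3 k2 S.n23 h.1 h.2)
    (fun h => hm.finD1 T S.h2 S.h4 S.s2 S.s4 k2 S.n24 h.1 h.2)
    (fun h => hm.finD1 T S.h3 S.h1 S.s3 S.s1 k3 S.n13.symm h.1 h.2)
    (fun h => hm.finD1 T S.h3 S.h2 S.s3 S.s2 k3 S.n23.symm h.1 h.2)
    (fun h => hm.finD1 T S.h3 S.h4 S.s3 S.s4 k3 S.n34 h.1 h.2)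
    (fun h => hm.finD1 T S.h4 S.h1 S.s4 S.s1 k4 S.n14.symm h.1 h.2)
    (fun h => hm.finD1 T S.h4 S.h2 S.s4 S.s2 k4 S.n24.symm h.1 h.2)
    (fun h => hm.finD1 T S.h4 S.h3 S.s4 S.s3 k4 S.n34.symm h.1 h.2)
    (fun h => hm.finD2 T h.1 h.2.1 h.2.2)
    (fun h => hm.finD2 T.sw34 h.1 h.2.1 h.2.2)
    (fun h => hm.finD2 T.sw23.sw34 h.1 h.2.1 h.2.2)
    (fun h => hm.finD2 T.sw12.sw23.sw34 h.1 h.2.1 h.2.2)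

omit hm in
theorem sw_cost : ∀ k : Fin 3, (k ≠ 1 → 2 * sw k ≤ cost k) ∧ (k = 1 → 2 * sw k + 1 ≤ cost k) := by
  decide

/-- the final charge of each node is nonpositive -/
theorem MC.charge {v} (hv : v ∈ V) :
    20 + ∑ d ∈ out D v, (gv D d.rev - gv D d - 2 * cost d.k) ≤ 0 := by
  have c0 : cost 0 = 4 := rfl
  have c1 : cost 1 = 3 := rfl
  have c2 : cost 2 = 2 := rfl
  have one : (1 : Fin 3) ≠ 0 := by decide
  have two : (2 : Fin 3) ≠ 1 := by decide
  rcases hm.classify hv with T | ⟨d1, d2, d3, T⟩ | ⟨d1, d2, d3, T⟩ | ⟨d1, d2, d3, d4, T⟩ | ⟨d1, d2, d3, d4, T⟩ | ⟨d1, d2, d3, d4, T⟩ | ⟨d1, d2, d3, d4, T⟩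
  · have : ∑ d ∈ out D v, (gv D d.rev - gv D d - 2 * cost d.k) ≤ ∑ d ∈ out D v, (-4) * sw d.k := by
      apply Finset.sum_le_sum
      intro d hd
      have h1 := gv_nonneg D d
      have h2 := gv_le D d.rev
      have h3 := sw_cost d.k
      by_cases hk : d.k = 1
      · have := h3.2 hk; omega
      · have := h3.1 hk
        have := gv_k (D := D) (d := d.rev) hk
        omega
    rw [← Finset.mul_sum] at this
    unfold Strict at T
    omega
  · obtain ⟨S, k1, k2, k3, -⟩ := id T
    have h1 := gv_in0 (D := D) (d := d1.rev) (by rw [rev_t, S.s1]; exact Or.inl T.ty)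
    have h2 := gv_in0 (D := D) (d := d2.rev) (by rw [rev_t, S.s2]; exact Or.inl T.ty)
    have h3 := gv_in0 (D := D) (d := d3.rev) (by rw [rev_t, S.s3]; exact Or.inl T.ty)
    have := hm.fin111 T
    rw [S.sum (fun d => gv D d.rev - gv D d - 2 * cost d.k), k1, k2, k3]
    omega
  · obtain ⟨S, k1, k2, k3⟩ := id T
    have h1 := gv_in0 (D := D) (d := d1.rev) (by rw [rev_t, S.s1]; exact Or.inr (Or.inl T.ty))
    have h2 := gv_in0 (D := D) (d := d2.rev) (by rw [rev_t, S.s2]; exact Or.inr (Or.inl T.ty))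
    have h3 := gv_in0 (D := D) (d := d3.rev) (by rw [rev_t, S.s3]; exact Or.inr (Or.inl T.ty))
    have p1 := gv_nonneg D d1
    have p2 := gv_nonneg D d2
    have p3 := gv_nonneg D d3
    rw [S.sum (fun d => gv D d.rev - gv D d - 2 * cost d.k), k1, k2, k3]
    omega
  · obtain ⟨S, k1, k2, k3, k4, -⟩ := id T
    have h1 := gv_k (D := D) (d := d1.rev) (by rw [rev_k, k1]; exact two)
    have h2 := gv_k (D := D) (d := d2.rev) (by rw [rev_k, k2]; exact two)
    have h3 := gv_k (D := D) (d := d3.rev) (by rw [rev_k, k3]; exact two)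
    have h4 := gv_in0 (D := D) (d := d4.rev) (by rw [rev_t, S.s4]; exact Or.inr (Or.inr T.ty))
    have p1 := gv_nonneg D d1
    have p2 := gv_nonneg D d2
    have p3 := gv_nonneg D d3
    have := hm.fin2221 T
    rw [S.sum (fun d => gv D d.rev - gv D d - 2 * cost d.k), k1, k2, k3, k4]
    omega
  · obtain ⟨S, k1, k2, k3, k4⟩ := id T
    have h1 := gv_k (D := D) (d := d1.rev) (by rw [rev_k, k1]; exact two)
    have h2 := gv_k (D := D) (d := d2.rev) (by rw [rev_k, k2]; exact two)
    have p1 := gv_nonneg D d1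
    have p2 := gv_nonneg D d2
    have := hm.finB T
    rw [S.sum (fun d => gv D d.rev - gv D d - 2 * cost d.k), k1, k2, k3, k4]
    omega
  · obtain ⟨S, k1, k2, k3, k4⟩ := id T
    have h1 := gv_k (D := D) (d := d1.rev) (by rw [rev_k, k1]; exact two)
    have p1 := gv_nonneg D d1
    have p2 := gv_nonneg D d2
    have p3 := gv_nonneg D d3
    have p4 := gv_nonneg D d4
    have := hm.finC T
    rw [S.sum (fun d => gv D d.rev - gv D d - 2 * cost d.k), k1, k2, k3, k4]
    omega
  · obtain ⟨S, k1, k2, k3, k4⟩ := id T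
    have p1 := gv_nonneg D d1
    have p2 := gv_nonneg D d2
    have p3 := gv_nonneg D d3
    have p4 := gv_nonneg D d4
    have := hm.finD T
    rw [S.sum (fun d => gv D d.rev - gv D d - 2 * cost d.k), k1, k2, k3, k4]
    omega

/-- there is no minimal counterexample -/
theorem MC.false : False := by
  have h1 : ∑ v ∈ V, (20 + ∑ d ∈ out D v, (gv D d.rev - gv D d - 2 * cost d.k)) ≤ 0 :=
    Finset.sum_nonpos (fun v hv => hm.charge hv)
  have h2 : ∑ v ∈ V, ∑ d ∈ out D v, (gv D d.rev - gv D d - 2 * cost d.k) =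
      ∑ d ∈ D, (gv D d.rev - gv D d - 2 * cost d.k) := by
    unfold out
    exact Finset.sum_fiberwise_of_maps_to (fun d hd => hm.ins d hd) _
  have h3 : ∑ d ∈ D, gv D d.rev = ∑ d ∈ D, gv D d :=
    Finset.sum_bij' (fun d _ => d.rev) (fun d _ => d.rev) (fun d hd => hm.sym d hd)
      (fun d hd => hm.sym d hd) (fun d _ => rev_rev d) (fun d _ => rev_rev d) (fun d _ => rfl)
  rw [Finset.sum_add_distrib, h2, Finset.sum_sub_distrib, Finset.sum_sub_distrib, h3,
    ← Finset.mul_sum] at h1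
  have h4 : inn D V = D := by
    ext d; rw [mem_inn]
    exact ⟨fun h => h.1, fun h => ⟨h, hm.ins d h, hm.inst h⟩⟩
  have h5 := hm.potV
  unfold pot at h5
  rw [h4] at h5
  simp at h1
  omega
end

end CG

namespace CG
variable {N : Type} [DecidableEq N]

theorem HasTri.mono {D D' : Finset (Dart N)} {A A' : Finset N} (h : HasTri D A)
    (hD : D ⊆ D') (hA : A ⊆ A') : HasTri D' A' := by
  rcases h with ⟨P, Q, h1, h2, h3, h4⟩ | ⟨P, Q, S, h1, h2, h3, h4, h5, h6⟩
  · exact Or.inl ⟨P, Q, hA h1, hA h2, hD h3, hD h4⟩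
  · exact Or.inr ⟨P, Q, S, hA h1, hA h2, hA h3, hD h4, hD h5, hD h6⟩

theorem inn_inn {D : Finset (Dart N)} {A B : Finset N} (h : B ⊆ A) : inn (inn D A) B = inn D B := by
  ext d
  simp only [mem_inn]
  constructor
  · rintro ⟨⟨a, _⟩, b⟩; exact ⟨a, b⟩
  · rintro ⟨a, b, c⟩; exact ⟨⟨a, h b, h c⟩, b, c⟩

/-- The cell theorem. -/
theorem cell_theorem (n : ℕ) : IH N n := by
  induction n with
  | zero => intro D V _ _ h; omega
  | succ n ihn =>
    intro D V hs hl hc hn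
    by_contra! hcon
    obtain ⟨hB, hT⟩ := hcon
    have ih : IH N V.card := fun D' V' a b c d => ihn D' V' a b (by omega) d
    have hsub : ∀ B, B ⊂ V → Col D B := by
      intro B hBV
      by_contra hnB
      rcases ih D B hs hl (Finset.card_lt_card hBV) hnB with ⟨B', h1, h2, h3⟩ | h
      · have := hB B' (h1.trans hBV.1) h2
        omega
      · exact hT (h.mono (Finset.Subset.refl _) hBV.1)
    have hsD : inn D V ⊆ D := fun d hd => (mem_inn.1 hd).1
    have hm : MC (inn D V) V := by
      refine ⟨?_, ?_, ?_, ?_, ?_, ?_, ?_, ih⟩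
      · intro d hd
        rw [mem_inn] at hd ⊢
        exact ⟨hs d hd.1, hd.2.2, hd.2.1⟩
      · exact fun d hd => hl d (hsD hd)
      · exact fun d hd => (mem_inn.1 hd).2.1
      · rintro ⟨σ, hσ⟩
        exact hn ⟨σ, hσ.congr (by rw [inn_inn (Finset.Subset.refl _)])⟩
      · have := hB V (Finset.Subset.refl _) hn
        unfold pot at this ⊢
        rw [inn_inn (Finset.Subset.refl _)]
        omega
      · intro B hBV
        obtain ⟨σ, hσ⟩ := hsub B hBV
        exact ⟨σ, hσ.mono hsD (Finset.Subset.refl _)⟩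
      · exact fun h => hT (h.mono hsD (Finset.Subset.refl _))
    exact hm.false

theorem c5_of_rel : ∀ x y : Fin 5, rel 0 x y = true →
    (SimpleGraph.cycleGraph 5).Adj (2 * x) (2 * y) := by decide
theorem rel_of_c5 : ∀ x y : Fin 5, (SimpleGraph.cycleGraph 5).Adj x y →
    rel 0 (2 * x) (2 * y) = true := by decide
theorem val_zero (g : St) : val g 0 = g.1 := by unfold val; split <;> simp

end CG

namespace CG

theorem crit_colour {V : Type} {G : SimpleGraph V} (hcrit : Critical52 G) {S : Set V}
    (hS : S ≠ Set.univ) : ∃ c : V → Fin 5, ∀ u ∈ S, ∀ v ∈ S, G.Adj u v →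
      (SimpleGraph.cycleGraph 5).Adj (c u) (c v) := by
  classical
  obtain ⟨f⟩ := hcrit.2 ((⊤ : G.Subgraph).induce S) (by
    intro h
    apply hS
    have := congrArg SimpleGraph.Subgraph.verts h
    simpa using this)
  refine ⟨fun v => if h : v ∈ S then f ⟨v, h⟩ else 0, fun u hu v hv huv => ?_⟩
  simp only [hu, hv, dif_pos]
  apply f.map_adj
  simp [hu, hv, huv]

/-- The darts of a graph. -/
def gd {V : Type} (p : V × V) : Dart V := ⟨(p.1, 0), (p.2, 0), 0⟩

theorem gd_inj {V : Type} : Function.Injective (gd : V × V → Dart V) := by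
  rintro ⟨a, b⟩ ⟨c, d⟩ h
  simp only [gd, Dart.mk.injEq, Prod.mk.injEq] at h
  simp [h.1.1, h.2.1.1]

end CG

/-- Every 5/2-critical graph not isomorphic to `C₃`
satisfies `5 n(G) - 4 e(G) ≤ 2`. -/
theorem critical52_potential_le_two {V : Type} [Fintype V] (G : SimpleGraph V)
    (hcrit : Critical52 G) (hC3 : IsEmpty (G ≃g cycleGraph 3)) :
    5 * (Fintype.card V : ℤ) - 4 * (G.edgeSet.ncard : ℤ) ≤ 2 := by
  classical
  set E : Finset (V × V) := Finset.univ.filter (fun p => G.Adj p.1 p.2) with hE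
  set D : Finset (CG.Dart V) := E.image CG.gd with hD
  have memD : ∀ d, d ∈ D ↔ ∃ u v, G.Adj u v ∧ d = ⟨(u, 0), (v, 0), 0⟩ := by
    intro d
    simp only [hD, hE, Finset.mem_image, Finset.mem_filter, Finset.mem_univ, true_and, Prod.exists,
      CG.gd]
    constructor
    · rintro ⟨a, b, h, rfl⟩; exact ⟨a, b, h, rfl⟩
    · rintro ⟨a, b, h, rfl⟩; exact ⟨a, b, h, rfl⟩
  have hs : CG.Sym D := by
    intro d hd
    obtain ⟨u, v, h, rfl⟩ := (memD d).1 hd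
    exact (memD _).2 ⟨v, u, h.symm, rfl⟩
  have hl : CG.Loopless D := by
    intro d hd
    obtain ⟨u, v, h, rfl⟩ := (memD d).1 hd
    exact h.ne
  have hn : ¬ CG.Col D Finset.univ := by
    rintro ⟨σ, hσ⟩
    refine hcrit.1.false ⟨fun v => 2 * (σ v).1, fun {a b} hab => ?_⟩
    have := hσ _ ((memD _).2 ⟨a, b, hab, rfl⟩) (Finset.mem_univ _) (Finset.mem_univ _)
    simp only [CG.col, CG.val_zero] at this
    exact CG.c5_of_rel _ _ this
  rcases CG.cell_theorem (Fintype.card V + 1) D Finset.univ hs hl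
    (by rw [Finset.card_univ]; omega) hn with ⟨B, -, hB, hp⟩ | hT
  · have hBu : B = Finset.univ := by
      by_contra hne
      obtain ⟨c, hc⟩ := CG.crit_colour hcrit (S := (B : Set V)) (by
        intro h; exact hne (by exact_mod_cast h))
      apply hB
      refine ⟨fun v => (2 * c v, true), fun d hd h1 h2 => ?_⟩
      obtain ⟨u, v, h, rfl⟩ := (memD d).1 hd
      simp only [CG.col, CG.val_zero]
      exact CG.rel_of_c5 _ _ (hc u h1 v h2 h)
    subst hBu
    have h1 : CG.inn D Finset.univ = D := by
      ext d; simp [CG.mem_inn]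
    unfold CG.pot at hp
    rw [h1] at hp
    have h2 : ∑ d ∈ D, CG.cost d.k = 4 * (E.card : ℤ) := by
      rw [hD, Finset.sum_image (fun a _ b _ h => CG.gd_inj h)]
      simp [CG.gd, CG.cost0, mul_comm]
    have h3 : E.card = 2 * G.edgeSet.ncard := by
      rw [Set.ncard_eq_toFinset_card', ← SimpleGraph.edgeFinset,
        ← SimpleGraph.sum_degrees_eq_twice_card_edges, hE, Finset.card_filter,
        ← Finset.univ_product_univ, Finset.sum_product]
      refine Finset.sum_congr rfl fun v _ => ?_
      rw [← Finset.card_filter, ← SimpleGraph.card_neighborFinset_eq_degree,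
        SimpleGraph.neighborFinset_eq_filter]
    rw [h2, Finset.card_univ] at hp
    omega
  · exfalso
    rcases hT with ⟨P, Q, -, -, -, h⟩ | ⟨P, Q, S, -, -, -, h1, h2, h3⟩
    · obtain ⟨u, v, -, h⟩ := (memD _).1 h
      simp at h
    · have key : ∀ P Q : V × Fin 5, (⟨P, Q, 0⟩ : CG.Dart V) ∈ D → G.Adj P.1 Q.1 := by
        intro P Q h
        obtain ⟨u, v, h, h'⟩ := (memD _).1 h
        simp only [CG.Dart.mk.injEq] at h'
        rw [h'.1, h'.2.1]; exact h
      have a1 := key _ _ h1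
      have a2 := key _ _ h2
      have a3 := key _ _ h3
      generalize P.1 = a at a1 a3
      generalize Q.1 = b at a1 a2
      generalize S.1 = c at a2 a3
      have hu : ({a, b, c} : Set V) = Set.univ := by
        by_contra hne
        obtain ⟨f, hf⟩ := CG.crit_colour hcrit hne
        have f1 := CG.rel_of_c5 _ _ (hf a (by simp) b (by simp) a1)
        have f2 := CG.rel_of_c5 _ _ (hf b (by simp) c (by simp) a2)
        have f3 := CG.rel_of_c5 _ _ (hf c (by simp) a (by simp) a3)
        exact CG.no000 _ _ _ f1 f2 f3
      have hG : ∀ x y, G.Adj x y ↔ x ≠ y := by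
        intro x y
        have hx : x ∈ ({a, b, c} : Set V) := hu ▸ Set.mem_univ _
        have hy : y ∈ ({a, b, c} : Set V) := hu ▸ Set.mem_univ _
        simp only [Set.mem_insert_iff, Set.mem_singleton_iff] at hx hy
        refine ⟨fun h => h.ne, fun h => ?_⟩
        rcases hx with rfl | rfl | rfl <;> rcases hy with rfl | rfl | rfl <;>
          first
          | exact absurd rfl h
          | assumption
          | (apply SimpleGraph.Adj.symm; assumption)
      have hcard : Fintype.card V = 3 := by
        rw [← Finset.card_univ]
        have : (Finset.univ : Finset V) = {a, b, c} := by
          ext x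
          have hx : x ∈ ({a, b, c} : Set V) := hu ▸ Set.mem_univ _
          simpa using hx
        rw [this, Finset.card_eq_three]
        exact ⟨a, b, c, a1.ne, a3.ne.symm, a2.ne, rfl⟩
      have e : V ≃ Fin 3 := Fintype.equivFinOfCardEq hcard
      refine hC3.false ⟨e, fun {x y} => ?_⟩
      rw [hG]
      have : ∀ i j : Fin 3, (cycleGraph 3).Adj i j ↔ i ≠ j := by decide
      rw [this]
      exact e.injective.ne_iff
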